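/- Fix n ≥ 3, j ∈ {2,…,n-1}, and p with (2n - j - nj)/(n-1) < p < 1. There exists δ > 0 depending only on n and p such that for all λ ∈ (0,1) and all origin-symmetric convex bodies K, L with h_K, h_L ∈ C² and max{‖h_K - 1‖_{C²}, ‖h_L - 1‖_{C²}} < δ, one has V_j((1-λ)·K +_p λ·L) ≥ ((1-λ)V_j(K)^{p/j} + λV_j(L)^{p/j})^{j/p} (geometric mean on the right when p = 0), with equality if and only if K and L are dilates. -/

import Mathlib

open MeasureTheory Metric Matrix
open scoped RealInnerProductSpace Pointwise

noncomputable section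

abbrev Euc (n : ℕ) := EuclideanSpace ℝ (Fin n)

/-- The support function of a set `K ⊆ ℝⁿ`. -/
def suppFn {n : ℕ} (K : Set (Euc n)) (x : Euc n) : ℝ :=
  sSup ((fun y => ⟪x, y⟫) '' K)

/-- `κ_d`, the volume of the `d`-dimensional Euclidean unit ball. -/
def kappa (d : ℕ) : ℝ := (volume (ball (0 : Euc d) 1)).toReal

/-- The `(n-1)`-dimensional Hausdorff measure on the unit sphere. -/
def sphM (n : ℕ) : Measure (Euc n) := (μH[(n : ℝ) - 1]).restrict (sphere (0 : Euc n) 1)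

/-- The Wulff shape of `f`: the largest convex body whose support function is dominated by `f`. -/
def wulff {n : ℕ} (f : Euc n → ℝ) : Set (Euc n) :=
  {x | ∀ u : Euc n, ‖u‖ = 1 → ⟪x, u⟫ ≤ f u}

/-- The `p`-combination `((1-λ)a^p + λb^p)^{1/p}` (geometric mean for `p = 0`). -/
def combP (p lam a b : ℝ) : ℝ :=
  if p = 0 then a ^ (1 - lam) * b ^ lam
  else ((1 - lam) * a ^ p + lam * b ^ p) ^ (1 / p)

/-- The Hessian matrix (in the standard coordinates of `ℝⁿ`) of `h : ℝⁿ → ℝ` at `u`. -/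
def hessMat {n : ℕ} (h : Euc n → ℝ) (u : Euc n) : Matrix (Fin n) (Fin n) ℝ :=
  Matrix.of fun i k =>
    fderiv ℝ (fun x => fderiv ℝ h x (EuclideanSpace.single k 1)) u (EuclideanSpace.single i 1)

/-- `s_j`: the normalized `j`-th elementary symmetric function of the principal radii of
curvature (for a 1-homogeneous `h`, the `j`-th elementary symmetric function of the eigenvalues
of the full Hessian at `u`, read off the characteristic polynomial). -/
def sjFun (n j : ℕ) (h : Euc n → ℝ) (u : Euc n) : ℝ :=
  (((n - 1).choose j : ℝ))⁻¹ * ((-1 : ℝ) ^ j * ((hessMat h u).charpoly.coeff (n - j)))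

/-- A function `V : ℕ → Set ℝⁿ → ℝ` realizes the intrinsic volumes via the Steiner formula. -/
def steiner (n : ℕ) (V : ℕ → Set (Euc n) → ℝ) : Prop :=
  ∀ K : Set (Euc n), IsCompact K → Convex ℝ K → K.Nonempty → ∀ ρ : ℝ, 0 < ρ →
    (volume (K + closedBall (0 : Euc n) ρ)).toReal
      = ∑ i ∈ Finset.range (n + 1), ρ ^ (n - i) * kappa (n - i) * V i K

/-- `‖h_K - 1‖_{C²} < δ` on the sphere, encoded through the values, the first derivatives and
the Hessian entries of `h_K - ‖·‖`. -/
def C2Close (n : ℕ) (K : Set (Euc n)) (δ : ℝ) : Prop :=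
  ∀ u : Euc n, ‖u‖ = 1 →
    |suppFn K u - 1| < δ ∧
    ‖fderiv ℝ (fun x => suppFn K x - ‖x‖) u‖ < δ ∧
    ∀ i k : Fin n,
      |hessMat (suppFn K) u i k - hessMat (fun x : Euc n => ‖x‖) u i k| < δ

/-! ### Part A: elementary symmetric functions of a matrix -/

/-- The matrix `1 + X A` over the polynomial ring. -/
def genM {n : ℕ} (A : Matrix (Fin n) (Fin n) ℝ) : Matrix (Fin n) (Fin n) (Polynomial ℝ) :=
  1 + (Polynomial.X : Polynomial ℝ) • A.map Polynomial.C

/-- `e_k(A)`, the coefficient of `t^k` in `det (1 + t A)`. -/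
def esym {n : ℕ} (k : ℕ) (A : Matrix (Fin n) (Fin n) ℝ) : ℝ := (genM A).det.coeff k

/-- the derivative of `e_k`: coefficient of `t^k` in `t adj (1 + t A)`. -/
def Sm {n : ℕ} (k : ℕ) (A : Matrix (Fin n) (Fin n) ℝ) : Matrix (Fin n) (Fin n) ℝ :=
  Matrix.of fun i l => (Polynomial.X * (genM A).adjugate i l).coeff k

lemma coeff_interp (N k : ℕ) : ∃ c : ℕ → ℝ, ∀ P : Polynomial ℝ, P.natDegree ≤ N →
    P.coeff k = ∑ m ∈ Finset.range (N + 1), c m * P.eval (m : ℝ) := by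
  refine ⟨fun m => (Lagrange.basis (Finset.range (N+1)) (fun m : ℕ => (m : ℝ)) m).coeff k, ?_⟩
  intro P hP
  have h1 := Lagrange.eq_interpolate (s := Finset.range (N+1)) (v := fun m : ℕ => (m : ℝ)) (f := P)
    (fun a _ b _ h => by simpa using h) (by
      rw [Finset.card_range]
      exact lt_of_le_of_lt Polynomial.degree_le_natDegree (by exact_mod_cast Nat.lt_succ_of_le hP))
  conv_lhs => rw [h1]
  rw [Lagrange.interpolate_apply, Polynomial.finsetSum_coeff]
  refine Finset.sum_congr rfl fun m _ => ?_
  rw [Polynomial.coeff_C_mul, mul_comm]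

lemma genM_eval {n : ℕ} (A : Matrix (Fin n) (Fin n) ℝ) (t : ℝ) :
    (Polynomial.evalRingHom t).mapMatrix (genM A) = 1 + t • A := by
  ext i j
  by_cases h : i = j
  · simp [genM, h]; ring
  · simp [genM, h]; ring

lemma genM_det_eval {n : ℕ} (A : Matrix (Fin n) (Fin n) ℝ) (t : ℝ) :
    (genM A).det.eval t = (1 + t • A).det := by
  rw [← genM_eval, ← RingHom.map_det]; rfl

lemma genM_adj_eval {n : ℕ} (A : Matrix (Fin n) (Fin n) ℝ) (t : ℝ) (i l : Fin n) :
    ((genM A).adjugate i l).eval t = (1 + t • A).adjugate i l := by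
  rw [← genM_eval, ← RingHom.map_adjugate]; rfl

lemma genM_det_deg {n : ℕ} (A : Matrix (Fin n) (Fin n) ℝ) : (genM A).det.natDegree ≤ n := by
  have := Polynomial.natDegree_det_X_add_C_le A (1 : Matrix (Fin n) (Fin n) ℝ)
  rw [genM, add_comm]
  simpa using this

lemma genM_adj_deg {n : ℕ} (A : Matrix (Fin n) (Fin n) ℝ) (i l : Fin n) :
    ((genM A).adjugate i l).natDegree ≤ n := by
  have := Polynomial.natDegree_det_X_add_C_le (A.updateRow l 0)
    ((1 : Matrix (Fin n) (Fin n) ℝ).updateRow l (Pi.single i 1))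
  rw [adjugate_apply]
  have h2 : (genM A).updateRow l (Pi.single i 1) =
      (Polynomial.X : Polynomial ℝ) • (A.updateRow l 0).map Polynomial.C +
      ((1 : Matrix (Fin n) (Fin n) ℝ).updateRow l (Pi.single i 1)).map Polynomial.C := by
    ext a b
    by_cases h : a = l
    · subst h
      by_cases hb : b = i
      · subst hb; simp
      · simp [hb]
    · by_cases hb : a = b
      · simp [Matrix.updateRow_ne h, genM, Matrix.one_apply, if_pos hb]; ring
      · simp [Matrix.updateRow_ne h, genM, Matrix.one_apply, if_neg hb]
  rw [h2]
  simpa using this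

lemma det_eq_sum_esym {n : ℕ} (A : Matrix (Fin n) (Fin n) ℝ) (t : ℝ) :
    (1 + t • A).det = ∑ k ∈ Finset.range (n + 1), t ^ k * esym k A := by
  rw [← genM_det_eval, Polynomial.eval_eq_sum_range' (Nat.lt_succ_of_le (genM_det_deg A))]
  exact Finset.sum_congr rfl fun k _ => mul_comm _ _

/-- universal interpolation formulas -/
lemma esym_Sm_interp (n k : ℕ) : ∃ c : ℕ → ℝ,
    (∀ A : Matrix (Fin n) (Fin n) ℝ, esym k A =
      ∑ m ∈ Finset.range (n + 2), c m * (1 + (m : ℝ) • A).det) ∧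
    (∀ A : Matrix (Fin n) (Fin n) ℝ, Sm k A =
      ∑ m ∈ Finset.range (n + 2), (c m * m) • (1 + (m : ℝ) • A).adjugate) := by
  obtain ⟨c, hc⟩ := coeff_interp (n + 1) k
  refine ⟨c, fun A => ?_, fun A => ?_⟩
  · rw [esym, hc _ ((genM_det_deg A).trans (Nat.le_succ n))]
    simp only [genM_det_eval]
  · ext i l
    rw [Sm, Matrix.of_apply, hc, Matrix.sum_apply]
    · simp only [Polynomial.eval_mul, Polynomial.eval_X, genM_adj_eval, Matrix.smul_apply,
        smul_eq_mul, mul_assoc]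
    · refine Polynomial.natDegree_mul_le.trans ?_
      have := genM_adj_deg A i l
      rw [Polynomial.natDegree_X]; omega

lemma continuous_esym {n : ℕ} (k : ℕ) : Continuous (esym (n := n) k) := by
  obtain ⟨c, hc, -⟩ := esym_Sm_interp n k
  rw [show esym (n := n) k = fun A => _ from funext hc]
  refine continuous_finsetSum _ fun m _ => continuous_const.mul ?_
  exact Continuous.matrix_det (by fun_prop)

lemma continuous_Sm {n : ℕ} (k : ℕ) : Continuous (Sm (n := n) k) := by
  obtain ⟨c, -, hc⟩ := esym_Sm_interp n k
  rw [show Sm (n := n) k = fun A => _ from funext hc]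
  refine continuous_finsetSum _ fun m _ => ?_
  have h1 : Continuous fun A : Matrix (Fin n) (Fin n) ℝ => (1 + (m:ℝ) • A).adjugate :=
    Continuous.matrix_adjugate (by fun_prop)
  exact h1.const_smul (c m * (m:ℝ))

/-- Jacobi's formula. -/
lemma hasDerivAt_det {n : ℕ} (A B : Matrix (Fin n) (Fin n) ℝ) (s : ℝ) :
    HasDerivAt (fun s : ℝ => (A + s • B).det) (((A + s • B).adjugate * B).trace) s := by
  let f : ContinuousMultilinearMap ℝ (fun _ : Fin n => Fin n → ℝ) ℝ :=
    { (Matrix.detRowAlternating (n := Fin n) (R := ℝ)).toMultilinearMap with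
      cont := by
        exact (Continuous.matrix_det continuous_id : Continuous fun M : Matrix (Fin n) (Fin n) ℝ => M.det) }
  have hf : ∀ M : Matrix (Fin n) (Fin n) ℝ, f M = M.det := fun M => rfl
  have h1 := f.hasFDerivAt (fun i l => A i l + s * B i l)
  have h2 : HasDerivAt (fun s : ℝ => (fun i l => A i l + s * B i l : Fin n → Fin n → ℝ))
      (fun i l => B i l) s := by
    rw [hasDerivAt_pi]; intro i
    rw [hasDerivAt_pi]; intro l
    simpa using ((hasDerivAt_id s).mul_const (B i l)).const_add (A i l)
  have h3 := h1.comp_hasDerivAt s h2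
  convert! h3 using 1
  rw [ContinuousMultilinearMap.linearDeriv_apply]
  have h4 : ∀ i, f (Function.update (fun i l => A i l + s * B i l) i (B i)) =
      ((A + s • B)ᵀ.cramer (B i)) i := by
    intro i
    rw [cramer_transpose_apply]; rfl
  rw [Finset.sum_congr rfl fun i _ => h4 i, Matrix.trace_mul_comm]
  refine Finset.sum_congr rfl fun i _ => ?_
  have h5 : ((A + s • B)ᵀ.cramer (B i)) i = ∑ l, (A + s • B).adjugate l i * B i l := by
    rw [cramer_eq_adjugate_mulVec, ← adjugate_transpose]; rfl
  rw [h5, diag_apply, Matrix.mul_apply]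
  exact Finset.sum_congr rfl fun l _ => mul_comm _ _

lemma hasDerivAt_esym {n : ℕ} (k : ℕ) (A B : Matrix (Fin n) (Fin n) ℝ) (s : ℝ) :
    HasDerivAt (fun s : ℝ => esym k (A + s • B)) ((Sm k (A + s • B) * B).trace) s := by
  obtain ⟨c, h1, h2⟩ := esym_Sm_interp n k
  rw [h2, Finset.sum_mul, Matrix.trace_sum,
    show (fun s : ℝ => esym k (A + s • B)) = fun s : ℝ => _ from funext fun s => h1 (A + s • B)]
  refine HasDerivAt.fun_sum fun m _ => ?_
  have h3 := (hasDerivAt_det (1 + (m:ℝ) • A) ((m:ℝ) • B) s).const_mul (c m)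
  have h4 : ∀ s : ℝ, (1 + (m:ℝ) • A) + s • (m:ℝ) • B = 1 + (m:ℝ) • (A + s • B) := by
    intro s; rw [smul_add, smul_comm s, add_assoc]
  rw [h4, show (fun s : ℝ => c m * ((1 + (m:ℝ) • A) + s • (m:ℝ) • B).det) =
    fun s : ℝ => c m * (1 + (m:ℝ) • (A + s • B)).det from funext fun s => by rw [h4]] at h3
  refine h3.congr_deriv ?_
  rw [Matrix.smul_mul, Matrix.mul_smul, Matrix.trace_smul, Matrix.trace_smul, smul_eq_mul, smul_eq_mul,
    mul_assoc]

lemma vecMul_Sm {n : ℕ} (k : ℕ) (A : Matrix (Fin n) (Fin n) ℝ) (u : Fin n → ℝ)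
    (hu : u ᵥ* A = 0) : u ᵥ* Sm (k+1) A = esym k A • u := by
  have h0 : (fun i => Polynomial.C (u i)) ᵥ* genM A = fun i => Polynomial.C (u i) := by
    rw [genM, vecMul_add, vecMul_one, vecMul_smul]
    have : (fun i => Polynomial.C (u i)) ᵥ* A.map Polynomial.C = 0 := by
      ext1 i
      have := congrFun hu i
      simp only [vecMul, dotProduct, Matrix.map_apply, ← Polynomial.C_mul, ← map_sum] at this ⊢
      rw [this]; simp
    rw [this]; simp
  have h1 : (fun i => Polynomial.C (u i)) ᵥ* (genM A).adjugate =
      (genM A).det • fun i => Polynomial.C (u i) := by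
    conv_lhs => rw [← h0]
    rw [vecMul_vecMul, mul_adjugate, vecMul_smul, vecMul_one]
  ext l
  have h2 := congrArg (fun P => Polynomial.coeff P k) (congrFun h1 l)
  simp only [vecMul, dotProduct, Polynomial.finsetSum_coeff, Polynomial.coeff_C_mul, Pi.smul_apply,
    smul_eq_mul, Polynomial.coeff_mul_C] at h2 ⊢
  rw [esym, ← h2]
  simp [Sm]

lemma esym_smul {n : ℕ} (k : ℕ) (c : ℝ) (A : Matrix (Fin n) (Fin n) ℝ) :
    esym k (c • A) = c ^ k * esym k A := by
  have : (genM (c • A)).det = (genM A).det.comp (Polynomial.C c * Polynomial.X) := by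
    apply Polynomial.funext
    intro t
    rw [genM_det_eval, Polynomial.eval_comp, genM_det_eval, Polynomial.eval_mul, Polynomial.eval_C,
      Polynomial.eval_X, smul_smul, mul_comm c]
  rw [esym, this, Polynomial.comp_C_mul_X_coeff, mul_comm]; rfl

lemma Sm_smul {n : ℕ} (k : ℕ) (c : ℝ) (A : Matrix (Fin n) (Fin n) ℝ) :
    Sm (k+1) (c • A) = c ^ k • Sm (k+1) A := by
  ext i l
  have : (genM (c • A)).adjugate i l = ((genM A).adjugate i l).comp (Polynomial.C c * Polynomial.X) := by
    apply Polynomial.funext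
    intro t
    rw [genM_adj_eval, Polynomial.eval_comp, genM_adj_eval, Polynomial.eval_mul, Polynomial.eval_C,
      Polynomial.eval_X, smul_smul, mul_comm c]
  rw [Sm, Matrix.of_apply, this, Polynomial.coeff_X_mul, Polynomial.comp_C_mul_X_coeff,
    Matrix.smul_apply, Sm, Matrix.of_apply, Polynomial.coeff_X_mul, smul_eq_mul, mul_comm]

lemma esym_zero {n : ℕ} (A : Matrix (Fin n) (Fin n) ℝ) : esym 0 A = 1 := by
  have := det_eq_sum_esym A 0
  rw [Finset.sum_range_succ'] at this
  simpa using this.symm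

lemma esym_top {n : ℕ} (A : Matrix (Fin n) (Fin n) ℝ) (u : Fin n → ℝ) (h0 : u ≠ 0)
    (hu : u ᵥ* A = 0) : esym n A = 0 := by
  -- `u * Sm (n+1) A = esym n A u` and degree considerations
  have h1 : (fun i => Polynomial.C (u i)) ᵥ* genM A = fun i => Polynomial.C (u i) := by
    rw [genM, vecMul_add, vecMul_one, vecMul_smul]
    have : (fun i => Polynomial.C (u i)) ᵥ* A.map Polynomial.C = 0 := by
      ext1 i
      have := congrFun hu i
      simp only [vecMul, dotProduct, Matrix.map_apply, ← Polynomial.C_mul, ← map_sum] at this ⊢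
      rw [this]; simp
    rw [this]; simp
  have hd : A.det = 0 := by
    by_contra hd
    apply h0
    have : u ᵥ* A ᵥ* A⁻¹ = u := by
      rw [vecMul_vecMul, Matrix.mul_nonsing_inv _ (isUnit_iff_ne_zero.2 hd), vecMul_one]
    rw [← this, hu, zero_vecMul]
  have h2 : (genM A).det.coeff n = A.det := by
    have := Polynomial.coeff_det_X_add_C_card A (1 : Matrix (Fin n) (Fin n) ℝ)
    rw [genM, add_comm]
    simpa using this
  rw [esym, h2, hd]

/-- The projection onto the orthogonal complement of `u`. -/
def H0 {n : ℕ} (u : Fin n → ℝ) : Matrix (Fin n) (Fin n) ℝ := 1 - vecMulVec u u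

lemma det_H0 {n : ℕ} (hn : 1 ≤ n) (u : Fin n → ℝ) (hu : u ⬝ᵥ u = 1) (t : ℝ) (ht : 1 + t ≠ 0) :
    (1 + t • H0 u).det = (1 + t) ^ (n - 1) := by
  have h1 : 1 + t • H0 u = (1 + t) • (1 + replicateCol Unit ((-t / (1+t)) • u) * replicateRow Unit u) := by
    ext i j
    simp [H0, vecMulVec_apply, Matrix.mul_apply]
    field_simp
    ring
  rw [h1, det_smul, det_one_add_replicateCol_mul_replicateRow, dotProduct_smul, hu, Fintype.card_fin]
  obtain ⟨m, rfl⟩ : ∃ m, n = m + 1 := ⟨n - 1, by omega⟩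
  simp only [Nat.add_sub_cancel, smul_eq_mul, pow_succ]
  field_simp
  ring

lemma adj_H0 {n : ℕ} (hn : 2 ≤ n) (u : Fin n → ℝ) (hu : u ⬝ᵥ u = 1) (t : ℝ) (ht : 1 + t ≠ 0) :
    (1 + t • H0 u).adjugate = (1 + t) ^ (n - 2) • (1 + t • vecMulVec u u) := by
  have h2 : (1 + t • H0 u) * (1 + t • vecMulVec u u) = (1 + t) • 1 := by
    have h3 : vecMulVec u u * vecMulVec u u = vecMulVec u u := by
      rw [vecMulVec_mul_vecMulVec, hu]; simp
    simp only [H0]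
    simp only [smul_sub, add_mul, sub_mul, mul_add, one_mul, mul_one, smul_mul_smul_comm, h3,
      add_smul, one_smul]
    abel
  have h4 : (1 + t) • (1 + t • H0 u).adjugate = (1+t)^(n-1) • (1 + t • vecMulVec u u) := by
    rw [← det_H0 (by omega) u hu t ht]
    calc (1 + t) • (1 + t • H0 u).adjugate = (1 + t • H0 u).adjugate * ((1 + t) • 1) := by simp
      _ = _ := by rw [← h2, ← mul_assoc, adjugate_mul]; simp
  obtain ⟨m, rfl⟩ : ∃ m, n = m + 2 := ⟨n - 2, by omega⟩
  have h5 : m + 2 - 1 = m + 1 := by omega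
  rw [h5, pow_succ, mul_comm, mul_smul] at h4
  have := smul_right_injective _ ht h4
  simpa using this

lemma poly_eq_of_nat {P Q : Polynomial ℝ} (h : ∀ m : ℕ, P.eval (m:ℝ) = Q.eval (m:ℝ)) : P = Q := by
  apply Polynomial.eq_of_infinite_eval_eq
  refine Set.infinite_of_injective_forall_mem (f := fun m : ℕ => (m:ℝ)) Nat.cast_injective ?_
  exact h

lemma esym_H0 {n : ℕ} (hn : 1 ≤ n) (u : Fin n → ℝ) (hu : u ⬝ᵥ u = 1) (k : ℕ) :
    esym k (H0 u) = ((n - 1).choose k : ℝ) := by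
  have : (genM (H0 u)).det = (1 + Polynomial.X) ^ (n - 1) := by
    apply poly_eq_of_nat
    intro m
    rw [genM_det_eval, det_H0 hn u hu _ (by positivity)]; simp
  rw [esym, this, Polynomial.coeff_one_add_X_pow]

/-- quadratic form of `S_k` at the ball: first coefficient `C(n-2,k)`, combined coefficient. -/
lemma Sm_H0 {n : ℕ} (hn : 2 ≤ n) (u : Fin n → ℝ) (hu : u ⬝ᵥ u = 1) (k : ℕ) :
    Sm (k+1) (H0 u) = ((n - 2).choose k : ℝ) • (1 : Matrix (Fin n) (Fin n) ℝ) +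
      (((n - 1).choose k : ℝ) - ((n - 2).choose k : ℝ)) • vecMulVec u u := by
  ext i l
  have : (genM (H0 u)).adjugate i l = (1 + Polynomial.X) ^ (n - 2) * Polynomial.C ((1 : Matrix (Fin n) (Fin n) ℝ) i l)
      + ((1 + Polynomial.X) ^ (n - 1) - (1 + Polynomial.X) ^ (n - 2)) * Polynomial.C (u i * u l) := by
    apply poly_eq_of_nat
    intro m
    rw [genM_adj_eval, adj_H0 hn u hu _ (by positivity)]
    obtain ⟨q, rfl⟩ : ∃ q, n = q + 2 := ⟨n - 2, by omega⟩
    have h5 : q + 2 - 1 = q + 1 := by omega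
    simp [h5, pow_succ, vecMulVec_apply]
    ring
  simp only [Sm, Matrix.of_apply, Polynomial.coeff_X_mul, this, Polynomial.coeff_add,
    Polynomial.coeff_mul_C, Polynomial.coeff_sub, Polynomial.coeff_one_add_X_pow, Matrix.add_apply,
    Matrix.smul_apply, vecMulVec_apply, smul_eq_mul]

/-- matrix of a continuous linear map in the standard basis -/
def matOf {n : ℕ} (L : Euc n →L[ℝ] Euc n) : Matrix (Fin n) (Fin n) ℝ :=
  Matrix.of fun i l => L (EuclideanSpace.single l 1) i

def Jac {n : ℕ} (Φ : Euc n → Euc n) (x : Euc n) : Matrix (Fin n) (Fin n) ℝ :=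
  matOf (fderiv ℝ Φ x)

lemma matOf_add {n : ℕ} (L M : Euc n →L[ℝ] Euc n) : matOf (L + M) = matOf L + matOf M := by
  ext i l; simp [matOf]

lemma matOf_smul {n : ℕ} (c : ℝ) (L : Euc n →L[ℝ] Euc n) : matOf (c • L) = c • matOf L := by
  ext i l; simp [matOf]

lemma matOf_id {n : ℕ} : matOf (ContinuousLinearMap.id ℝ (Euc n)) = 1 := by
  ext i l; simp [matOf, Matrix.one_apply]

lemma matOf_zero {n : ℕ} : matOf (0 : Euc n →L[ℝ] Euc n) = 0 := by
  ext i l; simp [matOf]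

lemma continuous_matOf {n : ℕ} : Continuous (matOf (n := n)) := by
  refine continuous_matrix fun i l => ?_
  simp only [matOf, Matrix.of_apply]
  fun_prop

lemma matOf_mulVec {n : ℕ} (L : Euc n →L[ℝ] Euc n) (x : Euc n) (i : Fin n) :
    L x i = (matOf L *ᵥ x) i := by
  have : x = ∑ l, x l • EuclideanSpace.single l (1:ℝ) := by
    ext m; simp [Finset.sum_apply, Pi.single_apply]
  conv_lhs => rw [this]
  simp [matOf, Matrix.mulVec, dotProduct, Finset.sum_apply, mul_comm]

lemma det_matOf {n : ℕ} (L : Euc n →L[ℝ] Euc n) : L.det = (matOf L).det := by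
  rw [ContinuousLinearMap.det, ← LinearMap.det_toMatrix (EuclideanSpace.basisFun (Fin n) ℝ).toBasis]
  congr 1

lemma esym_of_gt {n k : ℕ} (hk : n < k) (A : Matrix (Fin n) (Fin n) ℝ) : esym k A = 0 :=
  Polynomial.coeff_eq_zero_of_natDegree_lt (lt_of_le_of_lt (genM_det_deg A) hk)

lemma esym_mat_zero {n k : ℕ} (hk : 1 ≤ k) : esym k (0 : Matrix (Fin n) (Fin n) ℝ) = 0 := by
  have := esym_smul k 0 (0 : Matrix (Fin n) (Fin n) ℝ)
  rw [zero_pow (by omega)] at this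
  simpa using this

/-- differentiation under the integral -/
lemma hasDerivAt_int_esym {n : ℕ} {X : Type*} [MetricSpace X] [SecondCountableTopology X]
    [MeasurableSpace X] [BorelSpace X] (μ : Measure X) [IsFiniteMeasureOnCompacts μ]
    (T : Set X) (hT : IsCompact T) (k : ℕ) (g : X → ℝ) (A B : X → Matrix (Fin n) (Fin n) ℝ)
    (hg : ContinuousOn g T) (hA : ContinuousOn A T) (hB : ContinuousOn B T) (s : ℝ) :
    HasDerivAt (fun s : ℝ => ∫ x in T, g x * esym k (A x + s • B x) ∂μ)
      (∫ x in T, g x * (Sm k (A x + s • B x) * B x).trace ∂μ) s := by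
  have hTm := hT.measurableSet
  have hAB : ContinuousOn (fun q : ℝ × X => A q.2 + q.1 • B q.2) (Set.univ ×ˢ T) := by
    have h2 : Set.MapsTo (Prod.snd : ℝ × X → X) (Set.univ ×ˢ T) T := fun q hq => hq.2
    exact (hA.comp continuousOn_snd h2).add (continuousOn_fst.smul (hB.comp continuousOn_snd h2))
  have h2 : Set.MapsTo (Prod.snd : ℝ × X → X) (Set.univ ×ˢ T) T := fun q hq => hq.2
  have hF : ContinuousOn (fun q : ℝ × X => g q.2 * (Sm k (A q.2 + q.1 • B q.2) * B q.2).trace)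
      (Set.univ ×ˢ T) := by
    refine (hg.comp continuousOn_snd h2).mul ?_
    refine Continuous.comp_continuousOn (g := fun M : Matrix (Fin n) (Fin n) ℝ => M.trace)
      (continuous_id.matrix_trace) ?_
    have := ((continuous_Sm (n := n) k).comp_continuousOn hAB)
    have hB' := hB.comp continuousOn_snd h2
    exact ContinuousOn.mul this hB'
  have hG : ContinuousOn (fun q : ℝ × X => g q.2 * esym k (A q.2 + q.1 • B q.2))
      (Set.univ ×ˢ T) :=
    (hg.comp continuousOn_snd h2).mul ((continuous_esym (n := n) k).comp_continuousOn hAB)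
  have sec : ∀ (r : ℝ) (F : ℝ × X → ℝ), ContinuousOn F (Set.univ ×ˢ T) →
      ContinuousOn (fun x => F (r, x)) T := fun r F hF =>
    hF.comp (by fun_prop) (fun x hx => ⟨trivial, hx⟩)
  obtain ⟨C, hC⟩ := ((isCompact_Icc (a := s - 1) (b := s + 1)).prod hT).exists_bound_of_continuousOn
    (hF.mono (Set.prod_mono_left (Set.subset_univ _)))
  have := isFiniteMeasure_restrict.2 (hT.measure_lt_top (μ := μ)).ne
  refine (hasDerivAt_integral_of_dominated_loc_of_deriv_le (μ := μ.restrict T)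
    (F := fun (s : ℝ) x => g x * esym k (A x + s • B x))
    (F' := fun (s : ℝ) x => g x * (Sm k (A x + s • B x) * B x).trace)
    (bound := fun _ => C) (s := Set.Icc (s - 1) (s + 1)) ?_ ?_ ?_ ?_ ?_ ?_ ?_).2
  · exact Icc_mem_nhds (by linarith) (by linarith)
  · exact Filter.Eventually.of_forall fun r => (sec r _ hG).aestronglyMeasurable hTm
  · exact (sec s _ hG).integrableOn_compact hT
  · exact (sec s _ hF).aestronglyMeasurable hTm
  · refine (ae_restrict_iff' hTm).2 (Filter.Eventually.of_forall fun x hx r hr => ?_)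
    exact hC (r, x) ⟨hr, hx⟩
  · exact integrable_const _
  · refine Filter.Eventually.of_forall fun x r _ => ?_
    exact (hasDerivAt_esym k (A x) (B x) r).const_mul _

lemma B1 {n : ℕ} (Φ : Euc n → Euc n) (h1 : ContDiff ℝ 1 Φ) (hc : HasCompactSupport Φ)
    (k : ℕ) (hk : 1 ≤ k) : ∫ x, esym k (Jac Φ x) = 0 := by
  obtain ⟨C, hC⟩ := h1.lipschitzWith_of_hasCompactSupport hc (by norm_num)
  obtain ⟨R, hR⟩ := hc.isCompact.isBounded.subset_closedBall (0 : Euc n)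
  set B := closedBall (0 : Euc n) R with hBdef
  have hBc : IsCompact B := isCompact_closedBall _ _
  have hout : ∀ x, x ∉ B → Φ x = 0 := fun x hx =>
    image_eq_zero_of_notMem_tsupport fun h => hx (hR h)
  have hJc : Continuous (Jac Φ) :=
    continuous_matOf.comp (h1.continuous_fderiv (by norm_num))
  have hJout : ∀ x, x ∉ B → Jac Φ x = 0 := fun x hx => by
    have : fderiv ℝ Φ x = 0 :=
      image_eq_zero_of_notMem_tsupport fun h => hx (hR (tsupport_fderiv_subset ℝ h))
    simp [Jac, this, matOf_zero]
  have hInteg : ∀ m, IntegrableOn (fun x => esym m (Jac Φ x)) B := fun m =>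
    (((continuous_esym m).comp hJc).continuousOn).integrableOn_compact hBc
  -- the volume identity
  have hvol : ∀ᶠ t : ℝ in nhds 0, ∫ x in B, (1 + t • Jac Φ x).det = (volume B).toReal := by
    have e1 : ∀ᶠ t : ℝ in nhds 0, ∀ x ∈ B, 0 < (1 + t • Jac Φ x).det := by
      refine hBc.eventually_forall_of_forall_eventually fun x hx => ?_
      have hcont : Continuous (fun q : ℝ × Euc n => (1 + q.1 • Jac Φ q.2).det) := by
        refine Continuous.matrix_det ?_
        fun_prop
      have : (0:ℝ) < (fun q : ℝ × Euc n => (1 + q.1 • Jac Φ q.2).det) (0, x) := by simp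
      exact hcont.continuousAt.eventually (lt_mem_nhds this)
    have e2 : ∀ᶠ t : ℝ in nhds 0, |t| * C < 1 := by
      have : Continuous fun t : ℝ => |t| * C := by fun_prop
      exact this.continuousAt.eventually (gt_mem_nhds (by simp))
    filter_upwards [e1, e2] with t ht1 ht2
    set f : Euc n → Euc n := fun x => x + t • Φ x with hf
    have hlip : ∀ x y, ‖t • Φ x - t • Φ y‖ ≤ |t| * C * ‖x - y‖ := fun x y => by
      rw [← smul_sub, norm_smul, Real.norm_eq_abs, mul_assoc]
      exact mul_le_mul_of_nonneg_left (by simpa using hC.norm_sub_le x y) (abs_nonneg t)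
    have hinj : Function.Injective f := fun x y hxy => by
      have h3 : x - y = -(t • Φ x - t • Φ y) := by
        have : x + t • Φ x = y + t • Φ y := hxy
        have h5 : x = y + t • Φ y - t • Φ x := by rw [← this]; abel
        conv_lhs => rw [h5]
        abel
      have h4 := hlip x y
      rw [← norm_neg, ← h3] at h4
      have : ‖x - y‖ = 0 := by nlinarith [norm_nonneg (x - y)]
      exact sub_eq_zero.1 (norm_eq_zero.1 this)
    have hsurj : Function.Surjective f := fun y => by
      have hcw : ContractingWith ⟨|t| * C, by positivity⟩ (fun x => y - t • Φ x) := by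
        refine ⟨by exact_mod_cast ht2, LipschitzWith.of_dist_le_mul fun a b => ?_⟩
        rw [dist_eq_norm, dist_eq_norm]
        have := hlip b a
        rw [norm_sub_rev b a] at this
        have e : (y - t • Φ a) - (y - t • Φ b) = t • Φ b - t • Φ a := by abel
        show ‖(y - t • Φ a) - (y - t • Φ b)‖ ≤ |t| * C * ‖a - b‖
        rw [e]; exact this
      refine ⟨hcw.fixedPoint _, ?_⟩
      have := hcw.fixedPoint_isFixedPt
      have h5 : y - t • Φ (ContractingWith.fixedPoint _ hcw) = ContractingWith.fixedPoint _ hcw := this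
      generalize ContractingWith.fixedPoint _ hcw = z at h5
      show z + t • Φ z = y
      rw [sub_eq_iff_eq_add] at h5
      exact h5.symm
    have himg : f '' B = B := by
      ext y; constructor
      · rintro ⟨x, hx, rfl⟩
        by_contra hy
        have : f (f x) = f x := by
          show f x + t • Φ (f x) = f x
          rw [hout _ hy]; simp
        have := hinj this
        rw [this] at hy; exact hy hx
      · intro hy
        obtain ⟨x, rfl⟩ := hsurj y
        refine ⟨x, ?_, rfl⟩
        by_contra hx
        have : f x = x := by show x + t • Φ x = x; rw [hout _ hx]; simp
        rw [this] at hy; exact hx hy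
    have hder : ∀ x ∈ B, HasFDerivWithinAt f
        (ContinuousLinearMap.id ℝ (Euc n) + t • fderiv ℝ Φ x) B x := fun x _ => by
      have := ((h1.differentiable (by norm_num)) x).hasFDerivAt
      exact ((hasFDerivAt_id x).add (this.const_smul t)).hasFDerivWithinAt
    have := integral_image_eq_integral_abs_det_fderiv_smul volume hBc.measurableSet hder
      hinj.injOn (fun _ => (1:ℝ))
    rw [himg] at this
    simp only [integral_const, smul_eq_mul, mul_one, measureReal_restrict_apply_univ] at this
    rw [← Measure.real, this]
    refine setIntegral_congr_fun hBc.measurableSet fun x hx => ?_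
    have hd : (ContinuousLinearMap.id ℝ (Euc n) + t • fderiv ℝ Φ x).det = (1 + t • Jac Φ x).det := by
      rw [det_matOf, matOf_add, matOf_smul, matOf_id, Jac]
    show _ = |_|
    rw [hd, abs_of_pos (ht1 x hx)]
  -- polynomial
  rcases Nat.lt_or_ge n k with h | h
  · simp [esym_of_gt h]
  set P : Polynomial ℝ := ∑ m ∈ Finset.range (n+1),
    Polynomial.monomial m (∫ x in B, esym m (Jac Φ x)) with hP
  have hPe : ∀ t, P.eval t = ∫ x in B, (1 + t • Jac Φ x).det := fun t => by
    simp only [det_eq_sum_esym, hP, Polynomial.eval_finsetSum, Polynomial.eval_monomial]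
    rw [integral_finsetSum _ fun m _ => (hInteg m).const_mul _]
    refine Finset.sum_congr rfl fun m _ => ?_
    rw [integral_const_mul, mul_comm]
  have hPc : P = Polynomial.C (volume B).toReal := by
    apply Polynomial.eq_of_infinite_eval_eq
    have : {t : ℝ | ∫ x in B, (1 + t • Jac Φ x).det = (volume B).toReal} ∈ nhds (0:ℝ) := hvol
    refine (infinite_of_mem_nhds 0 this).mono fun t ht => ?_
    simp only [Set.mem_ofPred_eq, hPe, Polynomial.eval_C]
    exact ht
  have hck := congrArg (fun Q => Polynomial.coeff Q k) hPc
  simp only [hP, Polynomial.finsetSum_coeff, Polynomial.coeff_monomial, Polynomial.coeff_C] at hck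
  rw [Finset.sum_ite_eq' , if_pos (Finset.mem_range.2 (by omega)), if_neg (by omega)] at hck
  rw [← hck, setIntegral_eq_integral_of_forall_compl_eq_zero]
  intro x hx
  rw [hJout x hx, esym_mat_zero hk]

lemma B2 {n : ℕ} (Φ Z : Euc n → Euc n) (h1 : ContDiff ℝ 1 Φ) (hc : HasCompactSupport Φ)
    (h2 : ContDiff ℝ 1 Z) (hZ : HasCompactSupport Z)
    (k : ℕ) (hk : 1 ≤ k) : ∫ x, (Sm k (Jac Φ x) * Jac Z x).trace = 0 := by
  obtain ⟨R, hR⟩ := hc.isCompact.isBounded.subset_closedBall (0 : Euc n)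
  obtain ⟨R', hR'⟩ := hZ.isCompact.isBounded.subset_closedBall (0 : Euc n)
  set B := closedBall (0 : Euc n) (max R R') with hBdef
  have hBc : IsCompact B := isCompact_closedBall _ _
  have hJ1 : Continuous (Jac Φ) := continuous_matOf.comp (h1.continuous_fderiv (by norm_num))
  have hJ2 : Continuous (Jac Z) := continuous_matOf.comp (h2.continuous_fderiv (by norm_num))
  have out : ∀ x, x ∉ B → Jac Φ x = 0 ∧ Jac Z x = 0 := fun x hx => by
    constructor
    · have : fderiv ℝ Φ x = 0 := image_eq_zero_of_notMem_tsupport fun h => hx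
        (closedBall_subset_closedBall (le_max_left _ _) (hR (tsupport_fderiv_subset ℝ h)))
      simp [Jac, this, matOf_zero]
    · have : fderiv ℝ Z x = 0 := image_eq_zero_of_notMem_tsupport fun h => hx
        (closedBall_subset_closedBall (le_max_right _ _) (hR' (tsupport_fderiv_subset ℝ h)))
      simp [Jac, this, matOf_zero]
  have hd := hasDerivAt_int_esym volume B hBc k (fun _ => 1) (Jac Φ) (Jac Z)
    continuousOn_const hJ1.continuousOn hJ2.continuousOn 0
  have hz : ∀ s : ℝ, ∫ x in B, (1:ℝ) * esym k (Jac Φ x + s • Jac Z x) = 0 := fun s => by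
    have := B1 (fun x => Φ x + s • Z x) (h1.add (h2.const_smul s))
      (hc.add (hZ.smul_left (f := fun _ => s))) k hk
    rw [← this, setIntegral_eq_integral_of_forall_compl_eq_zero]
    · congr 1; ext x
      rw [one_mul, Jac, Jac, Jac, fderiv_fun_add, fderiv_fun_const_smul, matOf_add, matOf_smul]
      · exact h2.differentiable (by norm_num) x
      · exact h1.differentiable (by norm_num) x
      · exact (h2.differentiable (by norm_num) x).const_smul s
    · intro x hx
      rw [(out x hx).1, (out x hx).2]; simp [esym_mat_zero hk]
  simp only [hz] at hd
  have := hd.unique (hasDerivAt_const 0 0)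
  simp only [zero_smul, add_zero, one_mul] at this
  rw [← this, setIntegral_eq_integral_of_forall_compl_eq_zero]
  intro x hx
  rw [(out x hx).2]; simp

abbrev sgm (n : ℕ) : Measure (sphere (0 : Euc n) 1) := (volume : Measure (Euc n)).toSphere

lemma hsp_apply {n : ℕ} (F : Euc n → ℝ) (v : ℝ → ℝ) (g : Euc n → ℝ)
    (hF : ∀ r : ℝ, 0 < r → ∀ u : Euc n, ‖u‖ = 1 → F (r • u) = v r * g u)
    (x : ({(0 : Euc n)}ᶜ : Set (Euc n))) :
    F x = (fun q : sphere (0 : Euc n) 1 × Set.Ioi (0:ℝ) => g q.1 * v q.2)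
      (homeomorphUnitSphereProd (Euc n) x) := by
  have hx : (x : Euc n) ≠ 0 := x.2
  have hx' : 0 < ‖(x : Euc n)‖ := norm_pos_iff.2 hx
  have e : (x : Euc n) = ‖(x : Euc n)‖ • (‖(x : Euc n)‖⁻¹ • (x : Euc n)) := by
    rw [smul_smul, mul_inv_cancel₀ hx'.ne', one_smul]
  conv_lhs => rw [e]
  rw [hF _ hx' _ (by rw [norm_smul, norm_inv, norm_norm, inv_mul_cancel₀ hx'.ne'])]
  simp [mul_comm]

lemma polar {n : ℕ} (F : Euc n → ℝ) (v : ℝ → ℝ) (g : Euc n → ℝ)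
    (hn : 1 ≤ n)
    (hF : ∀ r : ℝ, 0 < r → ∀ u : Euc n, ‖u‖ = 1 → F (r • u) = v r * g u) :
    ∫ x, F x = (∫ r in Set.Ioi (0:ℝ), r ^ (n-1) * v r) * ∫ u, g u ∂(sgm n) := by
  have : Nonempty (Fin n) := ⟨⟨0, by omega⟩⟩
  calc
    ∫ x, F x = ∫ x : ({(0)}ᶜ : Set (Euc n)), F x.1 ∂((volume : Measure (Euc n)).comap (↑)) := by
      rw [integral_subtype_comap (measurableSet_singleton _).compl fun x ↦ F x,
        restrict_compl_singleton]
    _ = ∫ q, g q.1 * v q.2 ∂(sgm n).prod (.volumeIoiPow (Module.finrank ℝ (Euc n) - 1)) := by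
      simp only [hsp_apply F v g hF]
      exact (volume : Measure (Euc n)).measurePreserving_homeomorphUnitSphereProd.integral_comp
        (Homeomorph.measurableEmbedding _)
        (fun q : sphere (0 : Euc n) 1 × Set.Ioi (0:ℝ) => g q.1 * v q.2)
    _ = (∫ u, g u ∂(sgm n)) * ∫ x : Set.Ioi (0 : ℝ), v x ∂.volumeIoiPow (n - 1) := by
      rw [finrank_euclideanSpace_fin]
      exact integral_prod_mul (μ := sgm n) (fun u => g u) (fun x : Set.Ioi (0:ℝ) => v x)
    _ = _ := by
      rw [mul_comm]; congr 1
      simp only [Measure.volumeIoiPow, ENNReal.ofReal]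
      rw [integral_withDensity_eq_integral_smul,
        integral_subtype_comap measurableSet_Ioi fun a ↦ Real.toNNReal (a ^ (n - 1)) • v a,
        setIntegral_congr_fun measurableSet_Ioi fun x hx ↦ ?_]
      · rw [NNReal.smul_def, Real.coe_toNNReal _ (pow_nonneg (le_of_lt hx) _)]; rfl
      · exact (measurable_subtype_coe.pow_const _).real_toNNReal

lemma polar_integrable {n : ℕ} (F : Euc n → ℝ) (v : ℝ → ℝ) (g : Euc n → ℝ)
    (hn : 1 ≤ n)
    (hF : ∀ r : ℝ, 0 < r → ∀ u : Euc n, ‖u‖ = 1 → F (r • u) = v r * g u)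
    (hv : IntegrableOn (fun r => r ^ (n-1) * v r) (Set.Ioi 0))
    (hg : Integrable (fun u : sphere (0 : Euc n) 1 => g u) (sgm n)) : Integrable F := by
  have : Nonempty (Fin n) := ⟨⟨0, by omega⟩⟩
  have h2 : Integrable (fun x : Set.Ioi (0:ℝ) => v x) (.volumeIoiPow (n - 1)) := by
    rw [Measure.volumeIoiPow, integrable_withDensity_iff_integrable_smul']
    · rw [integrableOn_iff_comap_subtypeVal measurableSet_Ioi] at hv
      refine hv.congr (Filter.Eventually.of_forall ?_)
      rintro ⟨x, hx : 0 < x⟩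
      simp (disch := positivity) [ENNReal.toReal_ofReal]
    · fun_prop
    · simp
  have h3 := hg.mul_prod h2
  have h4 := ((volume : Measure (Euc n)).measurePreserving_homeomorphUnitSphereProd.integrable_comp_emb
    (Homeomorph.measurableEmbedding _)
    (g := (fun q : sphere (0 : Euc n) 1 × Set.Ioi (0:ℝ) => g q.1 * v q.2))).2
    (by rw [finrank_euclideanSpace_fin]; exact h3)
  rw [← restrict_compl_singleton (μ := (volume : Measure (Euc n))) 0, ← IntegrableOn,
    integrableOn_iff_comap_subtypeVal (by measurability)]
  refine h4.congr (Filter.Eventually.of_forall fun x => ?_)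
  exact (hsp_apply F v g hF x).symm

lemma integrable_sph {n : ℕ} {g : Euc n → ℝ} (hg : ContinuousOn g (sphere 0 1)) :
    Integrable (fun u : sphere (0 : Euc n) 1 => g u) (sgm n) := by
  have : Continuous (fun u : sphere (0 : Euc n) 1 => g u) := continuousOn_iff_continuous_domRestrict.1 hg
  exact this.integrable_of_hasCompactSupport (HasCompactSupport.of_compactSpace _)

structure SF {n : ℕ} (h : Euc n → ℝ) : Prop where
  c2 : ContDiffOn ℝ 2 h {(0 : Euc n)}ᶜ
  hom : ∀ c : ℝ, 0 < c → ∀ x, h (c • x) = c * h x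
  even : ∀ x, h (-x) = h x

def Hs {n : ℕ} (h : Euc n → ℝ) (x : Euc n) : Matrix (Fin n) (Fin n) ℝ := Jac (gradient h) x

lemma SF.cda {n : ℕ} {h : Euc n → ℝ} (H : SF h) {x : Euc n} (hx : x ≠ 0) : ContDiffAt ℝ 2 h x :=
  H.c2.contDiffAt (isOpen_compl_singleton.mem_nhds hx)

lemma SF.diff {n : ℕ} {h : Euc n → ℝ} (H : SF h) {x : Euc n} (hx : x ≠ 0) :
    DifferentiableAt ℝ h x := (H.cda hx).differentiableAt (by norm_num)

lemma SF.add {n : ℕ} {h g : Euc n → ℝ} (H : SF h) (G : SF g) : SF (fun x => h x + g x) :=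
  ⟨H.c2.add G.c2, fun c hc x => by rw [H.hom c hc, G.hom c hc]; ring,
    fun x => by rw [H.even, G.even]⟩

lemma SF.smul {n : ℕ} {h : Euc n → ℝ} (H : SF h) (s : ℝ) : SF (fun x => s * h x) :=
  ⟨contDiffOn_const.mul H.c2, fun c hc x => by rw [H.hom c hc]; ring,
    fun x => by rw [H.even]⟩

lemma SF.sub {n : ℕ} {h g : Euc n → ℝ} (H : SF h) (G : SF g) : SF (fun x => h x - g x) :=
  ⟨H.c2.sub G.c2, fun c hc x => by rw [H.hom c hc, G.hom c hc]; ring,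
    fun x => by rw [H.even, G.even]⟩

lemma grad_cda {n : ℕ} {h : Euc n → ℝ} {x : Euc n} (H : ContDiffAt ℝ 2 h x) :
    ContDiffAt ℝ 1 (gradient h) x := by
  have h1 : ContDiffAt ℝ 1 (fderiv ℝ h) x := H.fderiv_right (by norm_num)
  have h2 : ContDiff ℝ 1 (fun L : StrongDual ℝ (Euc n) => (InnerProductSpace.toDual ℝ (Euc n)).symm L) :=
    (InnerProductSpace.toDual ℝ (Euc n)).symm.contDiff
  exact h2.contDiffAt.comp x h1

lemma SF.gcda {n : ℕ} {h : Euc n → ℝ} (H : SF h) {x : Euc n} (hx : x ≠ 0) :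
    ContDiffAt ℝ 1 (gradient h) x := grad_cda (H.cda hx)

lemma SF.gcd {n : ℕ} {h : Euc n → ℝ} (H : SF h) : ContDiffOn ℝ 1 (gradient h) {(0 : Euc n)}ᶜ :=
  fun _ hx => (H.gcda hx).contDiffWithinAt

lemma SF.gdiff {n : ℕ} {h : Euc n → ℝ} (H : SF h) {x : Euc n} (hx : x ≠ 0) :
    DifferentiableAt ℝ (gradient h) x := (H.gcda hx).differentiableAt (by norm_num)

lemma jac_cont {n : ℕ} {V : Euc n → Euc n} (hV : ContDiffOn ℝ 1 V {(0 : Euc n)}ᶜ) :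
    ContinuousOn (Jac V) {(0 : Euc n)}ᶜ := by
  have := hV.continuousOn_fderiv_of_isOpen isOpen_compl_singleton (by norm_num)
  exact continuous_matOf.comp_continuousOn this

lemma SF.hs_cont {n : ℕ} {h : Euc n → ℝ} (H : SF h) : ContinuousOn (Hs h) {(0 : Euc n)}ᶜ :=
  jac_cont H.gcd

lemma SF.g_cont {n : ℕ} {h : Euc n → ℝ} (H : SF h) : ContinuousOn (gradient h) {(0 : Euc n)}ᶜ :=
  H.gcd.continuousOn

lemma grad_add {n : ℕ} {h g : Euc n → ℝ} {x : Euc n} (H : DifferentiableAt ℝ h x)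
    (G : DifferentiableAt ℝ g x) :
    gradient (fun x => h x + g x) x = gradient h x + gradient g x := by
  simp only [gradient]; rw [fderiv_fun_add H G, map_add]

lemma grad_smul {n : ℕ} {h : Euc n → ℝ} {x : Euc n} (s : ℝ) (H : DifferentiableAt ℝ h x) :
    gradient (fun x => s * h x) x = s • gradient h x := by
  simp only [gradient]; rw [fderiv_const_mul H, map_smul]

lemma SF.hs_add {n : ℕ} {h g : Euc n → ℝ} (H : SF h) (G : SF g) {x : Euc n} (hx : x ≠ 0) :
    Hs (fun x => h x + g x) x = Hs h x + Hs g x := by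
  have : gradient (fun x => h x + g x) =ᶠ[nhds x] fun x => gradient h x + gradient g x := by
    filter_upwards [isOpen_compl_singleton.mem_nhds hx] with y hy
    exact grad_add (H.diff hy) (G.diff hy)
  rw [Hs, Jac, this.fderiv_eq, fderiv_fun_add (H.gdiff hx) (G.gdiff hx), matOf_add]; rfl

lemma SF.hs_smul {n : ℕ} {h : Euc n → ℝ} (H : SF h) (s : ℝ) {x : Euc n} (hx : x ≠ 0) :
    Hs (fun x => s * h x) x = s • Hs h x := by
  have : gradient (fun x => s * h x) =ᶠ[nhds x] fun x => s • gradient h x := by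
    filter_upwards [isOpen_compl_singleton.mem_nhds hx] with y hy
    exact grad_smul s (H.diff hy)
  rw [Hs, Jac, this.fderiv_eq, fderiv_fun_const_smul (H.gdiff hx), matOf_smul]; rfl

lemma SF.g_hom {n : ℕ} {h : Euc n → ℝ} (H : SF h) (c : ℝ) (hc : 0 < c) (x : Euc n) (hx : x ≠ 0) :
    gradient h (c • x) = gradient h x := by
  have h1 : fderiv ℝ (fun x => h (c • x)) x = c • fderiv ℝ h (c • x) := fderiv_comp_smul c
  have h2 : (fun x => h (c • x)) = fun x => c * h x := by ext y; exact H.hom c hc y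
  rw [h2, fderiv_const_mul (H.diff hx)] at h1
  have h3 := smul_right_injective _ hc.ne' h1
  simp only [gradient]; rw [h3]

lemma jac_hom {n : ℕ} {V : Euc n → Euc n} {a : ℕ} (hV : DifferentiableOn ℝ V {(0 : Euc n)}ᶜ)
    (hom : ∀ c : ℝ, 0 < c → ∀ x : Euc n, x ≠ 0 → V (c • x) = c ^ a • V x) (c : ℝ) (hc : 0 < c)
    (x : Euc n) (hx : x ≠ 0) : Jac V (c • x) = (c⁻¹ * c ^ a) • Jac V x := by
  have h1 : fderiv ℝ (fun x => V (c • x)) x = c • fderiv ℝ V (c • x) := fderiv_comp_smul c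
  have h2 : (fun x => V (c • x)) =ᶠ[nhds x] fun x => c ^ a • V x := by
    filter_upwards [isOpen_compl_singleton.mem_nhds hx] with y hy
    exact hom c hc y hy
  rw [h2.fderiv_eq, fderiv_fun_const_smul] at h1
  · have : fderiv ℝ V (c • x) = (c⁻¹ * c ^ a) • fderiv ℝ V x := by
      rw [mul_smul, h1, smul_smul, inv_mul_cancel₀ hc.ne', one_smul]
    rw [Jac, this, matOf_smul]; rfl
  · exact (hV x hx).differentiableAt (isOpen_compl_singleton.mem_nhds hx)

lemma SF.hs_hom {n : ℕ} {h : Euc n → ℝ} (H : SF h) (c : ℝ) (hc : 0 < c) (x : Euc n) (hx : x ≠ 0) :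
    Hs h (c • x) = c⁻¹ • Hs h x := by
  have := jac_hom (a := 0) (V := gradient h) (H.gcd.differentiableOn (by norm_num))
    (fun c hc x hx => by rw [H.g_hom c hc x hx]; simp) c hc x hx
  simpa [Hs] using this

lemma SF.euler {n : ℕ} {h : Euc n → ℝ} (H : SF h) (x : Euc n) (hx : x ≠ 0) :
    ⟪x, gradient h x⟫ = h x := by
  rw [real_inner_comm, inner_gradient_left]
  have h1 : HasDerivAt (fun t : ℝ => h (t • x)) (fderiv ℝ h x x) 1 := by
    have h0 : HasDerivAt (fun t : ℝ => t • x) ((1:ℝ) • x) 1 := (hasDerivAt_id (1:ℝ)).smul_const x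
    have h2 : HasFDerivAt h (fderiv ℝ h x) ((1:ℝ) • x) := by
      rw [one_smul]; exact (H.diff hx).hasFDerivAt
    have h3 := h2.comp_hasDerivAt (1:ℝ) h0
    rw [one_smul] at h3
    exact h3
  have h2 : HasDerivAt (fun t : ℝ => h (t • x)) (h x) 1 := by
    have : HasDerivAt (fun t : ℝ => t * h x) (1 * h x) 1 := (hasDerivAt_id (1:ℝ)).mul_const (h x)
    rw [one_mul] at this
    refine this.congr_of_eventuallyEq ?_
    filter_upwards [lt_mem_nhds (zero_lt_one' ℝ)] with t ht
    exact H.hom t ht x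
  exact h1.unique h2

lemma vecMul_matOf {n : ℕ} (L : Euc n →L[ℝ] Euc n) (x : Euc n) (l : Fin n) :
    ((x : Fin n → ℝ) ᵥ* matOf L) l = ⟪x, L (EuclideanSpace.single l 1)⟫ := by
  simp [Matrix.vecMul, dotProduct, matOf, PiLp.inner_apply, mul_comm]

lemma SF.vecMul_hs {n : ℕ} {h : Euc n → ℝ} (H : SF h) (x : Euc n) (hx : x ≠ 0) :
    (x : Fin n → ℝ) ᵥ* Hs h x = 0 := by
  ext l
  rw [Hs, Jac, vecMul_matOf]
  set v : Euc n := EuclideanSpace.single l 1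
  have h1 : HasFDerivAt (fun y => ⟪y, gradient h y⟫)
      ((fderivInnerCLM ℝ (x, gradient h x)).comp
        ((ContinuousLinearMap.id ℝ _).prod (fderiv ℝ (gradient h) x))) x :=
    (hasFDerivAt_id x).inner ℝ (H.gdiff hx).hasFDerivAt
  have h2 : HasFDerivAt (fun y => ⟪y, gradient h y⟫) (fderiv ℝ h x) x := by
    refine (H.diff hx).hasFDerivAt.congr_of_eventuallyEq ?_
    filter_upwards [isOpen_compl_singleton.mem_nhds hx] with y hy
    exact H.euler y hy
  have h3 := congrArg (fun L => L v) (h1.unique h2)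
  simp only [ContinuousLinearMap.comp_apply, ContinuousLinearMap.prod_apply, fderivInnerCLM_apply,
    ContinuousLinearMap.id_apply] at h3
  rw [← inner_gradient_left, real_inner_comm v] at h3
  simpa using h3

lemma inner_eq_dot {n : ℕ} (x y : Euc n) : ⟪x, y⟫ = (x : Fin n → ℝ) ⬝ᵥ y := by
  simp [PiLp.inner_apply, dotProduct, mul_comm]

lemma trace_mul_vecMulVec {n : ℕ} (S : Matrix (Fin n) (Fin n) ℝ) (a b : Fin n → ℝ) :
    (S * vecMulVec a b).trace = b ⬝ᵥ (S *ᵥ a) := by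
  rw [Matrix.mul_vecMulVec, Matrix.trace_vecMulVec, dotProduct_comm]

lemma grad_apply {n : ℕ} (φ : Euc n → ℝ) (x : Euc n) (l : Fin n) :
    (gradient φ x) l = fderiv ℝ φ x (EuclideanSpace.single l 1) := by
  rw [← inner_gradient_left]
  simp only [EuclideanSpace.inner_single_right, one_mul, conj_trivial]

lemma jac_smul {n : ℕ} {φ : Euc n → ℝ} {V : Euc n → Euc n} {x : Euc n}
    (hφ : DifferentiableAt ℝ φ x) (hV : DifferentiableAt ℝ V x) :
    Jac (fun y => φ y • V y) x = φ x • Jac V x +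
      vecMulVec (V x : Fin n → ℝ) ((gradient φ x : Euc n) : Fin n → ℝ) := by
  rw [Jac, fderiv_fun_smul hφ hV, matOf_add, matOf_smul]
  congr 1
  ext i l
  simp only [matOf, Matrix.of_apply, ContinuousLinearMap.smulRight_apply, vecMulVec_apply,
    PiLp.smul_apply, smul_eq_mul]
  rw [grad_apply, mul_comm]

lemma grad_radial {n : ℕ} {χ : ℝ → ℝ} {x : Euc n} (hx : x ≠ 0) (hχ : DifferentiableAt ℝ χ ‖x‖) :
    gradient (fun y : Euc n => χ ‖y‖) x = (deriv χ ‖x‖ * ‖x‖⁻¹) • x := by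
  have h1 : HasFDerivAt (fun y : Euc n => ‖y‖) (fderiv ℝ (fun y : Euc n => ‖y‖) x) x :=
    ((contDiffAt_norm ℝ hx).differentiableAt (n := 1) (by norm_num)).hasFDerivAt
  have h2 := hχ.hasDerivAt.comp_hasFDerivAt x h1
  have h3 : fderiv ℝ (fun y : Euc n => χ ‖y‖) x
     = deriv χ ‖x‖ • fderiv ℝ (fun y : Euc n => ‖y‖) x := h2.fderiv
  apply ext_inner_right ℝ
  intro v
  rw [inner_gradient_left, h3]
  have h4 : HasFDerivAt (fun y : Euc n => ‖y‖ ^ 2) (2 • innerSL ℝ x) x := (hasStrictFDerivAt_norm_sq x).hasFDerivAt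
  have h5 := (h1.pow 2).unique h4
  have h6 := congrArg (fun L => L v) h5
  simp at h6
  have hpos : ‖x‖ ≠ 0 := norm_ne_zero_iff.2 hx
  rw [inner_smul_left]
  simp only [_root_.smul_apply, smul_eq_mul, conj_trivial]
  have : fderiv ℝ (fun y : Euc n => ‖y‖) x v = ‖x‖⁻¹ * ⟪x, v⟫ := by
    field_simp
    have e : (fun y : Euc n => ‖y‖) = norm := rfl
    rw [e]
    nlinarith
  rw [this]; ring

lemma cd_of_zero_near {n : ℕ} {F : Type*} [NormedAddCommGroup F] [NormedSpace ℝ F] {m : ℕ}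
    {f : Euc n → F} (h1 : ContDiffOn ℝ m f {(0 : Euc n)}ᶜ) {ε : ℝ} (hε : 0 < ε)
    (h2 : ∀ x, ‖x‖ < ε → f x = 0) : ContDiff ℝ m f := by
  rw [contDiff_iff_contDiffAt]
  intro x
  by_cases hx : x = 0
  · subst hx
    have : f =ᶠ[nhds 0] fun _ => 0 := by
      filter_upwards [ball_mem_nhds (0 : Euc n) hε] with y hy
      exact h2 y (by simpa using hy)
    exact contDiffAt_const.congr_of_eventuallyEq this
  · exact h1.contDiffAt (isOpen_compl_singleton.mem_nhds hx)

lemma sphere_ibp {n : ℕ} {h : Euc n → ℝ} (H : SF h) {V : Euc n → Euc n} {a : ℕ}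
    (hV : ContDiffOn ℝ 1 V {(0 : Euc n)}ᶜ)
    (hom : ∀ c : ℝ, 0 < c → ∀ x : Euc n, x ≠ 0 → V (c • x) = c ^ a • V x)
    (m : ℕ) (hm : m + 1 ≤ n - 1) :
    ∫ u, (Sm (m+1) (Hs h u) * Jac V u).trace ∂(sgm n)
      = ((n:ℝ) - (m+1) + a) * ∫ u, esym m (Hs h u) * ⟪(u : Euc n), V u⟫ ∂(sgm n) := by
  have hVd : DifferentiableOn ℝ V {(0 : Euc n)}ᶜ := hV.differentiableOn (by norm_num)
  have hn : 1 ≤ n := by omega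
  -- cut-offs
  let χ : ContDiffBump (2:ℝ) := ⟨1/2, 1, by norm_num, by norm_num⟩
  let ζ : ContDiffBump (5:ℝ) := ⟨44/10, 47/10, by norm_num, by norm_num⟩
  have hχ0 : ∀ r : ℝ, r ∉ Set.Icc (1:ℝ) 3 → χ r = 0 ∧ deriv χ r = 0 := fun r hr => by
    have : r ∉ tsupport χ := by
      rw [χ.tsupport_eq, Real.closedBall_eq_Icc]
      simpa [χ, show (2:ℝ) - 1 = 1 by norm_num, show (2:ℝ) + 1 = 3 by norm_num] using hr
    exact ⟨image_eq_zero_of_notMem_tsupport this,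
      image_eq_zero_of_notMem_tsupport fun h => this (tsupport_deriv_subset h)⟩
  set Φ : Euc n → Euc n := gradient (fun x => ζ (‖x‖^2) * h x) with hΦ
  set Z : Euc n → Euc n := fun x => χ ‖x‖ • V x with hZ
  have hζh : ContDiff ℝ 2 (fun x : Euc n => ζ (‖x‖^2) * h x) := by
    refine cd_of_zero_near (m := 2) (ε := 1/2) ?_ (by norm_num) ?_
    · refine ContDiffOn.mul ?_ H.c2
      exact (ζ.contDiff.comp (contDiff_norm_sq ℝ)).contDiffOn
    · intro x hx
      rw [ζ.zero_of_le_dist, zero_mul]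
      rw [Real.dist_eq, abs_of_neg (by nlinarith [norm_nonneg x])]
      show (47/10:ℝ) ≤ _
      nlinarith [norm_nonneg x]
  have hΦ1 : ContDiff ℝ 1 Φ := contDiff_iff_contDiffAt.2 fun x => grad_cda hζh.contDiffAt
  have hΦc : HasCompactSupport Φ := by
    refine HasCompactSupport.intro (isCompact_closedBall (0 : Euc n) 10) fun x hx => ?_
    have hx : 10 < ‖x‖ := by simpa using hx
    have : (fun x : Euc n => ζ (‖x‖^2) * h x) =ᶠ[nhds x] fun _ => 0 := by
      filter_upwards [continuous_norm.continuousAt.eventually (lt_mem_nhds hx)] with y hy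
      rw [ζ.zero_of_le_dist, zero_mul]
      rw [Real.dist_eq, abs_of_pos (by nlinarith [norm_nonneg x])]
      show (47/10:ℝ) ≤ _
      nlinarith [norm_nonneg x]
    show gradient _ x = 0
    rw [this.gradient_eq]
    simp [gradient]
  have hZ1 : ContDiff ℝ 1 Z := by
    refine cd_of_zero_near (m := 1) (ε := 1/2) ?_ (by norm_num) ?_
    · refine ContDiffOn.smul (f := fun x : Euc n => χ ‖x‖) ?_ hV
      intro x hx
      exact (χ.contDiff.contDiffAt.comp x (contDiffAt_norm ℝ hx)).contDiffWithinAt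
    · intro x hx
      show χ ‖x‖ • V x = 0
      rw [(hχ0 _ _).1, zero_smul]
      intro hh; linarith [hh.1]
  have hZc : HasCompactSupport Z := by
    refine HasCompactSupport.intro (isCompact_closedBall (0 : Euc n) 10) fun x hx => ?_
    have hx : 10 < ‖x‖ := by simpa using hx
    show χ ‖x‖ • V x = 0
    rw [(hχ0 _ _).1, zero_smul]
    intro hh; linarith [hh.2]
  have key := B2 Φ Z hΦ1 hΦc hZ1 hZc (m+1) (by omega)
  -- polar form
  set T : Euc n → ℝ := fun u => (Sm (m+1) (Hs h u) * Jac V u).trace with hT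
  set G : Euc n → ℝ := fun u => esym m (Hs h u) * ⟪u, V u⟫ with hG
  set v1 : ℝ → ℝ := fun r => χ r * ((r⁻¹)^m * (r⁻¹ * r^a)) with hv1
  set v2 : ℝ → ℝ := fun r => deriv χ r * ((r⁻¹)^m * r^a) with hv2
  set F1 : Euc n → ℝ := fun x => v1 ‖x‖ * T (‖x‖⁻¹ • x) with hF1
  set F2 : Euc n → ℝ := fun x => v2 ‖x‖ * G (‖x‖⁻¹ • x) with hF2
  have nrm : ∀ r : ℝ, 0 < r → ∀ u : Euc n, ‖u‖ = 1 → ‖r • u‖ = r ∧ (‖r • u‖)⁻¹ • (r • u) = u := by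
    intro r hr u hu
    have : ‖r • u‖ = r := by rw [norm_smul, hu, mul_one, Real.norm_of_nonneg hr.le]
    refine ⟨this, ?_⟩
    rw [this, smul_smul, inv_mul_cancel₀ hr.ne', one_smul]
  have p1 : ∀ r : ℝ, 0 < r → ∀ u : Euc n, ‖u‖ = 1 → F1 (r • u) = v1 r * T u := fun r hr u hu => by
    obtain ⟨e1, e2⟩ := nrm r hr u hu
    simp only [hF1]; rw [e2, e1]
  have p2 : ∀ r : ℝ, 0 < r → ∀ u : Euc n, ‖u‖ = 1 → F2 (r • u) = v2 r * G u := fun r hr u hu => by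
    obtain ⟨e1, e2⟩ := nrm r hr u hu
    simp only [hF2]; rw [e2, e1]
  have sph0 : sphere (0 : Euc n) 1 ⊆ {(0 : Euc n)}ᶜ := fun u hu h0 => by
    rw [mem_sphere_zero_iff_norm, h0] at hu; simp at hu
  have cT : ContinuousOn T (sphere 0 1) := by
    refine Continuous.comp_continuousOn (g := fun M : Matrix (Fin n) (Fin n) ℝ => M.trace)
      (continuous_id.matrix_trace) ?_
    exact ContinuousOn.mul ((continuous_Sm (n := n) (m+1)).comp_continuousOn (H.hs_cont.mono sph0))
      ((jac_cont hV).mono sph0)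
  have cG : ContinuousOn G (sphere 0 1) := by
    refine ContinuousOn.mul ((continuous_esym (n := n) m).comp_continuousOn (H.hs_cont.mono sph0)) ?_
    exact continuousOn_id.inner (hV.continuousOn.mono sph0)
  -- 1-D integrals
  have pw1 : ∀ r ∈ Set.Ioi (0:ℝ), r^(n-1) * v1 r = χ r * r^(n-1-(m+1)+a) := fun r hr => by
    have hr : 0 < r := hr
    have e : n - 1 = (n-1-(m+1)) + (m+1) := by omega
    simp only [hv1]
    conv_lhs => rw [e]
    simp only [pow_add, inv_pow]
    field_simp
  have pw2 : ∀ r ∈ Set.Ioi (0:ℝ), r^(n-1) * v2 r = deriv χ r * r^(n-1-(m+1)+a+1) := fun r hr => by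
    have hr : 0 < r := hr
    have e : n - 1 = (n-1-(m+1)) + (m+1) := by omega
    simp only [hv2]
    conv_lhs => rw [e]
    simp only [pow_add, inv_pow]
    field_simp
  set N := n-1-(m+1)+a with hN
  have cχ' : Continuous (deriv χ) := χ.contDiff.continuous_deriv (n := 1) (by norm_num)
  have i1' : Integrable (fun r : ℝ => χ r * r^N) :=
    (χ.continuous.mul (by fun_prop)).integrable_of_hasCompactSupport (χ.hasCompactSupport.mul_right)
  have i2' : Integrable (fun r : ℝ => deriv χ r * r^(N+1)) :=
    (cχ'.mul (by fun_prop)).integrable_of_hasCompactSupport (χ.hasCompactSupport.deriv.mul_right)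
  have i1 : IntegrableOn (fun r => r ^ (n-1) * v1 r) (Set.Ioi 0) :=
    i1'.integrableOn.congr_fun (fun r hr => (pw1 r hr).symm) measurableSet_Ioi
  have i2 : IntegrableOn (fun r => r ^ (n-1) * v2 r) (Set.Ioi 0) :=
    i2'.integrableOn.congr_fun (fun r hr => (pw2 r hr).symm) measurableSet_Ioi
  have I1 := polar_integrable F1 v1 T hn p1 i1 (integrable_sph cT)
  have I2 := polar_integrable F2 v2 G hn p2 i2 (integrable_sph cG)
  have split : ∀ x, x ≠ 0 → (Sm (m+1) (Jac Φ x) * Jac Z x).trace = F1 x + F2 x := by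
    intro x hx
    have hxp : 0 < ‖x‖ := norm_pos_iff.2 hx
    have hVx : DifferentiableAt ℝ V x := (hVd x hx).differentiableAt (isOpen_compl_singleton.mem_nhds hx)
    have hχd : DifferentiableAt ℝ χ ‖x‖ := (χ.contDiff (n := 1)).differentiable (by norm_num) _
    have hJZ : Jac Z x = χ ‖x‖ • Jac V x + vecMulVec (V x : Fin n → ℝ)
        (((deriv χ ‖x‖ * ‖x‖⁻¹) • x : Euc n) : Fin n → ℝ) := by
      rw [hZ, jac_smul (φ := fun y => χ ‖y‖) _ hVx, grad_radial hx hχd]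
      exact hχd.comp x ((contDiffAt_norm ℝ hx).differentiableAt (n := 1) (by norm_num))
    by_cases hr : ‖x‖ ∈ Set.Icc (1:ℝ) 3
    · have hloc : (fun x => ζ (‖x‖^2) * h x) =ᶠ[nhds x] h := by
        have : ∀ᶠ y : Euc n in nhds x, ‖y‖^2 ∈ ball (5:ℝ) (44/10) := by
          apply (continuous_norm.pow 2).continuousAt.eventually
          apply isOpen_ball.mem_nhds
          rw [Metric.mem_ball, Real.dist_eq, abs_lt]
          show -(44/10) < ‖x‖^2 - 5 ∧ ‖x‖^2 - 5 < 44/10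
          constructor <;> nlinarith [hr.1, hr.2]
        filter_upwards [this] with y hy
        rw [ζ.one_of_mem_closedBall (ball_subset_closedBall hy), one_mul]
      have hJΦ : Jac Φ x = Hs h x := by
        rw [Hs, Jac, Jac, hloc.gradient.fderiv_eq]
      set u := ‖x‖⁻¹ • x with hu
      have hun : ‖u‖ = 1 := by rw [hu, norm_smul, norm_inv, norm_norm, inv_mul_cancel₀ hxp.ne']
      have hu0 : u ≠ 0 := norm_ne_zero_iff.1 (by rw [hun]; norm_num)
      have hxu : x = ‖x‖ • u := by rw [hu, smul_smul, mul_inv_cancel₀ hxp.ne', one_smul]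
      set r := ‖x‖ with hrdef
      rw [hJΦ, hJZ, hF1, hF2]
      simp only [← hrdef, ← hu]
      rw [mul_add, trace_add]
      congr 1
      · rw [hxu, H.hs_hom r hxp u hu0, Sm_smul, jac_hom hVd hom r hxp u hu0]
        simp only [hv1, hT, Matrix.mul_smul, Matrix.smul_mul, trace_smul, smul_eq_mul]
        ring
      · rw [trace_mul_vecMulVec]
        have e1 : (((deriv χ r * r⁻¹) • x : Euc n) : Fin n → ℝ) = deriv χ r • (u : Fin n → ℝ) := by
          ext i; simp [hu]; ring
        have hz : (u : Fin n → ℝ) ᵥ* (r⁻¹ • Hs h u) = 0 := by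
          rw [vecMul_smul, H.vecMul_hs u hu0, smul_zero]
        rw [e1]
        conv_lhs => rw [hxu, H.hs_hom r hxp u hu0, hom r hxp u hu0]
        rw [dotProduct_mulVec, smul_vecMul, vecMul_Sm m _ _ hz, esym_smul]
        simp only [hv2, hG, inner_eq_dot, WithLp.ofLp_smul, dotProduct_smul, smul_dotProduct, smul_eq_mul]
        ring
    · have h0 := hχ0 _ hr
      have : Jac Z x = 0 := by
        rw [hJZ, h0.1, h0.2]; simp
      rw [this, hF1, hF2]
      simp only [hv1, hv2, h0.1, h0.2]
      simp
  have key2 : ∫ x, (F1 x + F2 x) = 0 := by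
    rw [← key]
    have : Nonempty (Fin n) := ⟨⟨0, hn⟩⟩
    refine integral_congr_ae ?_
    have h0 : ∀ᵐ x : Euc n, x ≠ 0 := by simp [ae_iff]
    filter_upwards [h0] with x hx using (split x hx).symm
  rw [integral_add I1 I2, polar F1 v1 T hn p1, polar F2 v2 G hn p2,
    setIntegral_congr_fun measurableSet_Ioi pw1, setIntegral_congr_fun measurableSet_Ioi pw2] at key2
  have toR : ∀ f : ℝ → ℝ, (∀ r, r ∉ Set.Icc (1:ℝ) 3 → f r = 0) → ∫ r in Set.Ioi (0:ℝ), f r = ∫ r, f r := by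
    intro f hf
    apply setIntegral_eq_integral_of_forall_compl_eq_zero
    intro r hr; apply hf; intro h2; apply hr; show 0 < r; linarith [h2.1]
  rw [toR (fun r => χ r * r ^ N) (fun r hr => by simp only [(hχ0 r hr).1, zero_mul]),
    toR (fun r => deriv χ r * r ^ (N+1)) (fun r hr => by simp only [(hχ0 r hr).2, zero_mul])] at key2
  have ibp : ∫ r, deriv χ r * r^(N+1) = -(((N:ℝ)+1) * ∫ r, χ r * r^N) := by
    have := integral_mul_deriv_eq_deriv_mul_of_integrable (u := χ) (v := fun r : ℝ => r^(N+1))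
      (u' := deriv χ) (v' := fun r => ((N:ℝ)+1) * r^N)
      (fun r _ => ((χ.contDiff (n := 1)).differentiable (by norm_num) r).hasDerivAt)
      (fun r _ => by simpa using hasDerivAt_pow (N+1) r) ?_ ?_ ?_
    · rw [eq_comm, neg_eq_iff_eq_neg, ← this, ← integral_const_mul]
      congr 1; ext r; ring
    · refine (i1'.const_mul ((N:ℝ)+1)).congr (Filter.Eventually.of_forall fun r => ?_)
      simp only [Pi.mul_apply]; ring
    · exact i2'
    · exact (χ.continuous.mul (by fun_prop)).integrable_of_hasCompactSupport (χ.hasCompactSupport.mul_right)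
  have posA : 0 < ∫ r, χ r * r^N := by
    rw [← toR (fun r => χ r * r ^ N) (fun r hr => by simp only [(hχ0 r hr).1, zero_mul])]
    rw [setIntegral_pos_iff_support_of_nonneg_ae]
    · have : Set.Ioo (1:ℝ) 3 ⊆ Function.support (fun r => χ r * r ^ N) ∩ Set.Ioi 0 := by
        intro r hr
        refine ⟨?_, by show 0 < r; linarith [hr.1]⟩
        have h1 : 0 < χ r := χ.pos_of_mem_ball (by
          rw [Metric.mem_ball, Real.dist_eq, abs_lt]; show _ ∧ _ < (1:ℝ)
          constructor
          · show -(1:ℝ) < _; linarith [hr.1]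
          · linarith [hr.2])
        have : 0 < r := by linarith [hr.1]
        simp only [Function.mem_support]; positivity
      exact lt_of_lt_of_le (by simp) (measure_mono this)
    · refine (ae_restrict_iff' measurableSet_Ioi).2 (Filter.Eventually.of_forall fun r hr => ?_)
      have hr : 0 < r := hr
      exact mul_nonneg χ.nonneg (by positivity)
    · exact i1'.integrableOn
  rw [ibp] at key2
  have hNc : (N:ℝ) + 1 = (n:ℝ) - (m+1) + a := by
    rw [hN]
    have : n - 1 - (m+1) + a + 1 + (m + 1) = n + a := by omega
    have : ((n - 1 - (m+1) + a : ℕ):ℝ) + 1 + (m+1) = n + a := by exact_mod_cast this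
    linarith
  rw [hNc] at key2
  have : (∫ r, χ r * r^N) * ((∫ u, T u ∂(sgm n)) - ((n:ℝ) - (m+1) + a) * ∫ u, G u ∂(sgm n)) = 0 := by
    linarith
  rcases mul_eq_zero.1 this with h | h
  · exact absurd h posA.ne'
  · linarith

lemma sph_ne {n : ℕ} (u : sphere (0 : Euc n) 1) : (u : Euc n) ≠ 0 := fun h0 => by
  have := mem_sphere_zero_iff_norm.1 u.2
  rw [h0] at this; simp at this

lemma sph_sub {n : ℕ} : sphere (0 : Euc n) 1 ⊆ {(0 : Euc n)}ᶜ := fun u hu => sph_ne ⟨u, hu⟩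

/-- the gradient as a coordinate vector -/
def gv {n : ℕ} (ψ : Euc n → ℝ) (x : Euc n) : Fin n → ℝ := (gradient ψ x).ofLp

lemma F1 {n : ℕ} {h ψ : Euc n → ℝ} (H : SF h) (Ψ : SF ψ) (m : ℕ) (hm : m + 1 ≤ n - 1) :
    ∫ u, (Sm (m+1) (Hs h u) * Hs ψ u).trace ∂(sgm n)
      = ((n:ℝ) - (m+1)) * ∫ u, ψ u * esym m (Hs h u) ∂(sgm n) := by
  have := sphere_ibp H (V := gradient ψ) (a := 0) Ψ.gcd
    (fun c hc x hx => by rw [Ψ.g_hom c hc x hx]; simp) m hm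
  simp only [Nat.cast_zero, add_zero] at this
  refine Eq.trans this ?_
  congr 1
  refine integral_congr_ae (Filter.Eventually.of_forall fun u => ?_)
  simp only []
  rw [Ψ.euler u (sph_ne u), mul_comm]

lemma F2 {n : ℕ} {h ψ : Euc n → ℝ} (H : SF h) (Ψ : SF ψ) (m : ℕ) (hm : m + 1 ≤ n - 1) :
    ∫ u, (ψ u * (Sm (m+1) (Hs h u) * Hs ψ u).trace) ∂(sgm n)
      = ((n:ℝ) - m) * ∫ u, ψ u ^ 2 * esym m (Hs h u) ∂(sgm n)
        - ∫ u, gv ψ u ⬝ᵥ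
            (Sm (m+1) (Hs h u) *ᵥ gv ψ u) ∂(sgm n) := by
  have h1 := sphere_ibp H (V := fun x => ψ x • gradient ψ x) (a := 1)
    ((Ψ.c2.of_le (by norm_num)).smul Ψ.gcd)
    (fun c hc x hx => by rw [Ψ.g_hom c hc x hx, Ψ.hom c hc, pow_one, smul_smul]) m hm
  have cS : ContinuousOn (fun x => Sm (m+1) (Hs h x)) (sphere 0 1) :=
    (continuous_Sm (n := n) (m+1)).comp_continuousOn (H.hs_cont.mono sph_sub)
  have i1 : Integrable (fun u : sphere (0 : Euc n) 1 =>
      (ψ u * (Sm (m+1) (Hs h u) * Hs ψ u).trace)) (sgm n) := by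
    apply integrable_sph (g := fun u => ψ u * (Sm (m+1) (Hs h u) * Hs ψ u).trace)
    refine (Ψ.c2.continuousOn.mono sph_sub).mul ?_
    refine Continuous.comp_continuousOn (g := fun M : Matrix (Fin n) (Fin n) ℝ => M.trace)
      (continuous_id.matrix_trace) ?_
    exact cS.mul (Ψ.hs_cont.mono sph_sub)
  have cg : ContinuousOn (fun x => gv ψ x) (sphere (0 : Euc n) 1) :=
    (PiLp.continuous_ofLp 2 _).comp_continuousOn (Ψ.g_cont.mono sph_sub)
  have i2 : Integrable (fun u : sphere (0 : Euc n) 1 => gv ψ u ⬝ᵥ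
            (Sm (m+1) (Hs h u) *ᵥ gv ψ u)) (sgm n) := by
    apply integrable_sph (g := fun u => gv ψ u ⬝ᵥ
            (Sm (m+1) (Hs h u) *ᵥ gv ψ u))
    have : Continuous (fun q : Matrix (Fin n) (Fin n) ℝ × (Fin n → ℝ) => q.2 ⬝ᵥ (q.1 *ᵥ q.2)) := by
      exact continuous_snd.dotProduct (continuous_fst.matrix_mulVec continuous_snd)
    exact this.comp_continuousOn (cS.prodMk cg)
  rw [eq_sub_iff_add_eq, ← integral_add i1 i2]
  have e1 : ((n:ℝ) - (m+1) + (1:ℕ)) = (n:ℝ) - m := by push_cast; ring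
  rw [e1] at h1
  have e2 : ∀ u : sphere (0 : Euc n) 1, esym m (Hs h u) * ⟪(u : Euc n), ψ u • gradient ψ (u : Euc n)⟫
      = ψ u ^ 2 * esym m (Hs h u) := fun u => by
    rw [inner_smul_right, Ψ.euler u (sph_ne u)]; ring
  simp only [e2] at h1
  rw [← h1]
  refine integral_congr_ae (Filter.Eventually.of_forall fun u => ?_)
  show _ = (Sm (m+1) (Hs h u) * Jac (fun x => ψ x • gradient ψ x) u).trace
  rw [jac_smul (Ψ.diff (sph_ne u)) (Ψ.gdiff (sph_ne u)), mul_add, trace_add, trace_mul_vecMulVec,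
    Matrix.mul_smul, trace_smul]
  rfl

lemma le_suppFn {n : ℕ} {K : Set (Euc n)} (hK : IsCompact K) (x : Euc n) {y : Euc n} (hy : y ∈ K) :
    ⟪x, y⟫ ≤ suppFn K x :=
  le_csSup (hK.image (by fun_prop)).bddAbove ⟨y, hy, rfl⟩

lemma exists_suppFn {n : ℕ} {K : Set (Euc n)} (hK : IsCompact K) (hne : K.Nonempty) (x : Euc n) :
    ∃ y ∈ K, ⟪x, y⟫ = suppFn K x := by
  have := (hK.image (f := fun y => ⟪x, y⟫) (by fun_prop)).sSup_mem (hne.image _)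
  obtain ⟨y, hy, h⟩ := this
  exact ⟨y, hy, h⟩

lemma suppFn_le {n : ℕ} {K : Set (Euc n)} (hne : K.Nonempty) {x : Euc n} {c : ℝ}
    (h : ∀ y ∈ K, ⟪x, y⟫ ≤ c) : suppFn K x ≤ c :=
  csSup_le (hne.image _) (by rintro _ ⟨y, hy, rfl⟩; exact h y hy)

lemma suppFn_SF {n : ℕ} {K : Set (Euc n)} (hK : IsCompact K) (hne : K.Nonempty)
    (hs : ∀ x ∈ K, -x ∈ K) (hc : ContDiffOn ℝ 2 (suppFn K) {(0 : Euc n)}ᶜ) : SF (suppFn K) := by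
  refine ⟨hc, fun c hc x => ?_, fun x => ?_⟩
  · apply le_antisymm
    · refine suppFn_le hne fun y hy => ?_
      rw [inner_smul_left]
      exact mul_le_mul_of_nonneg_left (le_suppFn hK x hy) hc.le
    · obtain ⟨y, hy, h⟩ := exists_suppFn hK hne x
      rw [← h]
      have := le_suppFn hK (c • x) hy
      rwa [inner_smul_left] at this
  · apply le_antisymm
    · refine suppFn_le hne fun y hy => ?_
      have := le_suppFn hK x (hs y hy)
      rwa [inner_neg_right, ← inner_neg_left] at this
    · refine suppFn_le hne fun y hy => ?_
      have := le_suppFn hK (-x) (hs y hy)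
      rwa [inner_neg_neg] at this

lemma grad_supp_eq {n : ℕ} {K : Set (Euc n)} (hK : IsCompact K)
    (S : SF (suppFn K)) {x y : Euc n} (hx : x ≠ 0) (hy : y ∈ K) (hxy : ⟪x, y⟫ = suppFn K x) :
    gradient (suppFn K) x = y := by
  have h1 : IsLocalMin (fun z => suppFn K z - ⟪z, y⟫) x := by
    refine Filter.Eventually.of_forall fun z => ?_
    simp only [hxy, sub_self]
    linarith [le_suppFn hK z hy]
  have h2 : HasFDerivAt (fun z : Euc n => ⟪z, y⟫) (innerSL ℝ y) x := by
    have := (innerSL ℝ y).hasFDerivAt (x := x)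
    refine this.congr_of_eventuallyEq (Filter.Eventually.of_forall fun z => ?_)
    simp [real_inner_comm]
  have h3 := h1.hasFDerivAt_eq_zero ((S.diff hx).hasFDerivAt.sub h2)
  apply ext_inner_right ℝ
  intro v
  rw [inner_gradient_left, sub_eq_zero.1 h3]; simp

lemma grad_supp_mem {n : ℕ} {K : Set (Euc n)} (hK : IsCompact K) (hne : K.Nonempty)
    (S : SF (suppFn K)) {x : Euc n} (hx : x ≠ 0) : gradient (suppFn K) x ∈ K := by
  obtain ⟨y, hy, h⟩ := exists_suppFn hK hne x
  rw [grad_supp_eq hK S hx hy h]; exact hy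

/-- monotone gradient gives positive determinant -/
lemma det_pos_of_mono {n : ℕ} {h : Euc n → ℝ} (H : SF h)
    (hm : ∀ x y, x ≠ 0 → y ≠ 0 → ⟪x, gradient h y⟫ ≤ h x) {x : Euc n} (hx : x ≠ 0) :
    0 < (1 + Hs h x).det := by
  have hpsd : ∀ v : Euc n, 0 ≤ ⟪v, fderiv ℝ (gradient h) x v⟫ := by
    intro v
    have h1 : HasDerivAt (fun t : ℝ => ⟪v, gradient h (x + t • v)⟫) ⟪v, fderiv ℝ (gradient h) x v⟫ 0 := by
      have h0 : HasDerivAt (fun t : ℝ => x + t • v) v 0 := by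
        simpa using ((hasDerivAt_id (0:ℝ)).smul_const v).const_add x
      have h2 : HasFDerivAt (gradient h) (fderiv ℝ (gradient h) x) (x + (0:ℝ) • v) := by
        rw [zero_smul, add_zero]; exact (H.gdiff hx).hasFDerivAt
      have h3 := h2.comp_hasDerivAt (0:ℝ) h0
      have h4 := (innerSL ℝ v).hasFDerivAt.comp_hasDerivAt (0:ℝ) h3
      simpa [Function.comp_def] using h4
    have h2 := h1.tendsto_slope_zero_right
    refine ge_of_tendsto h2 ?_
    have hne : ∀ᶠ t : ℝ in nhdsWithin 0 (Set.Ioi 0), x + t • v ≠ 0 := by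
      have : ContinuousAt (fun t : ℝ => x + t • v) 0 := by fun_prop
      exact (this.eventually_ne (by simpa using hx)).filter_mono nhdsWithin_le_nhds
    filter_upwards [hne, self_mem_nhdsWithin] with t ht htp
    have htp : 0 < t := htp
    simp only [zero_add, zero_smul, add_zero, smul_eq_mul]
    refine mul_nonneg (by positivity) ?_
    have e1 := hm (x + t • v) x ht hx
    have e2 := hm x (x + t • v) hx ht
    have e3 := H.euler _ hx
    have e4 := H.euler _ ht
    have : 0 ≤ t * (⟪v, gradient h (x + t • v)⟫ - ⟪v, gradient h x⟫) := by
      rw [inner_add_left, inner_smul_left] at e1 e4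
      simp only [conj_trivial] at e1 e4
      nlinarith
    nlinarith [this, mul_pos htp htp, (mul_nonneg_iff_of_pos_left htp).1 this]
  by_contra hcon
  push Not at hcon
  have hc : Continuous (fun t : ℝ => (1 + t • Hs h x).det) := by
    refine Continuous.matrix_det ?_
    fun_prop
  have hmem : (0:ℝ) ∈ Set.Icc ((1 + (1:ℝ) • Hs h x).det) ((1 + (0:ℝ) • Hs h x).det) := by
    simp [hcon]
  obtain ⟨t, ht, ht0⟩ := intermediate_value_Icc' zero_le_one hc.continuousOn hmem
  obtain ⟨v, hv0, hv⟩ := Matrix.exists_mulVec_eq_zero_iff.2 ht0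
  set w : Euc n := WithLp.toLp 2 v with hw
  have h5 : ⟪w, w⟫ + t * ⟪w, fderiv ℝ (gradient h) x w⟫ = 0 := by
    have e1 : (fderiv ℝ (gradient h) x w : Fin n → ℝ) = Hs h x *ᵥ v := by
      ext i; rw [matOf_mulVec]; rfl
    rw [inner_eq_dot, inner_eq_dot, e1]
    have := congrArg (fun z => v ⬝ᵥ z) hv
    simp only [add_mulVec, one_mulVec, smul_mulVec, dotProduct_add, dotProduct_smul, smul_eq_mul, dotProduct_zero] at this
    exact this
  have h6 : 0 < ⟪w, w⟫ := by
    rw [real_inner_self_eq_norm_sq]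
    have : w ≠ 0 := fun h => hv0 (by simpa [hw] using h)
    have := norm_pos_iff.2 this
    positivity
  nlinarith [hpsd w, mul_nonneg ht.1 (hpsd w)]

lemma shell_image {n : ℕ} {K : Set (Euc n)} (hK : IsCompact K) (hcv : Convex ℝ K) (hne : K.Nonempty)
    (S : SF (suppFn K)) (ρ : ℝ) :
    (fun x => x + gradient (suppFn K) x) '' (closedBall (0 : Euc n) ρ \ {0})
      = (K + closedBall (0 : Euc n) ρ) \ K := by
  ext q; constructor
  · rintro ⟨x, ⟨hx, hx0⟩, rfl⟩
    have hx0 : x ≠ 0 := hx0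
    have hm := grad_supp_mem hK hne S hx0
    refine ⟨⟨_, hm, x, hx, by simp [add_comm]⟩, fun hq => ?_⟩
    have h1 := le_suppFn hK x hq
    simp only [inner_add_right, S.euler x hx0, real_inner_self_eq_norm_sq] at h1
    have := norm_pos_iff.2 hx0
    nlinarith
  · rintro ⟨⟨k, hk, b, hb, rfl⟩, hq⟩
    simp only at hq ⊢
    obtain ⟨a, ha, hmin⟩ := exists_norm_eq_iInf_of_complete_convex hne hK.isComplete hcv (k + b)
    have hin := (norm_eq_iInf_iff_real_inner_le_zero hcv ha).1 hmin
    have hx0 : k + b - a ≠ 0 := fun h => hq (by rw [sub_eq_zero.1 h]; exact ha)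
    have hle : ‖k + b - a‖ ≤ ρ := by
      rw [hmin]
      have : Nonempty K := ⟨⟨a, ha⟩⟩
      refine (ciInf_le ⟨0, ?_⟩ (⟨k, hk⟩ : K)).trans ?_
      · rintro _ ⟨y, rfl⟩; exact norm_nonneg _
      · simpa using hb
    refine ⟨k + b - a, ⟨by simpa using hle, hx0⟩, ?_⟩
    have : gradient (suppFn K) (k + b - a) = a := by
      refine grad_supp_eq hK S hx0 ha (le_antisymm (le_suppFn hK _ ha) (suppFn_le hne fun y hy => ?_))
      have := hin y hy
      rw [inner_sub_right] at this; linarith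
    simp [this]

lemma shell_inj {n : ℕ} {K : Set (Euc n)} (hK : IsCompact K) (hne : K.Nonempty)
    (S : SF (suppFn K)) (T : Set (Euc n)) (hT : ∀ x ∈ T, x ≠ 0) :
    Set.InjOn (fun x => x + gradient (suppFn K) x) T := by
  intro x hx y hy hxy
  have hx := hT x hx
  have hy := hT y hy
  have a1 := le_suppFn hK x (grad_supp_mem hK hne S hy)
  have a2 := le_suppFn hK y (grad_supp_mem hK hne S hx)
  have e3 := S.euler _ hx
  have e4 := S.euler _ hy
  have e5 : x - y = gradient (suppFn K) y - gradient (suppFn K) x := by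
    have : x + gradient (suppFn K) x = y + gradient (suppFn K) y := hxy
    rw [sub_eq_sub_iff_add_eq_add, this, add_comm]
  have e6 : ⟪x - y, x - y⟫ ≤ 0 := by
    nth_rewrite 2 [e5]
    simp only [inner_sub_left, inner_sub_right]
    linarith
  exact sub_eq_zero.1 (inner_self_eq_zero (𝕜 := ℝ).1 (le_antisymm e6 real_inner_self_nonneg))

def Wf {n : ℕ} (j : ℕ) (h : Euc n → ℝ) : ℝ := ∫ u, esym j (Hs h u) ∂(sgm n)

lemma integral_ball_esym {n : ℕ} {h : Euc n → ℝ} (H : SF h) (hn : 1 ≤ n) (k : ℕ) (hk : k < n)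
    (ρ : ℝ) (hρ : 0 < ρ) :
    IntegrableOn (fun x => esym k (Hs h x)) (closedBall 0 ρ) ∧
    ∫ x in closedBall 0 ρ, esym k (Hs h x) = ρ^(n-k) / ((n:ℝ)-k) * Wf k h := by
  set v : ℝ → ℝ := (Set.Iic ρ).indicator (fun r => (r⁻¹)^k) with hv
  have pol : ∀ r : ℝ, 0 < r → ∀ u : Euc n, ‖u‖ = 1 →
      (closedBall (0 : Euc n) ρ).indicator (fun x => esym k (Hs h x)) (r • u)
        = v r * esym k (Hs h u) := by
    intro r hr u hu
    have hu0 : u ≠ 0 := norm_ne_zero_iff.1 (by rw [hu]; norm_num)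
    have hnr : ‖r • u‖ = r := by rw [norm_smul, hu, mul_one, Real.norm_of_nonneg hr.le]
    by_cases hrρ : r ≤ ρ
    · rw [Set.indicator_of_mem (by simpa [hnr] using hrρ), H.hs_hom r hr u hu0, esym_smul, hv,
        Set.indicator_of_mem (show r ∈ Set.Iic ρ from hrρ)]
    · rw [Set.indicator_of_notMem (by simpa [hnr] using hrρ), hv,
        Set.indicator_of_notMem (by simpa using hrρ), zero_mul]
  have pw : ∀ r ∈ Set.Ioi (0:ℝ), r^(n-1) * v r = (Set.Iic ρ).indicator (fun r => r^(n-1-k)) r := by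
    intro r hr
    have hr : 0 < r := hr
    by_cases hrρ : r ∈ Set.Iic ρ
    · rw [hv, Set.indicator_of_mem hrρ, Set.indicator_of_mem hrρ]
      have e : n - 1 = (n-1-k) + k := by omega
      conv_lhs => rw [e]
      rw [pow_add, inv_pow]
      field_simp
    · rw [hv, Set.indicator_of_notMem hrρ, Set.indicator_of_notMem hrρ, mul_zero]
  have hI : Set.Iic ρ ∩ Set.Ioi 0 = Set.Ioc 0 ρ := by
    ext r; simp [and_comm]
  have hInteg : IntegrableOn (fun r => r^(n-1) * v r) (Set.Ioi 0) := by
    have : IntegrableOn ((Set.Iic ρ).indicator (fun r : ℝ => r^(n-1-k))) (Set.Ioi 0) := by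
      rw [IntegrableOn, integrable_indicator_iff measurableSet_Iic, IntegrableOn,
        Measure.restrict_restrict measurableSet_Iic, hI]
      exact ((continuous_pow _).continuousOn.integrableOn_compact (isCompact_Icc (a := 0) (b := ρ))).mono_set
        Set.Ioc_subset_Icc_self
    exact this.congr_fun (fun r hr => (pw r hr).symm) measurableSet_Ioi
  have cE : ContinuousOn (fun u => esym k (Hs h u)) (sphere (0 : Euc n) 1) :=
    (continuous_esym (n := n) k).comp_continuousOn (H.hs_cont.mono sph_sub)
  constructor
  · rw [← integrable_indicator_iff measurableSet_closedBall]
    exact polar_integrable _ v _ hn pol hInteg (integrable_sph cE)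
  · rw [← integral_indicator measurableSet_closedBall, polar _ v _ hn pol, Wf]
    congr 1
    rw [setIntegral_congr_fun measurableSet_Ioi pw, integral_indicator measurableSet_Iic,
      Measure.restrict_restrict measurableSet_Iic, hI, ← intervalIntegral.integral_of_le hρ.le,
      integral_pow]
    have e : n - 1 - k + 1 = n - k := by omega
    have e2 : ((n-1-k : ℕ):ℝ) + 1 = n - k := by
      have : n - 1 - k + 1 + k = n := by omega
      have : ((n-1-k : ℕ):ℝ) + 1 + k = n := by exact_mod_cast this
      linarith
    rw [e, e2, zero_pow (by omega), sub_zero]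

lemma vol_shell {n : ℕ} (hn : 1 ≤ n) {K : Set (Euc n)} (hK : IsCompact K) (hcv : Convex ℝ K)
    (hne : K.Nonempty) (S : SF (suppFn K)) (ρ : ℝ) (hρ : 0 < ρ) :
    (volume (K + closedBall (0 : Euc n) ρ)).toReal = (volume K).toReal +
      ∑ k ∈ Finset.range n, ρ^(n-k) / ((n:ℝ)-k) * Wf k (suppFn K) := by
  have : Nonempty (Fin n) := ⟨⟨0, hn⟩⟩
  set h := suppFn K with hh
  have hsub : K ⊆ K + closedBall (0 : Euc n) ρ := fun y hy =>
    ⟨y, hy, 0, by simpa using hρ.le, by simp⟩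
  have hc2 : IsCompact (K + closedBall (0 : Euc n) ρ) := hK.add (isCompact_closedBall _ _)
  have h1 : (volume (K + closedBall (0 : Euc n) ρ)).toReal = (volume K).toReal +
      (volume ((K + closedBall (0 : Euc n) ρ) \ K)).toReal := by
    rw [measure_sdiff hsub hK.measurableSet.nullMeasurableSet hK.measure_lt_top.ne,
      ENNReal.toReal_sub_of_le (measure_mono hsub) hc2.measure_lt_top.ne]
    ring
  rw [h1]; congr 1
  set T := closedBall (0 : Euc n) ρ \ {0} with hT
  have hTm : MeasurableSet T := measurableSet_closedBall.diff (measurableSet_singleton _)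
  have hT0 : ∀ x ∈ T, x ≠ 0 := fun x hx => hx.2
  have hder : ∀ x ∈ T, HasFDerivWithinAt (fun x => x + gradient h x)
      (ContinuousLinearMap.id ℝ (Euc n) + fderiv ℝ (gradient h) x) T x := fun x hx =>
    ((hasFDerivAt_id x).add (S.gdiff (hT0 x hx)).hasFDerivAt).hasFDerivWithinAt
  have := integral_image_eq_integral_abs_det_fderiv_smul volume hTm hder
      (shell_inj hK hne S T hT0) (fun _ => (1:ℝ))
  rw [shell_image hK hcv hne S] at this
  simp only [integral_const, smul_eq_mul, mul_one, measureReal_restrict_apply_univ] at this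
  rw [← Measure.real, this]
  have hae : T =ᵐ[volume] closedBall (0 : Euc n) ρ := sdiff_null_ae_eq_self (by simp)
  have e1 : ∫ x in T, |(ContinuousLinearMap.id ℝ (Euc n) + fderiv ℝ (gradient h) x).det|
      = ∫ x in T, ∑ k ∈ Finset.range n, esym k (Hs h x) := by
    refine setIntegral_congr_fun hTm fun x hx => ?_
    have hx0 := hT0 x hx
    have hd : (ContinuousLinearMap.id ℝ (Euc n) + fderiv ℝ (gradient h) x).det = (1 + Hs h x).det := by
      rw [det_matOf, matOf_add, matOf_id]; rfl
    rw [hd, abs_of_pos (det_pos_of_mono S (fun x y hx hy => le_suppFn hK x (grad_supp_mem hK hne S hy)) hx0)]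
    have := det_eq_sum_esym (Hs h x) 1
    simp only [one_smul, one_pow, one_mul] at this
    rw [this, Finset.sum_range_succ, esym_top (Hs h x) x (fun h => hx0 (by ext i; simpa using congrFun h i)) (S.vecMul_hs x hx0), add_zero]
  rw [e1, setIntegral_congr_set hae, integral_finsetSum]
  · refine Finset.sum_congr rfl fun k hk => ?_
    exact (integral_ball_esym S hn k (Finset.mem_range.1 hk) ρ hρ).2
  · intro k hk
    exact (integral_ball_esym S hn k (Finset.mem_range.1 hk) ρ hρ).1

lemma steiner_coeff {n : ℕ} (hn : 1 ≤ n) {V : ℕ → Set (Euc n) → ℝ} (hV : steiner n V)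
    {K : Set (Euc n)} (hK : IsCompact K) (hcv : Convex ℝ K)
    (hne : K.Nonempty) (S : SF (suppFn K)) (j : ℕ) (hj : j < n) :
    kappa (n - j) * V j K = Wf j (suppFn K) / ((n:ℝ) - j) := by
  set P : Polynomial ℝ := ∑ i ∈ Finset.range (n+1), Polynomial.monomial (n-i) (kappa (n-i) * V i K) with hP
  set Q : Polynomial ℝ := Polynomial.C (volume K).toReal +
    ∑ i ∈ Finset.range n, Polynomial.monomial (n-i) (Wf i (suppFn K) / ((n:ℝ)-i)) with hQ
  have hPQ : P = Q := by
    apply Polynomial.eq_of_infinite_eval_eq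
    refine (Set.Ioi_infinite (0:ℝ)).mono fun ρ hρ => ?_
    have hρ : 0 < ρ := hρ
    have e1 := hV K hK hcv hne ρ hρ
    rw [vol_shell hn hK hcv hne S ρ hρ] at e1
    show P.eval ρ = Q.eval ρ
    simp only [hP, hQ, Polynomial.eval_add, Polynomial.eval_C, Polynomial.eval_finsetSum,
      Polynomial.eval_monomial]
    rw [show (∑ i ∈ Finset.range (n+1), kappa (n-i) * V i K * ρ^(n-i)) =
      ∑ i ∈ Finset.range (n + 1), ρ ^ (n - i) * kappa (n - i) * V i K from
      Finset.sum_congr rfl fun i _ => by ring, ← e1]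
    congr 1
    exact Finset.sum_congr rfl fun i _ => by ring
  have hc := congrArg (fun R => Polynomial.coeff R (n-j)) hPQ
  simp only [hP, hQ, Polynomial.coeff_add, Polynomial.finsetSum_coeff, Polynomial.coeff_monomial,
    Polynomial.coeff_C] at hc
  rw [if_neg (by omega), zero_add, Finset.sum_eq_single j, Finset.sum_eq_single j] at hc
  · simpa using hc
  · intro i hi hij
    rw [if_neg]
    have := Finset.mem_range.1 hi
    omega
  · intro h; exact absurd (Finset.mem_range.2 hj) h
  · intro i hi hij
    rw [if_neg]
    have := Finset.mem_range.1 hi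
    omega
  · intro h; exact absurd (Finset.mem_range.2 (by omega)) h

def Ig (k : ℕ) : ℝ := ∫ r in Set.Ioi (0:ℝ), r ^ k * Real.exp (-(r^2)/2)

lemma Ig_integrable (k : ℕ) : IntegrableOn (fun r : ℝ => r ^ k * Real.exp (-(r^2)/2)) (Set.Ioi 0) := by
  have := (integrable_rpow_mul_exp_neg_mul_sq (b := 1/2) (by norm_num) (s := (k:ℝ))
    (by have : (0:ℝ) ≤ k := by positivity
        linarith)).integrableOn (s := Set.Ioi (0:ℝ))
  refine this.congr_fun (fun r _ => ?_) measurableSet_Ioi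
  simp only [Real.rpow_natCast]
  congr 2; ring

lemma Ig_eq (k : ℕ) : Ig k = (1/2:ℝ) ^ (-((k:ℝ)+1)/2) * (1/2) * Real.Gamma (((k:ℝ)+1)/2) := by
  rw [← integral_rpow_mul_exp_neg_mul_rpow (p := 2) (q := k) (b := 1/2) (by norm_num)
    (by have : (0:ℝ) ≤ k := by positivity
        linarith) (by norm_num), Ig]
  refine setIntegral_congr_fun measurableSet_Ioi fun r _ => ?_
  simp only [Real.rpow_natCast, Real.rpow_two]
  congr 2; ring

lemma Ig_pos (k : ℕ) : 0 < Ig k := by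
  rw [Ig_eq]
  have : 0 < Real.Gamma (((k:ℝ)+1)/2) := Real.Gamma_pos_of_pos (by positivity)
  positivity

lemma Ig_rec (k : ℕ) : Ig (k+2) = (k+1) * Ig k := by
  rw [Ig_eq, Ig_eq]
  have e1 : (((k+2:ℕ):ℝ)+1)/2 = ((k:ℝ)+1)/2 + 1 := by push_cast; ring
  have e2 : -(((k+2:ℕ):ℝ)+1)/2 = -((k:ℝ)+1)/2 + (-1) := by push_cast; ring
  rw [e1, e2, Real.Gamma_add_one (by positivity), Real.rpow_add (by norm_num), Real.rpow_neg_one]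
  ring

def gden {n : ℕ} (x : Euc n) : ℝ := Real.exp (-(‖x‖^2)/2)

lemma gden_pos {n : ℕ} (x : Euc n) : 0 < gden x := Real.exp_pos _

lemma gden_cont {n : ℕ} : Continuous (gden (n := n)) := by unfold gden; fun_prop

lemma gden_polar {n : ℕ} (hn : 1 ≤ n) (F : Euc n → ℝ) (g : Euc n → ℝ) (d : ℕ)
    (hF : ∀ r : ℝ, 0 < r → ∀ u : Euc n, ‖u‖ = 1 → F (r • u) = r ^ d * g u) :
    ∫ x, F x * gden x = Ig (n-1+d) * ∫ u, g u ∂(sgm n) := by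
  rw [polar (fun x => F x * gden x) (fun r => r^d * Real.exp (-(r^2)/2)) g hn, Ig]
  · congr 2; ext r; ring
  · intro r hr u hu
    have : ‖r • u‖ = r := by rw [norm_smul, hu, mul_one, Real.norm_of_nonneg hr.le]
    simp only [gden]
    rw [hF r hr u hu, this]; ring

lemma gden_norm_pow {n : ℕ} (hn : 1 ≤ n) (d : ℕ) : Integrable (fun x : Euc n => ‖x‖^d * gden x) := by
  refine polar_integrable _ (fun r => r^d * Real.exp (-(r^2)/2)) (fun _ => 1) hn ?_ ?_ ?_
  · intro r hr u hu
    have : ‖r • u‖ = r := by rw [norm_smul, hu, mul_one, Real.norm_of_nonneg hr.le]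
    simp only [gden]; rw [this]; ring
  · refine (Ig_integrable (n-1+d)).congr_fun (fun r _ => ?_) measurableSet_Ioi
    simp only []; ring
  · exact integrable_const _

def gc (n : ℕ) : ℝ := ∫ x : Euc n, gden x

lemma gc_eq {n : ℕ} (hn : 1 ≤ n) : gc n = Ig (n-1) * (sgm n).real Set.univ := by
  have := gden_polar hn (fun _ => 1) (fun _ => 1) 0 (by simp)
  simp only [pow_zero, one_mul, add_zero, integral_const, smul_eq_mul, mul_one] at this
  exact this

lemma gden_int {n : ℕ} (hn : 1 ≤ n) : Integrable (gden (n := n)) := by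
  simpa using gden_norm_pow hn 0

lemma gc_pos {n : ℕ} (hn : 1 ≤ n) : 0 < gc n := by
  refine (integral_pos_iff_support_of_nonneg (fun x => (gden_pos x).le) (gden_int hn)).2 ?_
  have : Function.support (gden (n := n)) = Set.univ := by
    ext x; simp [(gden_pos x).ne']
  rw [this]; exact isOpen_univ.measure_pos volume ⟨0, trivial⟩

def gam (n : ℕ) : Measure (Euc n) :=
  volume.withDensity (fun x => ENNReal.ofReal ((gc n)⁻¹ * gden x))

lemma gam_int {n : ℕ} (hn : 1 ≤ n) (F : Euc n → ℝ) :
    ∫ x, F x ∂(gam n) = (gc n)⁻¹ * ∫ x, F x * gden x := by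
  have hc := gc_pos hn
  rw [gam, integral_withDensity_eq_integral_toReal_smul]
  · rw [← integral_const_mul]
    congr 1; ext x
    rw [ENNReal.toReal_ofReal (by have := gden_pos x; positivity), smul_eq_mul]; ring
  · exact (ENNReal.continuous_ofReal.comp (continuous_const.mul gden_cont)).measurable
  · simp

lemma gam_prob {n : ℕ} (hn : 1 ≤ n) : IsProbabilityMeasure (gam n) := by
  have hc := gc_pos hn
  constructor
  rw [gam, withDensity_apply _ MeasurableSet.univ, Measure.restrict_univ,
    ← ofReal_integral_eq_lintegral_ofReal ((gden_int hn).const_mul _), integral_const_mul]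
  · rw [← gc, inv_mul_cancel₀ hc.ne', ENNReal.ofReal_one]
  · exact Filter.Eventually.of_forall fun x => by
      have := gden_pos x
      show 0 ≤ (gc n)⁻¹ * gden x
      positivity

lemma gam_norm_pow {n : ℕ} (hn : 1 ≤ n) (d : ℕ) : Integrable (fun x : Euc n => ‖x‖^d) (gam n) := by
  have hc := gc_pos hn
  rw [gam, integrable_withDensity_iff]
  · refine ((gden_norm_pow hn d).const_mul (gc n)⁻¹).congr (Filter.Eventually.of_forall fun x => ?_)
    show _ = ‖x‖^d * _
    rw [ENNReal.toReal_ofReal (by have := gden_pos x; positivity)]; ring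
  · exact (ENNReal.continuous_ofReal.comp (continuous_const.mul gden_cont)).measurable
  · exact Filter.Eventually.of_forall fun x => ENNReal.ofReal_lt_top

lemma gam_pow {n : ℕ} (hn : 1 ≤ n) (d : ℕ) : Integrable (fun x : Euc n => (1 + ‖x‖)^d) (gam n) := by
  have e : (fun x : Euc n => (1 + ‖x‖)^d) = fun x => ∑ k ∈ Finset.range (d+1), ‖x‖^(d-k) * (d.choose k) := by
    ext x; rw [add_pow]; simp
  rw [e]
  exact integrable_finsetSum _ fun k _ => (gam_norm_pow hn _).mul_const _

lemma gam_neg {n : ℕ} : MeasurePreserving (fun x : Euc n => -x) (gam n) (gam n) := by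
  have h0 : MeasurePreserving (fun x : Euc n => -x) volume volume := Measure.measurePreserving_neg _
  refine ⟨measurable_neg, ?_⟩
  ext s hs
  rw [Measure.map_apply measurable_neg hs, gam, withDensity_apply _ (measurable_neg hs),
    withDensity_apply _ hs]
  rw [← h0.setLIntegral_comp_preimage hs]
  · simp [gden]
  · exact (ENNReal.continuous_ofReal.comp (continuous_const.mul gden_cont)).measurable

/-- the reflection `(x,z) ↦ (ρ x + s z, s x - ρ z)` -/
def rotm {n : ℕ} (ρ s : ℝ) : (Euc n × Euc n) →ₗ[ℝ] (Euc n × Euc n) where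
  toFun q := (ρ • q.1 + s • q.2, s • q.1 - ρ • q.2)
  map_add' q q' := by ext <;> simp <;> ring
  map_smul' c q := by ext <;> simp <;> ring

lemma rotm_sq {n : ℕ} {ρ s : ℝ} (h : ρ^2 + s^2 = 1) (q : Euc n × Euc n) :
    rotm ρ s (rotm ρ s q) = q := by
  have e1 : ρ • (ρ • q.1 + s • q.2) + s • (s • q.1 - ρ • q.2) = q.1 := by
    have : ρ • (ρ • q.1 + s • q.2) + s • (s • q.1 - ρ • q.2) = (ρ^2+s^2) • q.1 := by module
    rw [this, h, one_smul]
  have e2 : s • (ρ • q.1 + s • q.2) - ρ • (s • q.1 - ρ • q.2) = q.2 := by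
    have : s • (ρ • q.1 + s • q.2) - ρ • (s • q.1 - ρ • q.2) = (ρ^2+s^2) • q.2 := by module
    rw [this, h, one_smul]
  exact Prod.ext e1 e2

lemma rotm_meas {n : ℕ} (ρ s : ℝ) : Measurable (rotm (n := n) ρ s) :=
  (LinearMap.continuous_of_finiteDimensional _).measurable

lemma rotm_vol {n : ℕ} {ρ s : ℝ} (h : ρ^2 + s^2 = 1) :
    MeasurePreserving (rotm (n := n) ρ s) volume volume := by
  refine ⟨rotm_meas ρ s, ?_⟩
  have hd : (LinearMap.det (rotm (n := n) ρ s)) * (LinearMap.det (rotm (n := n) ρ s)) = 1 := by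
    rw [← LinearMap.det_comp]
    have : (rotm (n := n) ρ s) ∘ₗ (rotm ρ s) = LinearMap.id := LinearMap.ext fun q => rotm_sq h q
    rw [this, LinearMap.det_id]
  have hne : LinearMap.det (rotm (n := n) ρ s) ≠ 0 := fun h0 => by rw [h0] at hd; simp at hd
  have hab : |(LinearMap.det (rotm (n := n) ρ s))⁻¹| = 1 := by
    rw [abs_inv]
    rcases mul_self_eq_one_iff.1 hd with h | h <;> simp [h]
  haveI : (volume : Measure (Euc n × Euc n)).IsAddHaarMeasure :=
    (inferInstance : ((volume:Measure (Euc n)).prod volume).IsAddHaarMeasure)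
  rw [Measure.map_linearMap_addHaar_eq_smul_addHaar _ hne, hab]
  simp

lemma rotm_gam {n : ℕ} (hn : 1 ≤ n) {ρ s : ℝ} (h : ρ^2 + s^2 = 1) :
    MeasurePreserving (rotm (n := n) ρ s) ((gam n).prod (gam n)) ((gam n).prod (gam n)) := by
  have hm : Measurable (fun x : Euc n => ENNReal.ofReal ((gc n)⁻¹ * gden x)) :=
    (ENNReal.continuous_ofReal.comp (continuous_const.mul gden_cont)).measurable
  have hm2 : Measurable (fun z : Euc n × Euc n => ENNReal.ofReal ((gc n)⁻¹ * gden z.1)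
      * ENNReal.ofReal ((gc n)⁻¹ * gden z.2)) :=
    (hm.comp measurable_fst).mul (hm.comp measurable_snd)
  refine ⟨rotm_meas ρ s, ?_⟩
  have := gam_prob hn
  have hp : (gam n).prod (gam n) = (volume : Measure (Euc n × Euc n)).withDensity
      (fun z => ENNReal.ofReal ((gc n)⁻¹ * gden z.1) * ENNReal.ofReal ((gc n)⁻¹ * gden z.2)) := by
    have : SFinite ((volume : Measure (Euc n)).withDensity (fun x => ENNReal.ofReal ((gc n)⁻¹ * gden x))) := by
      change SFinite (gam n); infer_instance
    rw [gam, prod_withDensity hm hm]; rfl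
  rw [hp]
  ext S hS
  rw [Measure.map_apply (rotm_meas ρ s) hS, withDensity_apply _ (rotm_meas ρ s hS),
    withDensity_apply _ hS, ← (rotm_vol h).setLIntegral_comp_preimage hS hm2]
  congr 1; ext q
  have hc := gc_pos hn
  have g1 := fun x : Euc n => (gden_pos x).le
  rw [← ENNReal.ofReal_mul (mul_nonneg (by positivity) (g1 _)),
    ← ENNReal.ofReal_mul (mul_nonneg (by positivity) (g1 _))]
  congr 1
  have : gden (rotm ρ s q).1 * gden (rotm ρ s q).2 = gden q.1 * gden q.2 := by
    simp only [gden, ← Real.exp_add]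
    congr 1
    have : ‖(rotm ρ s q).1‖^2 + ‖(rotm ρ s q).2‖^2 = ‖q.1‖^2 + ‖q.2‖^2 := by
      have a1 : ‖(rotm ρ s q).1‖^2 = ‖ρ • q.1 + s • q.2‖^2 := rfl
      have a2 : ‖(rotm ρ s q).2‖^2 = ‖s • q.1 - ρ • q.2‖^2 := rfl
      rw [a1, a2, norm_add_sq_real, norm_sub_sq_real]
      simp only [norm_smul, inner_smul_left, inner_smul_right, mul_pow, Real.norm_eq_abs, sq_abs, conj_trivial]
      linear_combination (‖q.1‖^2 + ‖q.2‖^2) * h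
    linarith
  linear_combination -(gc n)⁻¹^2 * this

/-- even functions with bounded second differences -/
structure DC {n : ℕ} (G : Euc n → ℝ) (C : ℝ) : Prop where
  meas : StronglyMeasurable G
  even : ∀ x, G (-x) = G x
  sd : ∀ x y, |G (x+y) + G (x-y) - 2 * G x| ≤ C * ‖y‖^2

lemma DC.near {n : ℕ} {G : Euc n → ℝ} {C : ℝ} (h : DC G C) (y : Euc n) :
    |G y - G 0| ≤ C/2 * ‖y‖^2 := by
  have := h.sd 0 y
  rw [zero_add, zero_sub, h.even] at this
  have e : G y + G y - 2 * G 0 = 2 * (G y - G 0) := by ring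
  rw [e, abs_mul, abs_of_pos (by norm_num : (0:ℝ) < 2)] at this
  linarith

lemma DC.nonneg {n : ℕ} (hn : 1 ≤ n) {G : Euc n → ℝ} {C : ℝ} (h : DC G C) : 0 ≤ C := by
  have := h.sd 0 (EuclideanSpace.single (⟨0, hn⟩ : Fin n) 1)
  have h2 := abs_nonneg (G (0 + (EuclideanSpace.single (⟨0, hn⟩ : Fin n) (1:ℝ))) + G (0 - (EuclideanSpace.single (⟨0, hn⟩ : Fin n) 1)) - 2 * G 0)
  simp only [EuclideanSpace.norm_single, norm_one, one_pow, mul_one] at this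
  linarith

/-- quadratic growth -/
def QG {n : ℕ} (G : Euc n → ℝ) : Prop := StronglyMeasurable G ∧ ∃ A, 0 ≤ A ∧ ∀ x, |G x| ≤ A * (1+‖x‖)^2

lemma DC.qg {n : ℕ} (hn : 1 ≤ n) {G : Euc n → ℝ} {C : ℝ} (h : DC G C) : QG G := by
  have hC := h.nonneg hn
  refine ⟨h.meas, |G 0| + C/2, by positivity, fun y => ?_⟩
  have h1 := h.near y
  have h2 : |G y| ≤ |G y - G 0| + |G 0| := by
    have := abs_add_le (G y - G 0) (G 0); simpa using this
  have h3 : (1:ℝ) ≤ (1+‖y‖)^2 := by nlinarith [norm_nonneg y]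
  have h4 : ‖y‖^2 ≤ (1+‖y‖)^2 := by nlinarith [norm_nonneg y]
  have h5 := mul_le_mul_of_nonneg_left h3 (abs_nonneg (G 0))
  have h6 := mul_le_mul_of_nonneg_left h4 (by linarith : 0 ≤ C/2)
  linarith

lemma QG.int {n : ℕ} (hn : 1 ≤ n) {G : Euc n → ℝ} (h : QG G) : Integrable G (gam n) := by
  obtain ⟨hm, A, hA, hb⟩ := h
  exact ((gam_pow hn 2).const_mul A).mono' hm.aestronglyMeasurable
    (Filter.Eventually.of_forall fun x => by rw [Real.norm_eq_abs]; exact hb x)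

lemma QG.mul_int {n : ℕ} (hn : 1 ≤ n) {F G : Euc n → ℝ} (hF : QG F) (hG : QG G) :
    Integrable (fun x => F x * G x) (gam n) := by
  obtain ⟨hm, A, hA, hb⟩ := hF
  obtain ⟨hm', B, hB, hb'⟩ := hG
  refine ((gam_pow hn 4).const_mul (A*B)).mono' (hm.mul hm').aestronglyMeasurable
    (Filter.Eventually.of_forall fun x => ?_)
  rw [Real.norm_eq_abs, abs_mul]
  calc |F x| * |G x| ≤ (A * (1+‖x‖)^2) * (B * (1+‖x‖)^2) :=
        mul_le_mul (hb x) (hb' x) (abs_nonneg _) (by positivity)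
    _ = _ := by ring

lemma rot_bd {n : ℕ} {ρ s : ℝ} (h : ρ^2 + s^2 = 1) (x z : Euc n) :
    1 + ‖ρ • x + s • z‖ ≤ (1+‖x‖) * (1+‖z‖) := by
  have h1 : |ρ| ≤ 1 := abs_le_one_iff_mul_self_le_one.2 (by nlinarith)
  have h2 : |s| ≤ 1 := abs_le_one_iff_mul_self_le_one.2 (by nlinarith)
  have := norm_add_le (ρ • x) (s • z)
  rw [norm_smul, norm_smul, Real.norm_eq_abs, Real.norm_eq_abs] at this
  have a := mul_le_mul_of_nonneg_right h1 (norm_nonneg x)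
  have b := mul_le_mul_of_nonneg_right h2 (norm_nonneg z)
  nlinarith [norm_nonneg x, norm_nonneg z, mul_nonneg (norm_nonneg x) (norm_nonneg z)]

lemma QG.rot_meas {n : ℕ} {G : Euc n → ℝ} (hG : QG G) (ρ s : ℝ) :
    StronglyMeasurable (fun q : Euc n × Euc n => G (ρ • q.1 + s • q.2)) :=
  hG.1.comp_measurable (g := fun q : Euc n × Euc n => ρ • q.1 + s • q.2)
    (by fun_prop)

lemma QG.rot_int {n : ℕ} (hn : 1 ≤ n) {G : Euc n → ℝ} (hG : QG G) {ρ s : ℝ}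
    (h : ρ^2 + s^2 = 1) (x : Euc n) : Integrable (fun z => G (ρ • x + s • z)) (gam n) := by
  have hm := (hG.rot_meas ρ s).comp_measurable (g := fun z : Euc n => (x, z)) (by fun_prop)
  obtain ⟨-, A, hA, hb⟩ := hG
  refine ((gam_pow hn 2).const_mul (A * (1+‖x‖)^2)).mono' hm.aestronglyMeasurable
    (Filter.Eventually.of_forall fun z => ?_)
  rw [Real.norm_eq_abs]
  calc _ ≤ A * (1 + ‖ρ • x + s • z‖)^2 := hb _
    _ ≤ A * ((1+‖x‖) * (1+‖z‖))^2 := by gcongr; exact rot_bd h x z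
    _ = _ := by ring

lemma QG.mul_rot_int {n : ℕ} (hn : 1 ≤ n) {F G : Euc n → ℝ} (hF : QG F) (hG : QG G) {ρ s : ℝ}
    (h : ρ^2 + s^2 = 1) :
    Integrable (fun q : Euc n × Euc n => F q.1 * G (ρ • q.1 + s • q.2)) ((gam n).prod (gam n)) := by
  have := gam_prob hn
  have hm := (hF.1.comp_measurable (measurable_fst (α := Euc n) (β := Euc n))).mul (hG.rot_meas ρ s)
  obtain ⟨-, A, hA, hb⟩ := hF
  obtain ⟨-, B, hB, hb'⟩ := hG
  refine (((gam_pow hn 4).const_mul (A*B)).mul_prod (gam_pow hn 2)).mono' hm.aestronglyMeasurable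
    (Filter.Eventually.of_forall fun q => ?_)
  rw [Real.norm_eq_abs, abs_mul]
  have h1 : |G (ρ • q.1 + s • q.2)| ≤ B * ((1+‖q.1‖) * (1+‖q.2‖))^2 := by
    refine (hb' _).trans ?_
    gcongr; exact rot_bd h _ _
  calc _ ≤ (A * (1+‖q.1‖)^2) * (B * ((1+‖q.1‖) * (1+‖q.2‖))^2) :=
        mul_le_mul (hb q.1) h1 (abs_nonneg _) (by positivity)
    _ = _ := by ring

def Mop {n : ℕ} (ρ s : ℝ) (G : Euc n → ℝ) (x : Euc n) : ℝ := ∫ z, G (ρ • x + s • z) ∂(gam n)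

lemma Mop_DC {n : ℕ} (hn : 1 ≤ n) {G : Euc n → ℝ} {C ρ s : ℝ} (hG : DC G C)
    (h : ρ^2 + s^2 = 1) : DC (Mop ρ s G) (ρ^2 * C) := by
  have := gam_prob hn
  have q := hG.qg hn
  refine ⟨(q.rot_meas ρ s).integral_prod_right, fun x => ?_, fun x y => ?_⟩
  · unfold Mop
    have e := gam_neg (n := n).integral_comp (MeasurableEquiv.neg (Euc n)).measurableEmbedding
      (fun z => G (ρ • (-x) + s • z))
    rw [← e]
    congr 1; ext z
    rw [← hG.even]; congr 1; simp; abel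
  · unfold Mop
    rw [← integral_add (q.rot_int hn h _) (q.rot_int hn h _), ← integral_const_mul,
      ← integral_sub (f := fun z => G (ρ • (x+y) + s • z) + G (ρ • (x-y) + s • z)) ((q.rot_int hn h _).add (q.rot_int hn h _)) ((q.rot_int hn h _).const_mul _)]
    rw [← Real.norm_eq_abs]
    refine (norm_integral_le_of_norm_le_const (μ := gam n) (C := ρ^2 * C * ‖y‖^2) (Filter.Eventually.of_forall fun z => ?_)).trans ?_
    · have := hG.sd (ρ • x + s • z) (ρ • y)
      rw [norm_smul, mul_pow, Real.norm_eq_abs, sq_abs] at this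
      rw [Real.norm_eq_abs]
      have e1 : ρ • (x + y) + s • z = ρ • x + s • z + ρ • y := by module
      have e2 : ρ • (x - y) + s • z = ρ • x + s • z - ρ • y := by module
      rw [e1, e2]
      linarith
    · simp

lemma rot_integral {n : ℕ} (hn : 1 ≤ n) {ρ s : ℝ} (h : ρ^2 + s^2 = 1) (Φ : Euc n × Euc n → ℝ)
    (hΦ : StronglyMeasurable Φ) :
    ∫ q, Φ (rotm ρ s q) ∂((gam n).prod (gam n)) = ∫ q, Φ q ∂((gam n).prod (gam n)) := by
  have R := rotm_gam hn h
  conv_rhs => rw [← R.map_eq]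
  rw [integral_map R.measurable.aemeasurable hΦ.aestronglyMeasurable]

lemma rot_fst {n : ℕ} (hn : 1 ≤ n) {ρ s : ℝ} (h : ρ^2 + s^2 = 1) {G : Euc n → ℝ} (hG : StronglyMeasurable G) :
    ∫ q, G (ρ • q.1 + s • q.2) ∂((gam n).prod (gam n)) = ∫ x, G x ∂(gam n) := by
  have := gam_prob hn
  have := rot_integral hn h (fun q => G q.1) (hG.comp_measurable measurable_fst)
  rw [integral_fun_fst] at this
  simpa [rotm] using this

lemma Mop_inner {n : ℕ} (hn : 1 ≤ n) {F G : Euc n → ℝ} {ρ s : ℝ} (hF : QG F) (hG : QG G)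
    (h : ρ^2 + s^2 = 1) :
    ∫ x, F x * Mop ρ s G x ∂(gam n) = ∫ q : Euc n × Euc n, F q.1 * G (ρ • q.1 + s • q.2) ∂((gam n).prod (gam n)) := by
  have := gam_prob hn
  rw [integral_prod _ (hF.mul_rot_int hn hG h)]
  congr 1; ext x
  simp only []
  rw [integral_const_mul]; rfl

lemma Mop_symm {n : ℕ} (hn : 1 ≤ n) {F G : Euc n → ℝ} {ρ s : ℝ} (hF : QG F) (hG : QG G)
    (h : ρ^2 + s^2 = 1) :
    ∫ x, F x * Mop ρ s G x ∂(gam n) = ∫ x, Mop ρ s F x * G x ∂(gam n) := by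
  simp_rw [mul_comm (Mop ρ s F _)]
  rw [Mop_inner hn hF hG h, Mop_inner hn hG hF h,
    ← rot_integral hn h (fun q => G q.1 * F (ρ • q.1 + s • q.2))
      ((hG.1.comp_measurable (measurable_fst (α := Euc n) (β := Euc n))).mul (hF.rot_meas ρ s))]
  congr 1; ext q
  have e := congrArg Prod.fst (rotm_sq h q)
  change ρ • (rotm ρ s q).1 + s • (rotm ρ s q).2 = q.1 at e
  simp only [e]
  change _ = G (ρ • q.1 + s • q.2) * F q.1
  ring

lemma Mop_mean {n : ℕ} (hn : 1 ≤ n) {G : Euc n → ℝ} {ρ s : ℝ} (hG : QG G)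
    (h : ρ^2 + s^2 = 1) : ∫ x, Mop ρ s G x ∂(gam n) = ∫ x, G x ∂(gam n) := by
  have h1 : QG (fun _ : Euc n => (1:ℝ)) := ⟨stronglyMeasurable_const, 1, zero_le_one, fun x => by
    rw [abs_one]; nlinarith [norm_nonneg x]⟩
  have := Mop_inner hn h1 hG h
  simp only [one_mul] at this
  rw [this, rot_fst hn h hG.1]

def Kc (n : ℕ) : ℝ := ∫ y : Euc n, ((∫ y : Euc n, ‖y‖^2 ∂(gam n)) + ‖y‖^2)^2/4 ∂(gam n)

lemma Kc_nonneg (n : ℕ) : 0 ≤ Kc n := integral_nonneg fun x => by positivity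

lemma DC.sq_le {n : ℕ} (hn : 1 ≤ n) {G : Euc n → ℝ} {C : ℝ} (h : DC G C)
    (h0 : ∫ x, G x ∂(gam n) = 0) : ∫ x, G x * G x ∂(gam n) ≤ C^2 * Kc n := by
  have := gam_prob hn
  have hC := h.nonneg hn
  set M := ∫ y : Euc n, ‖y‖^2 ∂(gam n) with hM
  have hM0 : 0 ≤ M := integral_nonneg fun x => by positivity
  have hG0 : |G 0| ≤ C/2 * M := by
    have e : -G 0 = ∫ x, (G x - G 0) ∂(gam n) := by
      rw [integral_sub ((h.qg hn).int hn) (integrable_const _), h0]; simp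
    rw [← abs_neg, e, hM, ← integral_const_mul]
    rw [← Real.norm_eq_abs]
    exact norm_integral_le_of_norm_le ((gam_norm_pow hn 2).const_mul _)
      (Filter.Eventually.of_forall fun x => by rw [Real.norm_eq_abs]; exact h.near x)
  rw [Kc, ← integral_const_mul]
  refine integral_mono ((h.qg hn).mul_int hn (h.qg hn)) ?_ fun x => ?_
  · have i1 := gam_norm_pow hn 2
    have i2 := gam_norm_pow hn 4
    have : (fun y : Euc n => C^2 * ((M + ‖y‖^2)^2/4)) = fun y => C^2/4*M^2 + (C^2/2*M) * ‖y‖^2 + C^2/4*‖y‖^4 := by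
      ext y; ring
    rw [this]
    exact ((integrable_const _).add (i1.const_mul _)).add (i2.const_mul _)
  · have h1 := h.near x
    have h2 : |G x| ≤ |G x - G 0| + |G 0| := by
      have := abs_add_le (G x - G 0) (G 0); simpa using this
    have h3 : |G x| ≤ C/2 * (M + ‖x‖^2) := by linarith
    show G x * G x ≤ C^2 * ((M+‖x‖^2)^2/4)
    rw [← abs_mul_abs_self]
    nlinarith [mul_self_le_mul_self (abs_nonneg _) h3]

lemma cs_int {n : ℕ} (hn : 1 ≤ n) {F G : Euc n → ℝ} (hF : QG F) (hG : QG G) :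
    (∫ x, F x * G x ∂(gam n))^2 ≤ (∫ x, F x * F x ∂(gam n)) * ∫ x, G x * G x ∂(gam n) := by
  have key : ∀ t : ℝ, 0 ≤ (∫ x, G x * G x ∂(gam n)) * (t * t) + (2 * ∫ x, F x * G x ∂(gam n)) * t + ∫ x, F x * F x ∂(gam n) := by
    intro t
    have : 0 ≤ ∫ x, (F x + t * G x)*(F x + t * G x) ∂(gam n) := integral_nonneg fun x => mul_self_nonneg _
    have e : (fun x => (F x + t * G x)*(F x + t * G x)) = fun x => F x * F x + (2*t) * (F x * G x) + (t*t) * (G x * G x) := by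
      ext x; ring
    rw [e, integral_add, integral_add, integral_const_mul, integral_const_mul] at this
    · linarith
    · exact hF.mul_int hn hF
    · exact (hF.mul_int hn hG).const_mul _
    · exact (hF.mul_int hn hF).add ((hF.mul_int hn hG).const_mul _)
    · exact (hG.mul_int hn hG).const_mul _
  have := discrim_le_zero key
  rw [discrim] at this
  linarith

lemma ratio_bound (b : ℕ → ℝ) (K r : ℝ) (hr : 0 < r) (hb : ∀ k, 0 ≤ b k)
    (hlc : ∀ k, b (k+1)^2 ≤ b k * b (k+2)) (hK : ∀ k, b k ≤ K * r^k) : b 1 ≤ r * b 0 := by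
  by_contra hcon
  push Not at hcon
  have hb1 : 0 < b 1 := lt_of_le_of_lt (mul_nonneg hr.le (hb 0)) hcon
  have hb0 : 0 < b 0 := by
    rcases (hb 0).lt_or_eq with h | h
    · exact h
    · have := hlc 0; rw [← h] at this; simp at this; nlinarith
  set t := b 1 / b 0 with ht
  have hrt : r < t := by rw [ht, lt_div_iff₀ hb0]; exact hcon
  have ht0 : 0 < t := hr.trans hrt
  have step : ∀ k, 0 < b k ∧ t * b k ≤ b (k+1) := by
    intro k
    induction k with
    | zero => exact ⟨hb0, by rw [ht]; field_simp; exact le_rfl⟩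
    | succ k ih =>
      have p1 : 0 < b (k+1) := lt_of_lt_of_le (mul_pos ht0 ih.1) ih.2
      refine ⟨p1, ?_⟩
      have h1 := hlc k
      have h2 : (t * b (k+1)) * b k ≤ b (k+1) * b (k+1) := by
        have := mul_le_mul_of_nonneg_right ih.2 p1.le; linarith
      have h3 : (t * b (k+1)) * b k ≤ b (k+2) * b k := by nlinarith
      exact le_of_mul_le_mul_right h3 ih.1
  have pw : ∀ k, t^k * b 0 ≤ b k := by
    intro k
    induction k with
    | zero => simp
    | succ k ih =>
      calc t^(k+1) * b 0 = t * (t^k * b 0) := by ring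
        _ ≤ t * b k := mul_le_mul_of_nonneg_left ih ht0.le
        _ ≤ _ := (step k).2
  have hq : 1 < t / r := by rwa [lt_div_iff₀ hr, one_mul]
  obtain ⟨N, hN⟩ := pow_unbounded_of_one_lt (K / b 0) hq
  have := (pw N).trans (hK N)
  rw [div_pow, div_lt_div_iff₀ hb0 (pow_pos hr N)] at hN
  linarith

lemma Mop_contr {n : ℕ} (hn : 1 ≤ n) {F : Euc n → ℝ} {C ρ s : ℝ} (hF : DC F C) (hρ : 0 < ρ)
    (h : ρ^2 + s^2 = 1) (h0 : ∫ x, F x ∂(gam n) = 0) :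
    ∫ x, F x * Mop ρ s F x ∂(gam n) ≤ ρ^2 * ∫ x, F x * F x ∂(gam n) := by
  let G : ℕ → Euc n → ℝ := fun k => (Mop ρ s)^[k] F
  have Gs : ∀ k, G (k+1) = Mop ρ s (G k) := fun k => Function.iterate_succ_apply' _ _ _
  have GD : ∀ k, DC (G k) ((ρ^2)^k * C) := by
    intro k
    induction k with
    | zero => simpa [G] using hF
    | succ k ih =>
      rw [Gs]; have := Mop_DC hn ih h
      rwa [← mul_assoc, ← pow_succ'] at this
  have Gm : ∀ k, ∫ x, G k x ∂(gam n) = 0 := by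
    intro k
    induction k with
    | zero => simpa [G] using h0
    | succ k ih => rw [Gs, Mop_mean hn ((GD k).qg hn) h, ih]
  have GQ := fun k => (GD k).qg hn
  let b : ℕ → ℝ := fun k => ∫ x, G k x * G k x ∂(gam n)
  have hb : ∀ k, 0 ≤ b k := fun k => integral_nonneg fun x => mul_self_nonneg _
  have hb1 : b 1 ≤ ρ^4 * b 0 := by
    refine ratio_bound b (C^2 * Kc n) (ρ^4) (by positivity) hb ?_ ?_
    · intro k
      have e : b (k+1) = ∫ x, G k x * G (k+2) x ∂(gam n) := by
        show ∫ x, G (k+1) x * G (k+1) x ∂(gam n) = _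
        rw [Gs (k+1), Mop_symm hn (GQ k) (GQ (k+1)) h, ← Gs]
      rw [e]; exact cs_int hn (GQ k) (GQ (k+2))
    · intro k
      refine ((GD k).sq_le hn (Gm k)).trans (le_of_eq ?_)
      rw [mul_pow, ← pow_mul, ← pow_mul, ← pow_mul, show 2*(k*2)=4*k by ring]; ring
  have e1 : G 1 = Mop ρ s F := rfl
  have cs := cs_int hn (GQ 0) (GQ 1)
  change (∫ x, F x * Mop ρ s F x ∂(gam n))^2 ≤ b 0 * b 1 at cs
  refine le_of_sq_le_sq (α := ℝ) ?_ (mul_nonneg (sq_nonneg _) (hb 0))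
  change _ ≤ (ρ^2 * b 0)^2
  nlinarith [hb 0]

lemma var_ineq {n : ℕ} (hn : 1 ≤ n) {F : Euc n → ℝ} {C ρ s : ℝ} (hF : DC F C) (hρ : 0 < ρ)
    (h : ρ^2 + s^2 = 1) (h0 : ∫ x, F x ∂(gam n) = 0) :
    s^2 * ∫ x, F x * F x ∂(gam n) ≤
      1/2 * ∫ q : Euc n × Euc n, (F q.1 - F (ρ • q.1 + s • q.2))^2 ∂((gam n).prod (gam n)) := by
  have := gam_prob hn
  have Q := hF.qg hn
  have c := Mop_contr hn hF hρ h h0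
  rw [Mop_inner hn Q Q h] at c
  have iF := Q.mul_int hn Q
  have mF : StronglyMeasurable (fun x => F x * F x) := Q.1.mul Q.1
  have i1 : Integrable (fun q : Euc n × Euc n => F q.1 * F q.1) ((gam n).prod (gam n)) :=
    iF.comp_fst _
  have i2 : Integrable (fun q : Euc n × Euc n => F (ρ • q.1 + s • q.2) * F (ρ • q.1 + s • q.2)) ((gam n).prod (gam n)) :=
    ((rotm_gam hn h).integrable_comp (g := fun q : Euc n × Euc n => F q.1 * F q.1) i1.aestronglyMeasurable).2 i1
  have e : (fun q : Euc n × Euc n => (F q.1 - F (ρ • q.1 + s • q.2))^2) = fun q =>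
    F q.1 * F q.1 - 2 * (F q.1 * F (ρ • q.1 + s • q.2)) + F (ρ • q.1 + s • q.2) * F (ρ • q.1 + s • q.2) := by
      ext q; ring
  have i3 := Q.mul_rot_int hn Q h
  rw [e, integral_add (f := fun q : Euc n × Euc n => F q.1 * F q.1 - 2 * (F q.1 * F (ρ • q.1 + s • q.2))) (i1.sub (i3.const_mul _)) i2, integral_sub i1 (i3.const_mul _), integral_const_mul,
    rot_fst hn h mF]
  have e2 : ∫ q : Euc n × Euc n, F q.1 * F q.1 ∂((gam n).prod (gam n)) = ∫ x, F x * F x ∂(gam n) := by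
    rw [integral_fun_fst (fun x => F x * F x)]; simp
  rw [e2]
  have : s^2 = 1 - ρ^2 := by linarith
  rw [this]; linarith

/-- even 2-homogeneous functions, C² away from 0 -/
structure Q2 {n : ℕ} (F : Euc n → ℝ) : Prop where
  c2 : ContDiffOn ℝ 2 F {(0 : Euc n)}ᶜ
  hom : ∀ c : ℝ, 0 < c → ∀ x, F (c • x) = c^2 * F x
  even : ∀ x, F (-x) = F x
  zero : F 0 = 0

lemma hom_bound {n : ℕ} {E : Type*} [NormedAddCommGroup E] [NormedSpace ℝ E] (G : Euc n → E) (a : ℕ)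
    (hc : ContinuousOn G {(0 : Euc n)}ᶜ)
    (hom : ∀ c : ℝ, 0 < c → ∀ x : Euc n, x ≠ 0 → G (c • x) = c ^ a • G x) :
    ∃ C, 0 ≤ C ∧ ∀ x : Euc n, x ≠ 0 → ‖G x‖ ≤ C * ‖x‖^a := by
  obtain ⟨C, hC⟩ := (isCompact_sphere (0 : Euc n) 1).exists_bound_of_continuousOn (hc.mono sph_sub)
  refine ⟨max C 0, le_max_right _ _, fun x hx => ?_⟩
  have hx' : 0 < ‖x‖ := norm_pos_iff.2 hx
  have e : x = ‖x‖ • (‖x‖⁻¹ • x) := by rw [smul_smul, mul_inv_cancel₀ hx'.ne', one_smul]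
  have hu : ‖(‖x‖⁻¹ • x)‖ = 1 := by rw [norm_smul, norm_inv, norm_norm, inv_mul_cancel₀ hx'.ne']
  have h0 : ‖x‖⁻¹ • x ≠ 0 := by intro h; rw [h] at hu; simp at hu
  conv_lhs => rw [e]
  rw [hom _ hx' _ h0, norm_smul, norm_pow, norm_norm, mul_comm]
  gcongr
  exact (hC _ (by simpa using hu)).trans (le_max_left _ _)

lemma fderiv_hom {n : ℕ} {E : Type*} [NormedAddCommGroup E] [NormedSpace ℝ E] {G : Euc n → E} {a : ℕ}
    (hd : DifferentiableOn ℝ G {(0 : Euc n)}ᶜ)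
    (hom : ∀ c : ℝ, 0 < c → ∀ x : Euc n, x ≠ 0 → G (c • x) = c ^ (a+1) • G x)
    (c : ℝ) (hc : 0 < c) (x : Euc n) (hx : x ≠ 0) : fderiv ℝ G (c • x) = c^a • fderiv ℝ G x := by
  have h1 : fderiv ℝ (fun x => G (c • x)) x = c • fderiv ℝ G (c • x) := fderiv_comp_smul c
  have h2 : (fun x => G (c • x)) =ᶠ[nhds x] fun x => c ^ (a+1) • G x := by
    filter_upwards [isOpen_compl_singleton.mem_nhds hx] with y hy
    exact hom c hc y hy
  have hdx : DifferentiableAt ℝ G x := hd.differentiableAt (isOpen_compl_singleton.mem_nhds hx)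
  rw [h2.fderiv_eq, fderiv_fun_const_smul hdx] at h1
  have : c • fderiv ℝ G (c • x) = c • (c^a • fderiv ℝ G x) := by
    rw [← h1, smul_smul, pow_succ']
  exact smul_right_injective _ hc.ne' this

lemma Q2.hom' {n : ℕ} {F : Euc n → ℝ} (H : Q2 F) (c : ℝ) (x : Euc n) : F (c • x) = c^2 * F x := by
  rcases lt_trichotomy c 0 with h | h | h
  · rw [← H.even, ← neg_smul, H.hom _ (by linarith)]; ring
  · subst h; simp [H.zero]
  · exact H.hom c h x

lemma Q2.bd {n : ℕ} {F : Euc n → ℝ} (H : Q2 F) : ∃ C, 0 ≤ C ∧ ∀ x, |F x| ≤ C * ‖x‖^2 := by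
  obtain ⟨C, hC, h⟩ := hom_bound F 2 H.c2.continuousOn (fun c hc x _ => H.hom c hc x)
  refine ⟨C, hC, fun x => ?_⟩
  by_cases hx : x = 0
  · subst hx; simp [H.zero]
  · exact h x hx

lemma Q2.diff {n : ℕ} {F : Euc n → ℝ} (H : Q2 F) : Differentiable ℝ F := by
  intro x
  by_cases hx : x = 0
  · subst hx
    obtain ⟨C, hC, h⟩ := H.bd
    have : F =O[nhds 0] fun x => ‖x - 0‖^2 := by
      refine Asymptotics.IsBigO.of_bound C (Filter.Eventually.of_forall fun x => ?_)
      rw [sub_zero, Real.norm_eq_abs, norm_pow, norm_norm]; exact h x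
    exact (this.hasFDerivAt (by norm_num)).differentiableAt
  · exact (H.c2.contDiffAt (isOpen_compl_singleton.mem_nhds hx)).differentiableAt (by norm_num)

lemma Q2.fd0 {n : ℕ} {F : Euc n → ℝ} (H : Q2 F) : fderiv ℝ F 0 = 0 := by
  obtain ⟨C, hC, h⟩ := H.bd
  have : F =O[nhds 0] fun x => ‖x - 0‖^2 := by
    refine Asymptotics.IsBigO.of_bound C (Filter.Eventually.of_forall fun x => ?_)
    rw [sub_zero, Real.norm_eq_abs, norm_pow, norm_norm]; exact h x
  exact (this.hasFDerivAt (by norm_num)).fderiv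

lemma Q2.fd_hom {n : ℕ} {F : Euc n → ℝ} (H : Q2 F) (c : ℝ) (hc : 0 < c) (x : Euc n) (hx : x ≠ 0) :
    fderiv ℝ F (c • x) = c • fderiv ℝ F x := by
  have := fderiv_hom (a := 1) H.diff.differentiableOn (fun c hc x _ => by rw [H.hom c hc]; rfl) c hc x hx
  simpa using this

lemma Q2.fd_bd {n : ℕ} {F : Euc n → ℝ} (H : Q2 F) : ∃ C, 0 ≤ C ∧ ∀ x, ‖fderiv ℝ F x‖ ≤ C * ‖x‖ := by
  obtain ⟨C, hC, h⟩ := hom_bound (fderiv ℝ F) 1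
    (H.c2.continuousOn_fderiv_of_isOpen isOpen_compl_singleton (by norm_num))
    (fun c hc x hx => by rw [H.fd_hom c hc x hx, pow_one])
  refine ⟨C, hC, fun x => ?_⟩
  by_cases hx : x = 0
  · subst hx; simp [H.fd0]
  · simpa using h x hx

lemma Q2.fdd {n : ℕ} {F : Euc n → ℝ} (H : Q2 F) : ContDiffOn ℝ 1 (fderiv ℝ F) {(0 : Euc n)}ᶜ :=
  H.c2.fderiv_of_isOpen isOpen_compl_singleton (by norm_num)

lemma Q2.fdd_bd {n : ℕ} {F : Euc n → ℝ} (H : Q2 F) : ∃ C, 0 ≤ C ∧ ∀ x, x ≠ 0 → ‖fderiv ℝ (fderiv ℝ F) x‖ ≤ C := by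
  obtain ⟨C, hC, h⟩ := hom_bound (fderiv ℝ (fderiv ℝ F)) 0
    (H.fdd.continuousOn_fderiv_of_isOpen isOpen_compl_singleton (by norm_num))
    (fun c hc x hx => fderiv_hom (a := 0) (H.fdd.differentiableOn (by norm_num))
      (fun c hc x hx => by rw [H.fd_hom c hc x hx, zero_add, pow_one]) c hc x hx)
  exact ⟨C, hC, fun x hx => by simpa using h x hx⟩

lemma Q2.lip {n : ℕ} {F : Euc n → ℝ} {C : ℝ} (H : Q2 F) (hC : 0 ≤ C) (h : ∀ x, ‖fderiv ℝ F x‖ ≤ C * ‖x‖) (x y : Euc n) :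
    |F y - F x| ≤ C * (‖x‖+‖y‖) * ‖y - x‖ := by
  have := (convex_segment x y).norm_image_sub_le_of_norm_fderiv_le (𝕜 := ℝ) (f := F) (C := C * (‖x‖+‖y‖))
    (fun z _ => H.diff z) (fun z hz => ?_) (left_mem_segment ℝ x y) (right_mem_segment ℝ x y)
  · simpa using this
  · refine (h z).trans ?_
    gcongr
    obtain ⟨a, b, ha, hb, hab, rfl⟩ := hz
    refine (norm_add_le _ _).trans ?_
    rw [norm_smul, norm_smul, Real.norm_of_nonneg ha, Real.norm_of_nonneg hb]
    nlinarith [norm_nonneg x, norm_nonneg y]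

lemma Q2.dc {n : ℕ} {F : Euc n → ℝ} (H : Q2 F) : ∃ C, DC F C := by
  obtain ⟨C0, hC0, h0⟩ := H.bd
  obtain ⟨C2, hC2, h2⟩ := H.fdd_bd
  refine ⟨2*C0+2*C2, H.diff.continuous.stronglyMeasurable, H.even, fun x y => ?_⟩
  by_cases hz : ∃ t : ℝ, |t| ≤ 1 ∧ x + t • y = 0
  · obtain ⟨t, ht, e⟩ := hz
    have ex : x = (-t) • y := by rw [neg_smul]; exact eq_neg_of_add_eq_zero_left e
    have e1 : x + y = (1-t) • y := by rw [ex]; module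
    have e2 : x - y = (-(1+t)) • y := by rw [ex]; module
    rw [e1, e2, ex, H.hom', H.hom', H.hom']
    have : (1-t)^2 * F y + (-(1+t))^2*F y - 2 * ((-t)^2 * F y) = 2 * F y := by ring
    rw [this, abs_mul, abs_two]
    have := h0 y
    nlinarith [mul_nonneg hC2 (sq_nonneg ‖y‖)]
  · push Not at hz
    have fdl : ∀ t ∈ Set.Icc (0:ℝ) 1, ‖fderiv ℝ F (x + t • y) - fderiv ℝ F (x - t • y)‖ ≤ C2 * (2 * ‖y‖) := by
      intro t ht
      have hs : ∀ z ∈ segment ℝ (x - t • y) (x + t • y), z ≠ 0 := by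
        rintro z ⟨a, b, ha, hb, hab, rfl⟩
        have : a • (x - t • y) + b • (x + t • y) = x + ((b-a)*t) • y := by
          have : a • (x - t • y) + b • (x + t • y) = (a+b) • x + ((b-a)*t) • y := by module
          rw [this, hab, one_smul]
        rw [this]
        refine hz _ ?_
        rw [abs_mul]
        refine mul_le_one₀ (abs_le.2 ⟨by linarith, by linarith⟩) (abs_nonneg _) ?_
        rw [abs_of_nonneg ht.1]; exact ht.2
      have := (convex_segment (x - t • y) (x + t • y)).norm_image_sub_le_of_norm_fderiv_le (𝕜 := ℝ) (f := fderiv ℝ F) (C := C2)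
        (fun z hz' => (H.fdd.contDiffAt (isOpen_compl_singleton.mem_nhds (hs z hz'))).differentiableAt (by norm_num))
        (fun z hz' => h2 z (hs z hz')) (left_mem_segment ℝ _ _) (right_mem_segment ℝ _ _)
      refine this.trans ?_
      gcongr
      have : x + t • y - (x - t • y) = (2*t) • y := by module
      rw [this, norm_smul, Real.norm_of_nonneg (by linarith [ht.1])]
      nlinarith [norm_nonneg y, ht.2]
    have hd : ∀ t ∈ Set.Icc (0:ℝ) 1, HasDerivWithinAt (fun t : ℝ => F (x + t • y) + F (x - t • y))
        ((fderiv ℝ F (x + t • y) - fderiv ℝ F (x - t • y)) y) (Set.Icc 0 1) t := by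
      intro t _
      have l1 : HasDerivAt (fun t : ℝ => x + t • y) y t := by
        simpa using ((hasDerivAt_id t).smul_const y).const_add x
      have l2 : HasDerivAt (fun t : ℝ => x - t • y) (-y) t := by
        simpa using ((hasDerivAt_id t).smul_const y).const_sub x
      have := ((H.diff (x + t • y)).hasFDerivAt.comp_hasDerivAt t l1).add
        ((H.diff (x - t • y)).hasFDerivAt.comp_hasDerivAt t l2)
      have e : (fderiv ℝ F (x + t • y) - fderiv ℝ F (x - t • y)) y = fderiv ℝ F (x + t • y) y + fderiv ℝ F (x - t • y) (-y) := by
        simp [sub_eq_add_neg]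
      rw [e]
      exact this.hasDerivWithinAt
    have := norm_image_sub_le_of_norm_deriv_le_segment_01' (C := C2 * (2 * ‖y‖) * ‖y‖) hd (fun t ht => by
      refine (ContinuousLinearMap.le_opNorm _ _).trans ?_
      gcongr
      exact fdl t ⟨ht.1, ht.2.le⟩)
    simp only [one_smul, zero_smul, add_zero, sub_zero, Real.norm_eq_abs] at this
    have e : F (x+y) + F (x-y) - 2 * F x = F (x+y) + F (x-y) - (F x + F x) := by ring
    rw [e]
    nlinarith [mul_nonneg hC0 (sq_nonneg ‖y‖)]

lemma curve_deriv {n : ℕ} (x z : Euc n) :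
    HasDerivAt (fun s : ℝ => √(1-s^2) • x + s • z) z 0 := by
  have h1 : HasDerivAt (fun s : ℝ => √(1-s^2)) 0 0 := by
    have : HasDerivAt (fun s : ℝ => 1 - s^2) 0 0 := by
      simpa using ((hasDerivAt_id (0:ℝ)).pow 2).const_sub 1
    simpa using this.sqrt (by norm_num)
  have := (h1.smul_const x).fun_add ((hasDerivAt_id (0:ℝ)).smul_const z)
  simp only [zero_smul, zero_add, one_smul, id] at this
  exact this

lemma Q2.lim {n : ℕ} (hn : 1 ≤ n) {F : Euc n → ℝ} (H : Q2 F) (h0 : ∫ x, F x ∂(gam n) = 0) :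
    ∫ x, F x * F x ∂(gam n) ≤
      1/2 * ∫ q : Euc n × Euc n, (fderiv ℝ F q.1 q.2)^2 ∂((gam n).prod (gam n)) := by
  have := gam_prob hn
  obtain ⟨C, hD⟩ := H.dc
  obtain ⟨B, hB, hf⟩ := H.fd_bd
  have hS : ∀ᶠ s : ℝ in nhdsWithin 0 (Set.Ioi 0), 0 < s ∧ s < 1 := by
    filter_upwards [self_mem_nhdsWithin, mem_nhdsWithin_of_mem_nhds (Iio_mem_nhds (by norm_num : (0:ℝ) < 1))] with s h1 h2
    exact ⟨h1, h2⟩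
  have lim : Filter.Tendsto (fun s : ℝ => ∫ q : Euc n × Euc n, (s⁻¹ * (F (√(1-s^2) • q.1 + s • q.2) - F q.1))^2 ∂((gam n).prod (gam n)))
      (nhdsWithin 0 (Set.Ioi 0)) (nhds (∫ q : Euc n × Euc n, (fderiv ℝ F q.1 q.2)^2 ∂((gam n).prod (gam n)))) := by
    refine tendsto_integral_filter_of_dominated_convergence
      (fun q => (4*B^2 * (1+‖q.1‖)^4) * (1+‖q.2‖)^4) ?_ ?_ ?_ ?_
    · refine Filter.Eventually.of_forall fun s => Continuous.aestronglyMeasurable ?_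
      have := H.diff.continuous
      fun_prop
    · filter_upwards [hS] with s hs
      refine Filter.Eventually.of_forall fun q => ?_
      have hs2 : 0 ≤ 1 - s^2 := by nlinarith
      set ρ := √(1-s^2) with hρ
      have hρ0 : 0 ≤ ρ := Real.sqrt_nonneg _
      have hρ2 : ρ^2 = 1 - s^2 := Real.sq_sqrt hs2
      have hρ1 : ρ ≤ 1 := by nlinarith
      have hρs : 1 - ρ ≤ s := by nlinarith
      have l := H.lip hB hf q.1 (ρ • q.1 + s • q.2)
      have n1 : ‖ρ • q.1 + s • q.2‖ ≤ ‖q.1‖ + ‖q.2‖ := by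
        refine (norm_add_le _ _).trans ?_
        rw [norm_smul, norm_smul, Real.norm_of_nonneg hρ0, Real.norm_of_nonneg hs.1.le]
        nlinarith [norm_nonneg q.1, norm_nonneg q.2, hs.2]
      have n2 : ‖ρ • q.1 + s • q.2 - q.1‖ ≤ s * (‖q.1‖ + ‖q.2‖) := by
        have : ρ • q.1 + s • q.2 - q.1 = s • q.2 - (1-ρ) • q.1 := by module
        rw [this]
        refine (norm_sub_le _ _).trans ?_
        rw [norm_smul, norm_smul, Real.norm_of_nonneg hs.1.le, Real.norm_of_nonneg (by linarith)]
        nlinarith [norm_nonneg q.1, norm_nonneg q.2, hs.2]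
      have n3 : ‖q.1‖ + ‖q.2‖ ≤ (1+‖q.1‖)*(1+‖q.2‖) := by
        nlinarith [norm_nonneg q.1, norm_nonneg q.2, mul_nonneg (norm_nonneg q.1) (norm_nonneg q.2)]
      have n4 : ‖q.1‖ ≤ (1+‖q.1‖)*(1+‖q.2‖) := by linarith [norm_nonneg q.2]
      rw [Real.norm_eq_abs, abs_pow, abs_mul, abs_inv, abs_of_pos hs.1]
      have : s⁻¹ * |F (ρ • q.1 + s • q.2) - F q.1| ≤ 2 * B * ((1+‖q.1‖)*(1+‖q.2‖))^2 := by
        rw [inv_mul_le_iff₀ hs.1]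
        refine l.trans ?_
        have := mul_nonneg hB (add_nonneg (norm_nonneg q.1) (norm_nonneg (ρ • q.1 + s • q.2)))
        calc B * (‖q.1‖ + ‖ρ • q.1 + s • q.2‖) * ‖ρ • q.1 + s • q.2 - q.1‖
            ≤ B * (((1+‖q.1‖)*(1+‖q.2‖)) + ((1+‖q.1‖)*(1+‖q.2‖))) * (s * ((1+‖q.1‖)*(1+‖q.2‖))) := by
              gcongr
              · exact n1.trans n3
              · exact n2.trans (mul_le_mul_of_nonneg_left n3 hs.1.le)
          _ = _ := by ring
      refine (pow_le_pow_left₀ (mul_nonneg (inv_nonneg.2 hs.1.le) (abs_nonneg _)) this 2).trans (le_of_eq ?_)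
      ring
    · exact ((gam_pow hn 4).const_mul (4*B^2)).mul_prod (gam_pow hn 4)
    · refine Filter.Eventually.of_forall fun q => ?_
      have c := (H.diff (√(1-(0:ℝ)^2) • q.1 + (0:ℝ) • q.2)).hasFDerivAt.comp_hasDerivAt (0:ℝ) (curve_deriv q.1 q.2)
      have := c.tendsto_slope_zero_right
      have e : √(1-(0:ℝ)^2) • q.1 + (0:ℝ) • q.2 = q.1 := by simp
      simp only [Function.comp_apply, zero_add, smul_eq_mul] at this
      rw [e] at this
      exact this.pow 2
  refine ge_of_tendsto (lim.const_mul (1/2)) ?_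
  filter_upwards [hS] with s hs
  have hs2 : 0 < 1 - s^2 := by nlinarith
  have v := var_ineq hn hD (Real.sqrt_pos.2 hs2) (ρ := √(1-s^2)) (s := s) (by rw [Real.sq_sqrt hs2.le]; ring) h0
  have e : ∀ q : Euc n × Euc n, (s⁻¹ * (F (√(1-s^2) • q.1 + s • q.2) - F q.1))^2 = (s^2)⁻¹ * (F q.1 - F (√(1-s^2) • q.1 + s • q.2))^2 := by
    intro q; rw [mul_pow, inv_pow]; ring
  simp_rw [e]
  rw [integral_const_mul]
  have : 0 < s^2 := by have := hs.1; positivity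
  rw [← mul_assoc, mul_comm (1/2:ℝ), mul_assoc, le_inv_mul_iff₀ this]
  exact v

lemma sph_norm {n : ℕ} (u : sphere (0 : Euc n) 1) : ‖(u : Euc n)‖ = 1 := by simp

lemma dot_self_of_norm {n : ℕ} (u : Euc n) (hu : ‖u‖ = 1) : (u : Fin n → ℝ) ⬝ᵥ u = 1 := by
  rw [← inner_eq_dot, real_inner_self_eq_norm_sq, hu]; norm_num

lemma Sm_one_zero {n : ℕ} (hn : 2 ≤ n) : Sm 1 (0 : Matrix (Fin n) (Fin n) ℝ) = 1 := by
  set u : Euc n := EuclideanSpace.single (⟨0, by omega⟩ : Fin n) 1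
  have hu : ‖u‖ = 1 := by simp [u]
  have := Sm_smul 0 0 (H0 (u : Fin n → ℝ))
  rw [zero_smul, pow_zero, one_smul, zero_add] at this
  rw [this, Sm_H0 hn _ (dot_self_of_norm u hu) 0]; simp

lemma SF_zero {n : ℕ} : SF (fun _ : Euc n => (0:ℝ)) :=
  ⟨contDiffOn_const, by simp, by simp⟩

lemma sph_second {n : ℕ} (hn : 2 ≤ n) (a : Euc n) :
    (n:ℝ) * ∫ u, ⟪a, (u : Euc n)⟫^2 ∂(sgm n) = ‖a‖^2 * (sgm n).real Set.univ := by
  have hd : ∀ x : Euc n, DifferentiableAt ℝ (fun x => ⟪a, x⟫) x := fun x =>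
    (differentiableAt_const a).inner ℝ differentiableAt_fun_id
  have h1 := sphere_ibp SF_zero (V := fun x => ⟪a, x⟫ • a) (a := 1)
    ((contDiffOn_const.inner ℝ contDiffOn_id).smul contDiffOn_const)
    (fun c hc x hx => by rw [inner_smul_right, pow_one, smul_smul]) 0 (by omega)
  have e0 : ∀ u : Euc n, Hs (fun _ : Euc n => (0:ℝ)) u = 0 := by
    intro u
    have : gradient (fun _ : Euc n => (0:ℝ)) = fun _ => 0 := by ext1 x; simp [gradient]
    rw [Hs, this, Jac]; simp [matOf_zero]
  have e1 : ∀ u : Euc n, (Jac (fun x => ⟪a, x⟫ • a) u).trace = ‖a‖^2 := by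
    intro u
    rw [jac_smul (V := fun _ => a) (hd u) (by fun_prop)]
    have g : gradient (fun x => ⟪a, x⟫) u = a := by
      rw [gradient]
      have : fderiv ℝ (fun x => ⟪a, x⟫) u = InnerProductSpace.toDual ℝ (Euc n) a :=
        (InnerProductSpace.toDual ℝ (Euc n) a).hasFDerivAt.fderiv
      rw [this]; simp
    have z : Jac (fun _ : Euc n => a) u = 0 := by rw [Jac]; simp [matOf_zero]
    rw [g, z, smul_zero, zero_add, trace_vecMulVec, ← inner_eq_dot, real_inner_self_eq_norm_sq]
  simp only [e0, zero_add, Sm_one_zero hn, one_mul, e1, esym_zero] at h1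
  rw [integral_const, smul_eq_mul] at h1
  have e2 : ∀ u : sphere (0 : Euc n) 1, ⟪(u : Euc n), ⟪a, (u : Euc n)⟫ • a⟫ = ⟪a, (u : Euc n)⟫^2 := by
    intro u; rw [inner_smul_right, real_inner_comm]; ring
  simp only [e2] at h1
  rw [mul_comm (‖a‖^2), h1]
  push_cast; ring

lemma gam_polar {n : ℕ} (hn : 1 ≤ n) (F : Euc n → ℝ) (g : Euc n → ℝ) (d : ℕ)
    (hF : ∀ r : ℝ, 0 < r → ∀ u : Euc n, ‖u‖ = 1 → F (r • u) = r ^ d * g u) :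
    ∫ x, F x ∂(gam n) = (gc n)⁻¹ * (Ig (n-1+d) * ∫ u, g u ∂(sgm n)) := by
  rw [gam_int hn, gden_polar hn F g d hF]

lemma gam_second {n : ℕ} (hn : 2 ≤ n) (a : Euc n) : ∫ z, ⟪a, z⟫^2 ∂(gam n) = ‖a‖^2 := by
  rw [gam_polar (by omega) _ (fun z => ⟪a, z⟫^2) 2 (fun r hr u hu => by rw [inner_smul_right]; ring), Ig_rec]
  have h := sph_second hn a
  have hg := gc_pos (n := n) (by omega)
  rw [inv_mul_eq_iff_eq_mul₀ hg.ne', gc_eq (by omega)]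
  have : ((n-1:ℕ):ℝ) + 1 = n := by
    have : n - 1 + 1 = n := by omega
    exact_mod_cast this
  rw [this]
  linear_combination Ig (n-1) * h

lemma Q2.poin {n : ℕ} (hn : 2 ≤ n) {F : Euc n → ℝ} (H : Q2 F) (h0 : ∫ x, F x ∂(gam n) = 0) :
    ∫ x, F x * F x ∂(gam n) ≤ 1/2 * ∫ x, ‖gradient F x‖^2 ∂(gam n) := by
  have := gam_prob (n := n) (by omega)
  refine (H.lim (by omega) h0).trans (le_of_eq ?_)
  obtain ⟨B, hB, hf⟩ := H.fd_bd
  have hc : Continuous (fderiv ℝ F) := by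
    rw [continuous_iff_continuousAt]
    intro x
    by_cases hx : x = 0
    · subst hx
      rw [ContinuousAt, H.fd0, tendsto_zero_iff_norm_tendsto_zero]
      refine squeeze_zero (fun _ => norm_nonneg _) hf ?_
      have : Continuous (fun x : Euc n => B * ‖x‖) := by fun_prop
      simpa using this.tendsto 0
    · exact H.fdd.continuousOn.continuousAt (isOpen_compl_singleton.mem_nhds hx)
  have hi : Integrable (fun q : Euc n × Euc n => (fderiv ℝ F q.1 q.2)^2) ((gam n).prod (gam n)) := by
    refine (((gam_norm_pow (n := n) (by omega) 2).const_mul (B^2)).mul_prod (gam_norm_pow (n := n) (by omega) 2)).mono' ?_ ?_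
    · exact (((hc.comp continuous_fst).clm_apply continuous_snd).pow 2).aestronglyMeasurable
    · refine Filter.Eventually.of_forall fun q => ?_
      rw [norm_pow]
      have : ‖fderiv ℝ F q.1 q.2‖ ≤ B * ‖q.1‖ * ‖q.2‖ :=
        (ContinuousLinearMap.le_opNorm _ _).trans (mul_le_mul_of_nonneg_right (hf _) (norm_nonneg _))
      refine (pow_le_pow_left₀ (norm_nonneg _) this 2).trans (le_of_eq (by ring))
  rw [integral_prod _ hi]
  congr 2; ext x
  rw [← gam_second hn]
  congr 1; ext z
  rw [inner_gradient_left]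

lemma poincare {n : ℕ} (hn : 2 ≤ n) {ψ : Euc n → ℝ} (H : SF ψ) (m : ℝ)
    (hm : ∫ u, ψ u ∂(sgm n) = m * (sgm n).real Set.univ) :
    2 * (n:ℝ) * ∫ u, (ψ u - m)^2 ∂(sgm n) ≤ ∫ u, (‖gradient ψ u‖^2 - ψ u^2) ∂(sgm n) := by
  set F : Euc n → ℝ := fun x => ‖x‖ * ψ x - m * ‖x‖^2 with hFdef
  have hψ0 : ψ 0 = 0 := by have := H.hom 2 (by norm_num) 0; simp at this; linarith
  have HF : Q2 F := by
    refine ⟨?_, fun c hc x => ?_, fun x => ?_, by simp [F]⟩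
    · have : ContDiffOn ℝ 2 (fun x : Euc n => ‖x‖) {(0 : Euc n)}ᶜ := fun x hx => (contDiffAt_norm ℝ hx).contDiffWithinAt
      exact (this.mul H.c2).sub (contDiffOn_const.mul (this.pow 2))
    · simp only [F]; rw [H.hom c hc, norm_smul, Real.norm_of_nonneg hc.le]; ring
    · simp only [F]; rw [H.even, norm_neg]
  have hr : ∀ r : ℝ, 0 < r → ∀ u : Euc n, ‖u‖ = 1 → F (r • u) = r^2 * (ψ u - m) := by
    intro r hr u hu
    rw [HF.hom r hr]; simp [F, hu]
  have cψ : ContinuousOn ψ (sphere 0 1) := H.c2.continuousOn.mono sph_sub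
  have cg : ContinuousOn (gradient ψ) (sphere 0 1) := H.g_cont.mono sph_sub
  have h0 : ∫ x, F x ∂(gam n) = 0 := by
    rw [gam_polar (by omega) F (fun u => ψ u - m) 2 hr, integral_sub (integrable_sph cψ) (integrable_const _), hm]
    simp only [integral_const, smul_eq_mul]; ring
  have P := HF.poin hn h0
  rw [gam_polar (by omega) (fun x => F x * F x) (fun u => (ψ u - m)^2) 4
    (fun r hr' u hu => by rw [hr r hr' u hu]; ring)] at P
  rw [gam_polar (by omega) (fun x => ‖gradient F x‖^2) (fun u => (‖gradient ψ u‖^2 - ψ u^2) + 4 * (ψ u - m)^2) 2 ?_] at P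
  · have e : Ig (n-1+4) = (n+2) * Ig (n-1+2) := by
      have := Ig_rec (n-1+2)
      rw [show n-1+2+2 = n-1+4 by omega] at this
      rw [this]
      congr 1
      have : n - 1 + 1 = n := by omega
      have : ((n-1:ℕ):ℝ) + 1 = n := by exact_mod_cast this
      push_cast; linarith
    have i1 : Integrable (fun u : sphere (0 : Euc n) 1 => ‖gradient ψ u‖^2 - ψ u^2) (sgm n) :=
      integrable_sph (g := fun u => ‖gradient ψ u‖^2 - ψ u^2) ((cg.norm.pow 2).sub (cψ.pow 2))
    have i2 : Integrable (fun u : sphere (0 : Euc n) 1 => (ψ u - m)^2) (sgm n) :=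
      integrable_sph (g := fun u => (ψ u - m)^2) ((cψ.sub continuousOn_const).pow 2)
    rw [e, integral_add i1 (i2.const_mul _), integral_const_mul] at P
    have hI := Ig_pos (n-1+2)
    have hg := inv_pos.2 (gc_pos (n := n) (by omega))
    have hgI := mul_pos hg hI
    set A := ∫ u, (ψ u - m)^2 ∂(sgm n)
    set B := ∫ u, (‖gradient ψ u‖^2 - ψ u^2) ∂(sgm n)
    have : ((gc n)⁻¹ * Ig (n-1+2)) * (2 * n * A) ≤ ((gc n)⁻¹ * Ig (n-1+2)) * B := by
      linear_combination 2 * P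
    exact le_of_mul_le_mul_left this hgI
  · intro r hr' u hu
    have hu0 : u ≠ 0 := by intro h; rw [h] at hu; simp at hu
    have g1 : gradient F (r • u) = r • gradient F u := by
      simp only [gradient]; rw [HF.fd_hom r hr' u hu0, map_smul]
    rw [g1, norm_smul, mul_pow, Real.norm_eq_abs, sq_abs]
    congr 1
    have hd : DifferentiableAt ℝ (fun x : Euc n => ‖x‖) u := (contDiffAt_norm ℝ hu0).differentiableAt (n := 1) (by norm_num)
    have gn : gradient (fun x : Euc n => ‖x‖) u = u := by
      have := grad_radial (χ := fun t => t) hu0 differentiableAt_fun_id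
      simpa [hu] using this
    have g2 : gradient F u = (ψ u - 2 * m) • u + gradient ψ u := by
      have i : fderiv ℝ (fun x : Euc n => ‖x‖) u = InnerProductSpace.toDual ℝ (Euc n) u := by

        simpa [gradient] using congrArg (InnerProductSpace.toDual ℝ (Euc n)) gn
      have : fderiv ℝ F u = (ψ u - 2 * m) • fderiv ℝ (fun x : Euc n => ‖x‖) u + fderiv ℝ ψ u := by
        have f1 := (hd.hasFDerivAt.mul (H.diff hu0).hasFDerivAt).sub ((hd.hasFDerivAt.pow 2).const_mul m)
        have := f1.fderiv
        refine Eq.trans this ?_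
        ext v
        simp [hu]; ring
      rw [gradient, this, i]; simp [gradient]
    have eu := H.euler u hu0
    rw [g2, norm_add_sq_real, inner_smul_left, eu, norm_smul, hu]
    simp only [conj_trivial, Real.norm_eq_abs, mul_one, sq_abs]
    ring

lemma unif_close {n : ℕ} (Φ : Matrix (Fin n) (Fin n) ℝ → ℝ) (hΦ : Continuous Φ) (η : ℝ) (hη : 0 < η) :
    ∃ ε > 0, ∀ u : Euc n, ‖u‖ = 1 → ∀ A : Matrix (Fin n) (Fin n) ℝ,
      (∀ i k, |A i k - H0 (u : Fin n → ℝ) i k| < ε) → |Φ A - Φ (H0 (u : Fin n → ℝ))| < η := by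
  let X := Fin n → Fin n → ℝ
  let Φ' : X → ℝ := Φ
  have hΦ' : Continuous Φ' := hΦ
  let b : Euc n → X := fun u => H0 (u : Fin n → ℝ)
  have hb : Continuous b := by
    refine continuous_pi fun i => continuous_pi fun k => ?_
    simp only [b, H0, Matrix.sub_apply, vecMulVec_apply]
    fun_prop
  have hK : IsCompact (b '' sphere 0 1) := (isCompact_sphere _ _).image hb
  have hK1 := hK.cthickening (r := 1)
  have uc := hK1.uniformContinuousOn_of_continuous hΦ'.continuousOn
  rw [Metric.uniformContinuousOn_iff] at uc
  obtain ⟨δ, hδ, h⟩ := uc η hη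
  refine ⟨min δ 1 , by positivity, fun u hu A hA => ?_⟩
  have hu' : b u ∈ b '' sphere 0 1 := ⟨u, by simpa using hu, rfl⟩
  have hd : @dist X _ A (b u) < min δ 1 := by
    refine (dist_pi_lt_iff (by positivity)).2 fun i => (dist_pi_lt_iff (by positivity)).2 fun k => ?_
    rw [Real.dist_eq]; exact hA i k
  have := h (A : X) (mem_cthickening_of_dist_le _ (b u) _ _ hu' (hd.le.trans (min_le_right _ _)))
    (b u) (self_subset_cthickening _ hu') (hd.trans_le (min_le_left _ _))
  exact this

lemma nonneg_of_sign {g g' : ℝ → ℝ} {r : ℝ} (hg : ∀ x, |x| < r → HasDerivAt g (g' x) x)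
    (hs : ∀ x, |x| < r → 0 ≤ x * g' x) (h0 : g 0 = 0) (x : ℝ) (hx : |x| < r) : 0 ≤ g x := by
  rcases le_total 0 x with h | h
  · have hsub : ∀ y ∈ Set.Icc 0 x, |y| < r := fun y hy => by
      rw [abs_of_nonneg hy.1]; rw [abs_of_nonneg h] at hx; exact hy.2.trans_lt hx
    have := monotoneOn_of_deriv_nonneg (f := g) (convex_Icc 0 x)
      (fun y hy => (hg y (hsub y hy)).continuousAt.continuousWithinAt)
      (fun y hy => (hg y (hsub y (interior_subset hy))).differentiableAt.differentiableWithinAt)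
      (fun y hy => by
        rw [interior_Icc] at hy
        rw [(hg y (hsub y ⟨hy.1.le, hy.2.le⟩)).deriv]
        exact nonneg_of_mul_nonneg_right (hs y (hsub y ⟨hy.1.le, hy.2.le⟩)) hy.1)
    have := this ⟨le_rfl, h⟩ ⟨h, le_rfl⟩ h
    rwa [h0] at this
  · have hsub : ∀ y ∈ Set.Icc x 0, |y| < r := fun y hy => by
      rw [abs_of_nonpos hy.2]; rw [abs_of_nonpos h] at hx; linarith [hy.1]
    have := antitoneOn_of_deriv_nonpos (f := g) (convex_Icc x 0)
      (fun y hy => (hg y (hsub y hy)).continuousAt.continuousWithinAt)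
      (fun y hy => (hg y (hsub y (interior_subset hy))).differentiableAt.differentiableWithinAt)
      (fun y hy => by
        rw [interior_Icc] at hy
        rw [(hg y (hsub y ⟨hy.1.le, hy.2.le⟩)).deriv]
        have := hs y (hsub y ⟨hy.1.le, hy.2.le⟩)
        nlinarith [hy.2])
    have := this ⟨le_rfl, h⟩ ⟨h, le_rfl⟩ h
    rwa [h0] at this

def Tp (p s : ℝ) : ℝ := if p = 0 then Real.log s else (s^p - 1)/p

lemma Tp_deriv (p : ℝ) {s : ℝ} (hs : 0 < s) : HasDerivAt (Tp p) (s^(p-1)) s := by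
  unfold Tp
  by_cases hp : p = 0
  · simp only [hp, if_true]
    rw [zero_sub, Real.rpow_neg_one]
    exact Real.hasDerivAt_log hs.ne'
  · simp only [hp, if_false]
    have := ((Real.hasDerivAt_rpow_const (p := p) (Or.inl hs.ne')).sub_const 1).div_const p
    rwa [mul_div_cancel_left₀ _ hp] at this

lemma Tp_one (p : ℝ) : Tp p 1 = 0 := by unfold Tp; split_ifs <;> simp

lemma Tp_strict (p : ℝ) : StrictMonoOn (Tp p) (Set.Ioi 0) := by
  refine strictMonoOn_of_deriv_pos (convex_Ioi 0) (fun x hx => (Tp_deriv p hx).continuousAt.continuousWithinAt) ?_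
  intro x hx
  rw [interior_Ioi] at hx
  rw [(Tp_deriv p hx).deriv]
  exact Real.rpow_pos_of_pos hx _

lemma Tp_div (p : ℝ) {x σ : ℝ} (hx : 0 < x) (hσ : 0 < σ) : Tp p (x/σ) = σ^(-p) * (Tp p x - Tp p σ) := by
  unfold Tp
  by_cases hp : p = 0
  · simp [hp, Real.log_div hx.ne' hσ.ne']
  · simp only [hp, if_false]
    rw [Real.div_rpow hx.le hσ.le, Real.rpow_neg hσ.le]
    have := Real.rpow_pos_of_pos hσ p
    field_simp
    ring

lemma Tp_bounds (p : ℝ) (hp : p < 1) (η : ℝ) (hη : 0 < η) :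
    ∃ r > 0, r < 1 ∧ ∀ x : ℝ, |x| < r → x - ((1-p)/2 + η) * x^2 ≤ Tp p (1+x) ∧ Tp p (1+x) ≤ x := by
  have hd : ∀ x : ℝ, |x| < 1 → HasDerivAt (fun x => Tp p (1+x)) ((1+x)^(p-1)) x := by
    intro x hx
    have := (Tp_deriv p (s := 1+x) (by linarith [(abs_lt.1 hx).1])).comp x ((hasDerivAt_id x).const_add 1)
    simpa [Function.comp_def] using this
  set q : ℝ → ℝ := fun x => (1+x)^(p-1) - 1 + 2 * ((1-p)/2+η) * x with hq
  have q0 : q 0 = 0 := by simp [q]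
  have qd : HasDerivAt q (2*η) 0 := by
    have h1 : HasDerivAt (fun x : ℝ => (1+x)^(p-1)) (p-1) 0 := by
      have := (Real.hasDerivAt_rpow_const (x := 1+0) (p := p-1) (Or.inl (by norm_num))).comp (0:ℝ) ((hasDerivAt_id (0:ℝ)).const_add 1)
      simpa [Function.comp_def] using this
    have := (h1.sub_const 1).fun_add ((hasDerivAt_id (0:ℝ)).const_mul (2 * ((1-p)/2+η)))
    exact this.congr_deriv (by ring)
  have ev : ∀ᶠ x in nhdsWithin (0:ℝ) {0}ᶜ, 0 < slope q 0 x :=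
    (hasDerivAt_iff_tendsto_slope.1 qd).eventually (lt_mem_nhds (by linarith))
  rw [eventually_nhdsWithin_iff, Metric.eventually_nhds_iff] at ev
  obtain ⟨r, hr, h⟩ := ev
  refine ⟨min r (1/2), by positivity, by linarith [min_le_right r (1/2)], fun x hx => ⟨?_, ?_⟩⟩
  · have := nonneg_of_sign (g := fun x => Tp p (1+x) - (x - ((1-p)/2+η)*x^2)) (g' := q) (r := min r (1/2)) ?_ ?_ (by simp [Tp_one]) x hx
    · linarith
    · intro y hy
      have := (hd y (by linarith [min_le_right r (1/2)])).fun_sub ((hasDerivAt_id y).fun_sub (((hasDerivAt_id y).fun_pow 2).const_mul ((1-p)/2+η)))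
      exact this.congr_deriv (by simp [q]; ring)
    · intro y hy
      by_cases hy0 : y = 0
      · simp [hy0]
      · have := h (y := y) (by rw [dist_zero_right, Real.norm_eq_abs]; exact hy.trans_le (min_le_left _ _)) hy0
        rw [slope_def_field, q0, sub_zero, sub_zero] at this
        have e : y * q y = y^2 * (q y / y) := by field_simp
        rw [e]; positivity
  · have := nonneg_of_sign (g := fun x => x - Tp p (1+x)) (g' := fun x => 1 - (1+x)^(p-1)) (r := min r (1/2)) ?_ ?_ (by simp [Tp_one]) x hx
    · linarith
    · intro y hy
      exact (hasDerivAt_id y).fun_sub (hd y (by linarith [min_le_right r (1/2)]))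
    · intro y hy
      have hy1 : |y| < 1/2 := hy.trans_le (min_le_right _ _)
      have hy2 := abs_lt.1 hy1
      rcases le_total 0 y with h | h
      · exact mul_nonneg h (by linarith [Real.rpow_le_one_of_one_le_of_nonpos (by linarith : 1 ≤ 1 + y) (by linarith : p - 1 ≤ 0)])
      · exact mul_nonneg_of_nonpos_of_nonpos h (by linarith [Real.one_le_rpow_of_pos_of_le_one_of_nonpos (by linarith : 0 < 1+y) (by linarith) (by linarith : p - 1 ≤ 0)])

lemma taylor_le {w w' w'' : ℝ → ℝ} {B : ℝ} (h1 : ∀ s ∈ Set.Icc (0:ℝ) 1, HasDerivAt w (w' s) s)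
    (h2 : ∀ s ∈ Set.Icc (0:ℝ) 1, HasDerivAt w' (w'' s) s) (hB : ∀ s ∈ Set.Icc (0:ℝ) 1, w'' s ≤ B) :
    w 1 ≤ w 0 + w' 0 + B/2 := by
  have a1 : ∀ s ∈ Set.Icc (0:ℝ) 1, w' s - B * s ≤ w' 0 := by
    intro s hs
    have hd : ∀ s ∈ Set.Icc (0:ℝ) 1, HasDerivAt (fun s => w' s - B * s) (w'' s - B * 1) s :=
      fun s hs => (h2 s hs).fun_sub ((hasDerivAt_id s).const_mul B)
    have := antitoneOn_of_deriv_nonpos (f := fun s => w' s - B * s) (convex_Icc 0 1)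
      (fun y hy => (hd y hy).continuousAt.continuousWithinAt)
      (fun y hy => (hd y (interior_subset hy)).differentiableAt.differentiableWithinAt)
      (fun y hy => by rw [(hd y (interior_subset hy)).deriv]; linarith [hB y (interior_subset hy)])
    have := this ⟨le_rfl, zero_le_one⟩ hs hs.1
    simpa using this
  have hd : ∀ s ∈ Set.Icc (0:ℝ) 1, HasDerivAt (fun s => w s - (w' 0 * s + B/2 * s^2)) (w' s - (w' 0 * 1 + B/2*(2*s))) s := by
    intro s hs
    have := (h1 s hs).fun_sub (((hasDerivAt_id s).const_mul (w' 0)).fun_add (((hasDerivAt_id s).fun_pow 2).const_mul (B/2)))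
    exact this.congr_deriv (by simp)
  have := antitoneOn_of_deriv_nonpos (f := fun s => w s - (w' 0 * s + B/2 * s^2)) (convex_Icc 0 1)
      (fun y hy => (hd y hy).continuousAt.continuousWithinAt)
      (fun y hy => (hd y (interior_subset hy)).differentiableAt.differentiableWithinAt)
      (fun y hy => by rw [(hd y (interior_subset hy)).deriv]; linarith [a1 y (interior_subset hy)])
  have := this ⟨le_rfl, zero_le_one⟩ ⟨zero_le_one, le_rfl⟩ zero_le_one
  simp at this
  linarith

lemma sph_deriv {n : ℕ} {h ψ g : Euc n → ℝ} (H : SF h) (Ψ : SF ψ) (k : ℕ)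
    (hg : ContinuousOn g (sphere 0 1)) (s : ℝ) :
    HasDerivAt (fun s : ℝ => ∫ u : sphere (0 : Euc n) 1, g u * esym k (Hs h u + s • Hs ψ u) ∂(sgm n))
      (∫ u : sphere (0 : Euc n) 1, g u * (Sm k (Hs h u + s • Hs ψ u) * Hs ψ u).trace ∂(sgm n)) s := by
  have c1 : Continuous (fun u : sphere (0 : Euc n) 1 => Hs h u) :=
    continuousOn_iff_continuous_domRestrict.1 (H.hs_cont.mono sph_sub)
  have c2 : Continuous (fun u : sphere (0 : Euc n) 1 => Hs ψ u) :=
    continuousOn_iff_continuous_domRestrict.1 (Ψ.hs_cont.mono sph_sub)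
  have c3 : Continuous (fun u : sphere (0 : Euc n) 1 => g u) :=
    continuousOn_iff_continuous_domRestrict.1 hg
  have := hasDerivAt_int_esym (sgm n) Set.univ isCompact_univ k (fun u => g u) (fun u => Hs h u)
    (fun u => Hs ψ u) c3.continuousOn c1.continuousOn c2.continuousOn s
  simpa only [Measure.restrict_univ] using this

lemma hs_comb {n : ℕ} {h ψ : Euc n → ℝ} (H : SF h) (Ψ : SF ψ) (s : ℝ) (u : sphere (0 : Euc n) 1) :
    Hs (fun x => h x + s * ψ x) u = Hs h u + s • Hs ψ u := by
  rw [H.hs_add (Ψ.smul s) (sph_ne u), Ψ.hs_smul s (sph_ne u)]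

lemma quad_bd {n : ℕ} (D : Matrix (Fin n) (Fin n) ℝ) (η : ℝ) (hη : 0 ≤ η) (hD : ∀ i k, |D i k| ≤ η)
    (g : Fin n → ℝ) : |g ⬝ᵥ (D *ᵥ g)| ≤ n * η * (g ⬝ᵥ g) := by
  have e : g ⬝ᵥ (D *ᵥ g) = ∑ i, ∑ k, g i * (D i k * g k) := by
    simp only [dotProduct, mulVec, Finset.mul_sum]
  rw [e]
  calc |∑ i, ∑ k, g i * (D i k * g k)| ≤ ∑ i, ∑ k, |g i| * (η * |g k|) := by
        refine (Finset.abs_sum_le_sum_abs _ _).trans (Finset.sum_le_sum fun i _ => ?_)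
        refine (Finset.abs_sum_le_sum_abs _ _).trans (Finset.sum_le_sum fun k _ => ?_)
        rw [abs_mul, abs_mul]
        gcongr; exact hD i k
    _ = η * (∑ i, |g i|)^2 := by
        rw [sq, Finset.sum_mul_sum, Finset.mul_sum]
        refine Finset.sum_congr rfl fun i _ => ?_
        rw [Finset.mul_sum]
        exact Finset.sum_congr rfl fun k _ => by ring
    _ ≤ η * (n * ∑ i, |g i|^2) := by
        gcongr
        have := sq_sum_le_card_mul_sum_sq (s := Finset.univ) (f := fun i => |g i|)
        simpa using this
    _ = _ := by
        simp only [sq_abs, dotProduct, ← sq]; ring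

lemma gv_dot {n : ℕ} (ψ : Euc n → ℝ) (x : Euc n) : gv ψ x ⬝ᵥ gv ψ x = ‖gradient ψ x‖^2 := by
  rw [← real_inner_self_eq_norm_sq, inner_eq_dot]; rfl

lemma choose_id1 {n m : ℕ} (hm : m + 2 ≤ n - 1) :
    ((n:ℝ) - 1 - m) * ((n-1).choose m : ℝ) = ((n:ℝ)-1) * ((n-2).choose m : ℝ) := by
  obtain ⟨N, rfl⟩ : ∃ N, n = N + 2 := ⟨n - 2, by omega⟩
  have := Nat.choose_mul_succ_eq N m
  simp only [show N + 2 - 1 = N + 1 by omega, show N + 2 - 2 = N by omega] at *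
  have h2 : ((N + 1 - m : ℕ) : ℝ) = (N:ℝ) + 1 - m := by push_cast [Nat.cast_sub (by omega : m ≤ N + 1)]; ring
  have h3 : ((N.choose m : ℕ):ℝ) * ((N:ℝ)+1) = ((N+1).choose m : ℝ) * ((N:ℝ)+1-m) := by
    rw [← h2]; exact_mod_cast this
  push_cast; linear_combination -h3

lemma choose_id2 {n m : ℕ} (hm : m + 2 ≤ n - 1) :
    ((m:ℝ) + 1) * ((n-1).choose (m+1) : ℝ) = ((n:ℝ)-1) * ((n-2).choose m : ℝ) := by
  obtain ⟨N, rfl⟩ : ∃ N, n = N + 2 := ⟨n - 2, by omega⟩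
  have := Nat.add_one_mul_choose_eq N m
  simp only [show N + 2 - 1 = N + 1 by omega, show N + 2 - 2 = N by omega] at *
  have h3 : ((N:ℝ)+1) * ((N.choose m : ℕ):ℝ) = ((N+1).choose (m+1) : ℝ) * ((m:ℝ)+1) := by
    exact_mod_cast this
  push_cast; linear_combination -h3

lemma Sm_quad {n m : ℕ} (hn : 2 ≤ n) (v g : Fin n → ℝ) (hv : v ⬝ᵥ v = 1) :
    g ⬝ᵥ (Sm (m+1) (H0 v) *ᵥ g) = ((n-2).choose m : ℝ) * (g ⬝ᵥ g)
      + (((n-1).choose m : ℝ) - (n-2).choose m) * (v ⬝ᵥ g)^2 := by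
  rw [Sm_H0 hn v hv, add_mulVec, smul_mulVec, smul_mulVec, one_mulVec,
      dotProduct_add, dotProduct_smul, dotProduct_smul, vecMulVec_mulVec]
  simp only [smul_eq_mul]
  congr 2
  rw [sq, dotProduct_comm v g, op_smul_eq_smul, dotProduct_smul, smul_eq_mul]

lemma second_pw0 {n m : ℕ} (hm : m + 2 ≤ n - 1) (v g : Fin n → ℝ) (hv : v ⬝ᵥ v = 1)
    (S : Matrix (Fin n) (Fin n) ℝ) (E η a N : ℝ) (hη : 0 ≤ η)
    (he : |E - (n-1).choose m| ≤ η) (hgg : g ⬝ᵥ g = N) (hug : v ⬝ᵥ g = a)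
    (hS : ∀ i k, |S i k - Sm (m+1) (H0 v) i k| ≤ η) :
    ((n:ℝ) - m) * (a^2 * E) - g ⬝ᵥ (S *ᵥ g) ≤
     (-((n-2).choose m : ℝ) + n * η) * (N - a^2) + (((n:ℝ)-1) * ((n-2).choose m : ℝ) + 2 * (n * η)) * a^2 := by
  have q := quad_bd (S - Sm (m+1) (H0 v)) η hη (fun i k => hS i k) g
  rw [sub_mulVec, dotProduct_sub, Sm_quad (by omega) v g hv, hgg, hug] at q
  have q1 := (abs_le.1 q).1
  have e1 := (abs_le.1 he).2
  have id := choose_id1 hm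
  have hnm : (0:ℝ) ≤ (n:ℝ) - m := by
    have : m ≤ n := by omega
    have : (m:ℝ) ≤ n := by exact_mod_cast this
    linarith
  have hm0 : (0:ℝ) ≤ m := by positivity
  have e2 : ((n:ℝ) - m) * (a^2 * E) ≤ ((n:ℝ)-m) * (a^2 * ((n-1).choose m + η)) := by
    gcongr; linarith
  have e3 : ((n:ℝ)-m) * (a^2 * η) ≤ n * (a^2 * η) := by
    gcongr; linarith
  have e4 : ((n:ℝ) - 1 - m) * ((n-1).choose m : ℝ) * a^2 = ((n:ℝ)-1) * ((n-2).choose m : ℝ) * a^2 := by rw [id]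
  linarith

lemma second_pw {n m : ℕ} (hm : m + 2 ≤ n - 1) {h ψ : Euc n → ℝ} (Ψ : SF ψ)
    (η : ℝ) (hη : 0 ≤ η) (u : Euc n) (hu : ‖u‖ = 1)
    (he : |esym m (Hs h u) - (n-1).choose m| ≤ η)
    (hS : ∀ i k, |Sm (m+1) (Hs h u) i k - Sm (m+1) (H0 (u : Fin n → ℝ)) i k| ≤ η) :
    ((n:ℝ) - m) * (ψ u^2 * esym m (Hs h u)) - gv ψ u ⬝ᵥ (Sm (m+1) (Hs h u) *ᵥ gv ψ u) ≤
     (-((n-2).choose m : ℝ) + n * η) * (‖gradient ψ u‖^2 - ψ u^2) + (((n:ℝ)-1) * ((n-2).choose m : ℝ) + 2 * (n * η)) * ψ u^2 := by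
  have hug : (u : Fin n → ℝ) ⬝ᵥ gv ψ u = ψ u := by
    rw [← Ψ.euler u (by intro h; simp [h] at hu), inner_eq_dot]; rfl
  exact second_pw0 hm _ _ (dot_self_of_norm u hu) _ _ η _ _ hη he (gv_dot ψ u) hug hS

set_option maxHeartbeats 1000000 in
lemma second_bound {n m : ℕ} (hm : m + 2 ≤ n - 1) {h ψ : Euc n → ℝ} (H : SF h) (Ψ : SF ψ)
    (η : ℝ) (hη : 0 ≤ η)
    (he : ∀ u : Euc n, ‖u‖ = 1 → |esym m (Hs h u) - (n-1).choose m| ≤ η)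
    (hS : ∀ u : Euc n, ‖u‖ = 1 → ∀ i k, |Sm (m+1) (Hs h u) i k - Sm (m+1) (H0 (u : Fin n → ℝ)) i k| ≤ η) :
    ∫ u, (ψ u * (Sm (m+1) (Hs h u) * Hs ψ u).trace) ∂(sgm n) ≤
      -((n-2).choose m : ℝ) * ∫ u, (‖gradient ψ u‖^2 - ψ u^2) ∂(sgm n)
      + ((n:ℝ)-1) * ((n-2).choose m : ℝ) * ∫ u, ψ u^2 ∂(sgm n)
      + n * η * ((∫ u, (‖gradient ψ u‖^2 - ψ u^2) ∂(sgm n)) + 2 * ∫ u, ψ u^2 ∂(sgm n)) := by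
  rw [F2 H Ψ m (by omega)]
  have cψ : ContinuousOn ψ (sphere 0 1) := Ψ.c2.continuousOn.mono sph_sub
  have cg : ContinuousOn (gradient ψ) (sphere 0 1) := Ψ.g_cont.mono sph_sub
  have cgv : ContinuousOn (gv ψ) (sphere 0 1) := (PiLp.continuous_ofLp 2 _).comp_continuousOn cg
  have cH : ContinuousOn (Hs h) (sphere 0 1) := H.hs_cont.mono sph_sub
  have ce : ContinuousOn (fun u => esym m (Hs h u)) (sphere 0 1) := (continuous_esym m).comp_continuousOn cH
  have cS : ContinuousOn (fun u => Sm (m+1) (Hs h u)) (sphere 0 1) := (continuous_Sm (m+1)).comp_continuousOn cH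
  have i1 := integrable_sph (g := fun u => ψ u^2 * esym m (Hs h u)) ((cψ.pow 2).mul ce)
  have i2 := integrable_sph (g := fun u => gv ψ u ⬝ᵥ (Sm (m+1) (Hs h u) *ᵥ gv ψ u))
    (by
      have : Continuous (fun q : (Fin n → ℝ) × Matrix (Fin n) (Fin n) ℝ => q.1 ⬝ᵥ (q.2 *ᵥ q.1)) :=
        continuous_fst.dotProduct (continuous_snd.matrix_mulVec continuous_fst)
      exact this.comp_continuousOn (cgv.prodMk cS))
  have i3 := integrable_sph (g := fun u => ‖gradient ψ u‖^2 - ψ u^2) ((cg.norm.pow 2).sub (cψ.pow 2))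
  have i4 := integrable_sph (g := fun u => ψ u^2) (cψ.pow 2)
  rw [← integral_const_mul, ← integral_sub (i1.const_mul _) i2]
  have key : ∫ u : sphere (0 : Euc n) 1, (((n:ℝ) - m) * (ψ u^2 * esym m (Hs h u)) - gv ψ u ⬝ᵥ (Sm (m+1) (Hs h u) *ᵥ gv ψ u)) ∂(sgm n)
     ≤ ∫ u : sphere (0 : Euc n) 1, ((-((n-2).choose m : ℝ) + n * η) * (‖gradient ψ u‖^2 - ψ u^2) + (((n:ℝ)-1) * ((n-2).choose m : ℝ) + 2 * (n * η)) * ψ u^2) ∂(sgm n) := by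
    refine integral_mono ((i1.const_mul _).sub i2) ((i3.const_mul _).add (i4.const_mul _)) fun u => ?_
    exact second_pw hm Ψ η hη u (sph_norm u) (he u (sph_norm u)) (hS u (sph_norm u))
  refine key.trans (le_of_eq ?_)
  rw [integral_add (i3.const_mul _) (i4.const_mul _), integral_const_mul, integral_const_mul]
  ring

lemma sgm_pos {n : ℕ} (hn : 1 ≤ n) : 0 < (sgm n).real Set.univ := by
  unfold sgm
  rw [Measure.toSphere_real_apply_univ]
  have h1 : (0:ℝ) < Module.finrank ℝ (Euc n) := by simp; omega
  have h2 : 0 < (volume : Measure (Euc n)).real (ball 0 1) :=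
    ENNReal.toReal_pos (measure_ball_pos _ _ one_pos).ne' measure_ball_lt_top.ne
  positivity

lemma cint {n : ℕ} {g : sphere (0 : Euc n) 1 → ℝ} (hg : Continuous g) : Integrable g (sgm n) :=
  hg.integrable_of_hasCompactSupport (HasCompactSupport.of_compactSpace _)

lemma sq_shift {n : ℕ} {g : sphere (0 : Euc n) 1 → ℝ} (hg : Continuous g) (t : ℝ) :
    ∫ u, (g u - t)^2 ∂(sgm n) = (∫ u, g u^2 ∂(sgm n)) - 2 * t * (∫ u, g u ∂(sgm n)) + t^2 * (sgm n).real Set.univ := by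
  have i1 := cint (hg.pow 2)
  have i2 := cint hg
  have e : (fun u => (g u - t)^2) = fun u => (g u^2 - 2 * t * g u) + t^2 := by ext u; ring
  rw [e, integral_add (f := fun u => g u^2 - 2 * t * g u) (i1.sub (i2.const_mul _)) (integrable_const _),
    integral_sub (f := fun u => g u^2) i1 (i2.const_mul _), integral_const_mul, integral_const]
  simp only [smul_eq_mul]; ring

lemma mean_est {n : ℕ} (hn : 1 ≤ n) {g : sphere (0 : Euc n) 1 → ℝ} (hg : Continuous g) (E0 κ : ℝ) (hE : 0 < E0)
    (hκ : 0 ≤ κ)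
    (hb : E0 * |∫ u, g u ∂(sgm n)| ≤ κ * ∫ u, |g u| ∂(sgm n)) (m : ℝ)
    (hm : ∫ u, g u ∂(sgm n) = m * (sgm n).real Set.univ) :
    (1 - κ^2/E0^2) * ∫ u, g u^2 ∂(sgm n) ≤ ∫ u, (g u - m)^2 ∂(sgm n) := by
  have R := sgm_pos hn
  rw [sq_shift hg]
  have h2 := sq_shift hg.abs ((∫ u, |g u| ∂(sgm n)) / (sgm n).real Set.univ)
  have h3 : 0 ≤ ∫ u, (|g u| - (∫ u, |g u| ∂(sgm n)) / (sgm n).real Set.univ)^2 ∂(sgm n) :=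
    integral_nonneg fun u => sq_nonneg _
  rw [h2] at h3
  simp only [sq_abs] at h3
  rw [hm] at hb ⊢
  generalize (sgm n).real Set.univ = r at *
  generalize ∫ u, |g u| ∂(sgm n) = A at *
  generalize ∫ u, g u^2 ∂(sgm n) = P at *
  have h4 : A^2 / r ≤ P := by
    have : P - 2 * (A/r) * A + (A/r)^2 * r = P - A^2/r := by field_simp; ring
    linarith
  have h5 : E0^2 * (m * r)^2 ≤ κ^2 * A^2 := by
    have := pow_le_pow_left₀ (by positivity) hb 2
    rw [mul_pow, mul_pow, sq_abs] at this; exact this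
  have h6 : m^2 * r ≤ κ^2/E0^2 * (A^2 / r) := by
    rw [div_mul_div_comm, le_div_iff₀ (by positivity)]
    nlinarith
  have h7 : κ^2/E0^2 * (A^2 / r) ≤ κ^2/E0^2 * P := by gcongr
  nlinarith

lemma W_taylor {n m : ℕ} (hm : m + 2 ≤ n - 1) {h ψ : Euc n → ℝ} (H : SF h) (Ψ : SF ψ) (B : ℝ)
    (hB : ∀ s ∈ Set.Icc (0:ℝ) 1,
      ∫ u, (ψ u * (Sm (m+1) (Hs (fun x => h x + s * ψ x) u) * Hs ψ u).trace) ∂(sgm n) ≤ B) :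
    Wf (m+2) (fun x => h x + ψ x) ≤ Wf (m+2) h +
      ((n:ℝ) - (m+2)) * ((∫ u, ψ u * esym (m+1) (Hs h u) ∂(sgm n)) + B/2) := by
  have hnm : (0:ℝ) ≤ (n:ℝ) - (m+2) := by
    have : m + 2 ≤ n := by omega
    have : ((m+2:ℕ):ℝ) ≤ n := by exact_mod_cast this
    push_cast at this; linarith
  have d1 : ∀ s ∈ Set.Icc (0:ℝ) 1, HasDerivAt (fun s : ℝ => Wf (m+2) (fun x => h x + s * ψ x))
      (((n:ℝ) - (m+2)) * ∫ u : sphere (0 : Euc n) 1, ψ u * esym (m+1) (Hs h u + s • Hs ψ u) ∂(sgm n)) s := by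
    intro s _
    have := sph_deriv (g := fun _ => 1) H Ψ (m+2) continuousOn_const s
    have f := F1 (H.add (Ψ.smul s)) Ψ (m+1) (by omega)
    simp only [hs_comb H Ψ] at f
    simp only [one_mul] at this
    rw [f] at this
    have e : (fun s : ℝ => Wf (m+2) (fun x => h x + s * ψ x)) =
        fun s : ℝ => ∫ u : sphere (0 : Euc n) 1, esym (m+2) (Hs h u + s • Hs ψ u) ∂(sgm n) := by
      ext s; simp only [Wf, hs_comb H Ψ]
    rw [e]
    exact this.congr_deriv (by push_cast; ring)
  have d2 : ∀ s ∈ Set.Icc (0:ℝ) 1, HasDerivAt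
      (fun s : ℝ => ((n:ℝ) - (m+2)) * ∫ u : sphere (0 : Euc n) 1, ψ u * esym (m+1) (Hs h u + s • Hs ψ u) ∂(sgm n))
      (((n:ℝ) - (m+2)) * ∫ u : sphere (0 : Euc n) 1, ψ u * (Sm (m+1) (Hs h u + s • Hs ψ u) * Hs ψ u).trace ∂(sgm n)) s :=
    fun s _ => (sph_deriv H Ψ (m+1) (Ψ.c2.continuousOn.mono sph_sub) s).const_mul _
  have := taylor_le (B := ((n:ℝ) - (m+2)) * B) d1 d2 (fun s hs => by
    have := hB s hs
    simp only [hs_comb H Ψ] at this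
    exact mul_le_mul_of_nonneg_left this hnm)
  simp only [one_mul, zero_mul, add_zero, zero_smul] at this
  linarith

def Close {n : ℕ} (h : Euc n → ℝ) (ε : ℝ) : Prop :=
  ∀ u : Euc n, ‖u‖ = 1 → |h u - 1| < ε ∧ ‖gradient h u - u‖ < ε ∧
    ∀ i k, |Hs h u i k - H0 (u : Fin n → ℝ) i k| < ε

lemma tp_est {n : ℕ} {h ψ E G : sphere (0 : Euc n) 1 → ℝ} (ch : Continuous h) (cψ : Continuous ψ)
    (cE : Continuous E) (cG : Continuous G) (η c E0 : ℝ) (hη : 0 < η) (hη4 : η < 1/4) (hc : 0 ≤ c)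
    (hE0 : η < E0) (h1 : ∀ u, |h u - 1| ≤ η) (h2 : ∀ u, |ψ u| ≤ 2 * η) (h3 : ∀ u, |E u - E0| ≤ η)
    (h4 : ∀ u, ψ u / h u - c * (ψ u / h u)^2 ≤ G u) (h5 : ∀ u, G u ≤ ψ u / h u)
    (h0 : ∫ u, h u * G u * E u ∂(sgm n) = 0) :
    ∫ u, ψ u * E u ∂(sgm n) ≤ c * (E0 + η) * (1 + 2 * η) * ∫ u, ψ u^2 ∂(sgm n) ∧
    E0 * |∫ u, ψ u ∂(sgm n)| ≤ (η * (1 + 2 * (c * (E0 + η) * (1 + 2 * η)))) * ∫ u, |ψ u| ∂(sgm n) := by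
  have hh : ∀ u, 0 < h u := fun u => by linarith [(abs_le.1 (h1 u)).1]
  have hE : ∀ u, 0 < E u := fun u => by linarith [(abs_le.1 (h3 u)).1]
  have i1 : Integrable (fun u => h u * G u * E u) (sgm n) := cint ((ch.mul cG).mul cE)
  have i2 : Integrable (fun u => ψ u * E u) (sgm n) := cint (cψ.mul cE)
  have i3 : Integrable (fun u => ψ u ^ 2) (sgm n) := cint (cψ.pow 2)
  have i4 := cint cψ.abs
  have i5 := cint cψ
  set M := c * (E0 + η) * (1 + 2 * η) with hM
  have hE00 : 0 < E0 := by linarith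
  have hM0 : 0 ≤ M := by positivity
  have low : 0 ≤ ∫ u, ψ u * E u ∂(sgm n) := by
    rw [← h0]
    refine integral_mono i1 i2 fun u => ?_
    have : h u * G u ≤ ψ u := by
      have := mul_le_mul_of_nonneg_left (h5 u) (hh u).le
      rwa [mul_div_cancel₀ _ (hh u).ne'] at this
    exact mul_le_mul_of_nonneg_right this (hE u).le
  have up : ∫ u, ψ u * E u ∂(sgm n) ≤ M * ∫ u, ψ u^2 ∂(sgm n) := by
    have : ∫ u, ψ u * E u ∂(sgm n) ≤ ∫ u, (h u * G u * E u + M * ψ u^2) ∂(sgm n) := by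
      refine integral_mono i2 (i1.add (i3.const_mul M)) fun u => ?_
      simp only []
      have a1 := mul_le_mul_of_nonneg_left (h4 u) (hh u).le
      have a2 : h u * (ψ u / h u - c * (ψ u / h u)^2) = ψ u - c * (ψ u ^2 / h u) := by
        have := (hh u).ne'
        field_simp
      rw [a2] at a1
      have a3 : 1 / h u ≤ 1 + 2 * η := by
        rw [div_le_iff₀ (hh u)]
        nlinarith [(abs_le.1 (h1 u)).1]
      have a4 : ψ u^2 / h u ≤ (1 + 2 * η) * ψ u^2 := by
        rw [div_eq_mul_one_div, mul_comm]
        gcongr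
      have a5 : c * (ψ u^2 / h u) * E u ≤ M * ψ u^2 := by
        calc c * (ψ u^2 / h u) * E u ≤ c * ((1 + 2 * η) * ψ u^2) * (E0 + η) := by
              have := (hE u).le
              gcongr
              linarith [(abs_le.1 (h3 u)).2]
          _ = M * ψ u^2 := by rw [hM]; ring
      have a6 := mul_le_mul_of_nonneg_right a1 (hE u).le
      nlinarith
    rw [integral_add i1 (i3.const_mul M), h0, integral_const_mul, zero_add] at this
    exact this
  refine ⟨up, ?_⟩
  have P1 : ∫ u, ψ u^2 ∂(sgm n) ≤ 2 * η * ∫ u, |ψ u| ∂(sgm n) := by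
    rw [← integral_const_mul]
    refine integral_mono i3 (i4.const_mul _) fun u => ?_
    simp only []
    rw [← sq_abs, sq]
    exact mul_le_mul_of_nonneg_right (h2 u) (abs_nonneg _)
  have d : |∫ u, (E0 * ψ u - ψ u * E u) ∂(sgm n)| ≤ η * ∫ u, |ψ u| ∂(sgm n) := by
    rw [← integral_const_mul]
    refine (abs_integral_le_integral_abs).trans (integral_mono ((i5.const_mul E0).sub i2).abs (i4.const_mul _) fun u => ?_)
    simp only []
    rw [show E0 * ψ u - ψ u * E u = -((E u - E0) * ψ u) by ring, abs_neg, abs_mul]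
    exact mul_le_mul_of_nonneg_right (h3 u) (abs_nonneg _)
  rw [integral_sub (i5.const_mul E0) i2, integral_const_mul] at d
  have e : E0 * |∫ u, ψ u ∂(sgm n)| = |E0 * ∫ u, ψ u ∂(sgm n)| := by
    rw [abs_mul, abs_of_pos (by linarith : 0 < E0)]
  rw [e, abs_le]
  have := abs_le.1 d
  have P2 := mul_le_mul_of_nonneg_left P1 hM0
  have A0 : 0 ≤ ∫ u, |ψ u| ∂(sgm n) := integral_nonneg fun u => abs_nonneg _
  constructor
  · have : 0 ≤ η * M * ∫ u, |ψ u| ∂(sgm n) := by positivity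
    nlinarith
  · nlinarith

lemma exists_eta {n m : ℕ} (hm : m + 2 ≤ n - 1) (p : ℝ)
    (hp : (1-p)*((n:ℝ)-1) < (n+1)*(m+1)) :
    ∃ η : ℝ, 0 < η ∧ η < 1/4 ∧ η < ((n-1).choose (m+1) : ℝ) ∧ n * η < ((n-2).choose m : ℝ) ∧
    2 * (((1-p)/2 + η) * (((n-1).choose (m+1) : ℝ) + η) * (1 + 2 * η)) + (n-1)*((n-2).choose m : ℝ) + 2*n*η
      - (((n-2).choose m : ℝ) - n * η) * (2 * n *
        (1 - (η * (1 + 2 * (((1-p)/2 + η) * (((n-1).choose (m+1) : ℝ) + η) * (1 + 2 * η))))^2 / ((n-1).choose (m+1) : ℝ)^2)) < 0 := by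
  have id2 := choose_id2 hm
  have a0 : 0 < ((n-2).choose m : ℝ) := by exact_mod_cast Nat.choose_pos (by omega)
  have E00 : 0 < ((n-1).choose (m+1) : ℝ) := by exact_mod_cast Nat.choose_pos (by omega)
  generalize ((n-2).choose m : ℝ) = a at *
  generalize ((n-1).choose (m+1) : ℝ) = E0 at *
  have neg : (1-p) * E0 + (n-1)*a - 2*n*a < 0 := by
    have hm1 : (0:ℝ) < (m:ℝ)+1 := by positivity
    have : ((m:ℝ)+1) * ((1-p) * E0 + (n-1)*a - 2*n*a) < 0 := by
      have : ((m:ℝ)+1) * ((1-p) * E0 + (n-1)*a - 2*n*a) = a * ((1-p)*((n:ℝ)-1) - (n+1)*(m+1)) := by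
        linear_combination (1-p) * id2
      rw [this]
      exact mul_neg_of_pos_of_neg a0 (by linarith)
    exact neg_of_mul_neg_right this hm1.le
  have cont : Continuous (fun η : ℝ => 2 * (((1-p)/2 + η) * (E0 + η) * (1 + 2 * η)) + (n-1)*a + 2*n*η
      - (a - n * η) * (2 * n *
        (1 - (η * (1 + 2 * (((1-p)/2 + η) * (E0 + η) * (1 + 2 * η))))^2 / E0^2))) := by
    fun_prop
  have e1 := cont.continuousAt.eventually_lt (x₀ := 0) continuousAt_const (g := fun _ => 0) (by
    simp only [add_zero, mul_zero, zero_mul, sub_zero]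
    norm_num; linarith)
  have e2 : ∀ᶠ η : ℝ in nhds 0, η < 1/4 := eventually_lt_nhds (by norm_num)
  have e3 : ∀ᶠ η : ℝ in nhds 0, η < E0 := eventually_lt_nhds E00
  have e4 : ∀ᶠ η : ℝ in nhds 0, n * η < a :=
    (continuous_const.mul continuous_id).continuousAt.eventually_lt continuousAt_const (by simpa using a0)
  have all := ((e1.and e2).and (e3.and e4)).filter_mono (nhdsWithin_le_nhds (s := Set.Ioi 0))
  obtain ⟨η, ⟨⟨h1, h2⟩, h3, h4⟩, h5⟩ := (all.and self_mem_nhdsWithin).exists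
  exact ⟨η, h5, h2, h3, h4, h1⟩

lemma matrix_close_comb {n : ℕ} {A B C : Matrix (Fin n) (Fin n) ℝ} {ε s : ℝ} (hs : s ∈ Set.Icc (0:ℝ) 1)
    (hA : ∀ i k, |A i k - C i k| < ε) (hB : ∀ i k, |B i k - C i k| < ε) :
    ∀ i k, |(A + s • (B - A)) i k - C i k| < ε := by
  intro i k
  simp only [Matrix.add_apply, Matrix.smul_apply, Matrix.sub_apply, smul_eq_mul]
  have h1 := abs_lt.1 (hA i k)
  have h2 := abs_lt.1 (hB i k)
  have := hs.1; have := hs.2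
  rcases hs.2.eq_or_lt with h | h
  · subst h; rw [abs_lt]; constructor <;> linarith
  · rw [abs_lt]; constructor
    · nlinarith [mul_pos (sub_pos.2 h) (neg_lt_iff_pos_add.1 h1.1), mul_nonneg hs.1 (neg_lt_iff_pos_add.1 h2.1).le]
    · nlinarith [mul_pos (sub_pos.2 h) (sub_pos.2 h1.2), mul_nonneg hs.1 (sub_pos.2 h2.2).le]

lemma exists_unif {n m : ℕ} (hm : m + 2 ≤ n - 1) (η : ℝ) (hη : 0 < η) :
    ∃ ε > 0, ∀ u : Euc n, ‖u‖ = 1 → ∀ A : Matrix (Fin n) (Fin n) ℝ,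
      (∀ i k, |A i k - H0 (u : Fin n → ℝ) i k| < ε) →
      |esym m A - (n-1).choose m| ≤ η ∧ |esym (m+1) A - (n-1).choose (m+1)| ≤ η ∧
      ∀ i k, |Sm (m+1) A i k - Sm (m+1) (H0 (u : Fin n → ℝ)) i k| ≤ η := by
  have : Nonempty (Fin n × Fin n) := ⟨(⟨0, by omega⟩, ⟨0, by omega⟩)⟩
  obtain ⟨e1, p1, h1⟩ := unif_close (n := n) (esym m) (continuous_esym m) η hη
  obtain ⟨e2, p2, h2⟩ := unif_close (n := n) (esym (m+1)) (continuous_esym (m+1)) η hη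
  have h3 : ∀ q : Fin n × Fin n, ∃ ε > 0, ∀ u : Euc n, ‖u‖ = 1 → ∀ A : Matrix (Fin n) (Fin n) ℝ,
      (∀ i k, |A i k - H0 (u : Fin n → ℝ) i k| < ε) →
      |Sm (m+1) A q.1 q.2 - Sm (m+1) (H0 (u : Fin n → ℝ)) q.1 q.2| < η := fun q =>
    unif_close (n := n) (fun A => Sm (m+1) A q.1 q.2) ((continuous_Sm (m+1)).matrix_elem q.1 q.2) η hη
  choose e3 p3 h3 using h3
  obtain ⟨q0, hq0⟩ := Finite.exists_min e3
  refine ⟨min e1 (min e2 (e3 q0)), lt_min p1 (lt_min p2 (p3 q0)), fun u hu A hA => ⟨?_, ?_, fun i k => ?_⟩⟩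
  · have := h1 u hu A fun i k => (hA i k).trans_le (min_le_left _ _)
    rw [esym_H0 (by omega) _ (dot_self_of_norm u hu)] at this
    exact this.le
  · have := h2 u hu A fun i k => (hA i k).trans_le ((min_le_right _ _).trans (min_le_left _ _))
    rw [esym_H0 (by omega) _ (dot_self_of_norm u hu)] at this
    exact this.le
  · exact (h3 (i, k) u hu A fun i' k' => (hA i' k').trans_le
      (((min_le_right _ _).trans (min_le_right _ _)).trans (hq0 (i,k)))).le

lemma Tp_contAt (p : ℝ) {s : ℝ} (hs : 0 < s) : ContinuousAt (Tp p) s := (Tp_deriv p hs).continuousAt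

lemma cont_sph {n : ℕ} {X : Type*} [TopologicalSpace X] {g : Euc n → X} (hg : ContinuousOn g {(0 : Euc n)}ᶜ) :
    Continuous (fun u : sphere (0 : Euc n) 1 => g u) :=
  continuousOn_iff_continuous_domRestrict.1 (hg.mono sph_sub)

set_option maxHeartbeats 1000000 in
lemma key {n m : ℕ} (hm : m + 2 ≤ n - 1) (p : ℝ) (hp1 : p < 1)
    (hp : (1-p)*((n:ℝ)-1) < (n+1)*(m+1)) :
    ∃ ε : ℝ, 0 < ε ∧ ε < 1/4 ∧ ∀ h f : Euc n → ℝ, SF h → SF f → Close h ε → Close f ε →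
      ∫ u : sphere (0 : Euc n) 1, h u * Tp p (f u / h u) * esym (m+1) (Hs h u) ∂(sgm n) = 0 →
      Wf (m+2) f ≤ Wf (m+2) h ∧ (Wf (m+2) f = Wf (m+2) h → ∀ u : Euc n, ‖u‖ = 1 → f u = h u) := by
  obtain ⟨η, η0, η4, ηE, ηa, ηΦ⟩ := exists_eta hm p hp
  obtain ⟨ε1, ε10, hε1⟩ := exists_unif hm η η0
  obtain ⟨r, r0, r1, hr⟩ := Tp_bounds p hp1 η η0
  refine ⟨min (min η (r/3)) ε1, by positivity, (min_le_left _ _).trans_lt ((min_le_left _ _).trans_lt η4), ?_⟩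
  intro h f H F ch cf h0
  set ε := min (min η (r/3)) ε1 with hε
  have εη : ε ≤ η := (min_le_left _ _).trans (min_le_left _ _)
  have εr : ε ≤ r/3 := (min_le_left _ _).trans (min_le_right _ _)
  have εε : ε ≤ ε1 := min_le_right _ _
  have hh : ∀ u : Euc n, ‖u‖ = 1 → 3/4 < h u := fun u hu => by linarith [(abs_lt.1 (ch u hu).1).1]
  have hf : ∀ u : Euc n, ‖u‖ = 1 → 3/4 < f u := fun u hu => by linarith [(abs_lt.1 (cf u hu).1).1]
  set ψ : Euc n → ℝ := fun x => f x - h x with hψ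
  have Ψ : SF ψ := F.sub H
  have hψb : ∀ u : Euc n, ‖u‖ = 1 → |ψ u| < 2 * ε := fun u hu => by
    have a := abs_lt.1 (ch u hu).1; have b := abs_lt.1 (cf u hu).1
    rw [abs_lt]; constructor <;> simp only [hψ] <;> linarith
  have cch := cont_sph H.c2.continuousOn
  have ccf := cont_sph F.c2.continuousOn
  have ccψ := cont_sph Ψ.c2.continuousOn
  have ccE : Continuous (fun u : sphere (0 : Euc n) 1 => esym (m+1) (Hs h u)) :=
    (continuous_esym (m+1)).comp (cont_sph H.hs_cont)
  have ccG : Continuous (fun u : sphere (0 : Euc n) 1 => Tp p (f u / h u)) := by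
    rw [continuous_iff_continuousAt]; intro u
    have a := hh u (sph_norm u); have b := hf u (sph_norm u)
    exact ContinuousAt.comp (g := Tp p) (f := fun u : sphere (0 : Euc n) 1 => f u / h u)
      (Tp_contAt p (by apply div_pos <;> linarith))
      (ccf.continuousAt.div cch.continuousAt (by linarith))
  have hx : ∀ u : Euc n, ‖u‖ = 1 → |ψ u / h u| < r := fun u hu => by
    have a := hh u hu
    rw [abs_div, abs_of_pos (a := h u) (by linarith), div_lt_iff₀ (by linarith)]
    nlinarith [hψb u hu]
  have hfx : ∀ u : Euc n, ‖u‖ = 1 → f u / h u = 1 + ψ u / h u := fun u hu => by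
    have a := hh u hu
    rw [hψ]; field_simp; ring
  obtain ⟨est1, est2⟩ := tp_est (n := n) cch ccψ ccE ccG η ((1-p)/2+η) ((n-1).choose (m+1) : ℝ) η0 η4
    (by linarith) ηE (fun u => ((ch u (sph_norm u)).1.trans_le εη).le)
    (fun u => by linarith [hψb u (sph_norm u)])
    (fun u => (hε1 u (sph_norm u) _ fun i k => ((ch u (sph_norm u)).2.2 i k).trans_le εε).2.1)
    (fun u => by rw [hfx u (sph_norm u)]; exact (hr _ (hx u (sph_norm u))).1)
    (fun u => by rw [hfx u (sph_norm u)]; exact (hr _ (hx u (sph_norm u))).2) h0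
  have n3 : 3 ≤ n := by omega
  have R := sgm_pos (n := n) (by omega)
  set μ := (∫ u : sphere (0 : Euc n) 1, ψ u ∂(sgm n)) / (sgm n).real Set.univ with hμ
  have hμ' : ∫ u : sphere (0 : Euc n) 1, ψ u ∂(sgm n) = μ * (sgm n).real Set.univ := by
    rw [hμ, div_mul_cancel₀ _ R.ne']
  have mean := mean_est (by omega) ccψ _ _ (by linarith : (0:ℝ) < ((n-1).choose (m+1) : ℝ))
    (by have : (0:ℝ) < ((n-1).choose (m+1) : ℝ) := by linarith
        have : 0 < 1 - p := by linarith
        positivity) est2 μ hμ'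
  have poin := poincare (by omega) Ψ μ hμ'
  set P := ∫ u : sphere (0 : Euc n) 1, ψ u^2 ∂(sgm n) with hP
  set T := ∫ u : sphere (0 : Euc n) 1, (‖gradient ψ u‖^2 - ψ u^2) ∂(sgm n) with hT
  have P0 : 0 ≤ P := integral_nonneg fun u => sq_nonneg _
  have hcomb : ∀ s : ℝ, ∀ u : Euc n, ‖u‖ = 1 →
      Hs (fun x => h x + s * ψ x) u = Hs h u + s • (Hs f u - Hs h u) := by
    intro s u hu
    have hu0 : u ≠ 0 := by intro h; simp [h] at hu
    have e1 : Hs (fun x => h x + s * ψ x) u = Hs h u + s • Hs ψ u := by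
      rw [H.hs_add (Ψ.smul s) hu0, Ψ.hs_smul s hu0]
    have e2 : Hs (fun x => h x + ψ x) u = Hs h u + Hs ψ u := H.hs_add Ψ hu0
    have e3 : (fun x => h x + ψ x) = f := by ext x; simp [hψ]
    rw [e3] at e2
    rw [e1, e2, add_sub_cancel_left]
  have tay := W_taylor hm H Ψ (-((n-2).choose m : ℝ) * T + ((n:ℝ)-1) * ((n-2).choose m : ℝ) * P
      + n * η * (T + 2 * P)) (fun s hs => by
    have cl : ∀ u : Euc n, ‖u‖ = 1 → ∀ i k,
        |Hs (fun x => h x + s * ψ x) u i k - H0 (u : Fin n → ℝ) i k| < ε1 := fun u hu => by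
      rw [hcomb s u hu]
      exact matrix_close_comb hs (fun i k => ((ch u hu).2.2 i k).trans_le εε)
        (fun i k => ((cf u hu).2.2 i k).trans_le εε)
    exact second_bound hm (H.add (Ψ.smul s)) Ψ η η0.le (fun u hu => (hε1 u hu _ (cl u hu)).1)
      (fun u hu => (hε1 u hu _ (cl u hu)).2.2))
  have e3 : (fun x => h x + ψ x) = f := by ext x; simp [hψ]
  rw [e3] at tay
  set a := ((n-2).choose m : ℝ) with ha
  set I := ∫ u : sphere (0 : Euc n) 1, ψ u * esym (m+1) (Hs h u) ∂(sgm n) with hI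
  have hnm : (0:ℝ) < (n:ℝ) - (m+2) := by
    have : m + 2 < n := by omega
    have : ((m+2:ℕ):ℝ) < n := by exact_mod_cast this
    push_cast at this; linarith
  have main : ∃ Φ : ℝ, Φ < 0 ∧ Wf (m+2) f ≤ Wf (m+2) h + ((n:ℝ) - (m+2)) * (Φ * P / 2) := by
    refine ⟨_, ηΦ, tay.trans ?_⟩
    gcongr
    have T1 := mul_le_mul_of_nonneg_left (mul_le_mul_of_nonneg_left mean (by positivity : (0:ℝ) ≤ 2 * n) |>.trans poin)
      (by linarith : 0 ≤ a - n * η)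
    linarith
  obtain ⟨Φ, Φ0, main⟩ := main
  have hz : ((n:ℝ) - (m+2)) * (Φ * P / 2) ≤ 0 := by
    have : Φ * P ≤ 0 := mul_nonpos_of_nonpos_of_nonneg Φ0.le P0
    nlinarith
  refine ⟨by linarith, fun heq u hu => ?_⟩
  have Pz : P = 0 := by
    by_contra hne
    have : 0 < P := lt_of_le_of_ne P0 (Ne.symm hne)
    have : Φ * P < 0 := mul_neg_of_neg_of_pos Φ0 this
    have : ((n:ℝ) - (m+2)) * (Φ * P / 2) < 0 := mul_neg_of_pos_of_neg hnm (by linarith)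
    linarith
  rw [hP, integral_eq_zero_iff_of_nonneg (fun u => sq_nonneg _) (cint (ccψ.pow 2))] at Pz
  have := Continuous.ae_eq_iff_eq (μ := sgm n) (ccψ.pow 2) continuous_const |>.1 Pz
  have t : (f u - h u)^2 = 0 := congrFun this ⟨u, by simpa using hu⟩
  exact sub_eq_zero.1 (pow_eq_zero_iff (two_ne_zero) |>.1 t)

lemma Wf_smul {n : ℕ} {f : Euc n → ℝ} (F : SF f) (c : ℝ) (k : ℕ) :
    Wf k (fun x => c * f x) = c^k * Wf k f := by
  unfold Wf
  rw [← integral_const_mul]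
  refine integral_congr_ae (Filter.Eventually.of_forall fun u => ?_)
  simp only []
  rw [F.hs_smul c (sph_ne u), esym_smul]

lemma H0_le {n : ℕ} (u : Euc n) (hu : ‖u‖ = 1) (i k : Fin n) : |H0 (u : Fin n → ℝ) i k| ≤ 2 := by
  have h1 : |u.ofLp i| ≤ 1 := by rw [← hu]; exact PiLp.norm_apply_le u i
  have h2 : |u.ofLp k| ≤ 1 := by rw [← hu]; exact PiLp.norm_apply_le u k
  simp only [H0, Matrix.sub_apply, vecMulVec_apply]
  have h3 : |(1 : Matrix (Fin n) (Fin n) ℝ) i k| ≤ 1 := by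
    rw [Matrix.one_apply]; split_ifs <;> simp
  have h4 : |u.ofLp i * u.ofLp k| ≤ 1 := by
    rw [abs_mul]; exact mul_le_one₀ h1 (abs_nonneg _) h2
  have a1 := abs_le.1 h3
  have a2 := abs_le.1 h4
  exact abs_le.2 ⟨by linarith, by linarith⟩

lemma Close.scale {n : ℕ} {f : Euc n → ℝ} {δ σ ε : ℝ} (F : SF f) (c : Close f δ) (hδ : δ < 1/4)
    (hσ : |σ - 1| ≤ 3 * δ) (hε : 28 * δ ≤ ε) : Close (fun x => σ⁻¹ * f x) ε := by
  intro u hu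
  obtain ⟨c1, c2, c3⟩ := c u hu
  have hu0 : u ≠ 0 := by intro h; simp [h] at hu
  have hs := abs_le.1 hσ
  have s4 : 1/4 < σ := by linarith
  have s0 : 0 < σ := by linarith
  have δ0 : 0 < δ := (abs_nonneg _).trans_lt c1
  have fin : ∀ x : ℝ, x < 7 * δ → σ⁻¹ * x < ε := fun x hx => by
    rw [inv_mul_lt_iff₀ s0]; nlinarith
  refine ⟨?_, ?_, fun i k => ?_⟩
  · have : σ⁻¹ * f u - 1 = σ⁻¹ * ((f u - 1) + (1 - σ)) := by field_simp; ring
    rw [this, abs_mul, abs_of_pos (inv_pos.2 s0)]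
    apply fin
    refine (abs_add_le _ _).trans_lt ?_
    rw [abs_sub_comm 1 σ]; linarith
  · have : gradient (fun x => σ⁻¹ * f x) u = σ⁻¹ • gradient f u := grad_smul _ (F.diff hu0)
    rw [this, show σ⁻¹ • gradient f u - u = σ⁻¹ • ((gradient f u - u) + (1 - σ) • u) by
      rw [smul_add, smul_sub, smul_smul, mul_sub, sub_smul, inv_mul_cancel₀ s0.ne']; simp, norm_smul,
      Real.norm_of_nonneg (inv_pos.2 s0).le]
    apply fin
    refine (norm_add_le _ _).trans_lt ?_
    rw [norm_smul, hu, Real.norm_eq_abs, abs_sub_comm 1 σ]; linarith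
  · rw [F.hs_smul _ hu0, Matrix.smul_apply, smul_eq_mul]
    have : σ⁻¹ * Hs f u i k - H0 u.ofLp i k = σ⁻¹ * ((Hs f u i k - H0 u.ofLp i k) + (1-σ) * H0 u.ofLp i k) := by
      field_simp; ring
    rw [this, abs_mul, abs_of_pos (inv_pos.2 s0)]
    apply fin
    refine (abs_add_le _ _).trans_lt ?_
    rw [abs_mul, abs_sub_comm 1 σ]
    have := H0_le u hu i k
    have := c3 i k
    have := mul_le_mul hσ (H0_le u hu i k) (abs_nonneg _) (by linarith)
    linarith

lemma Close.mono {n : ℕ} {f : Euc n → ℝ} {δ ε : ℝ} (c : Close f δ) (h : δ ≤ ε) : Close f ε := fun u hu =>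
  ⟨(c u hu).1.trans_le h, (c u hu).2.1.trans_le h, fun i k => ((c u hu).2.2 i k).trans_le h⟩

lemma esym_pos {n k : ℕ} (hk : k ≤ n - 1) (hn : 1 ≤ n) : ∃ ε > 0, ∀ h : Euc n → ℝ, Close h ε →
    ∀ u : Euc n, ‖u‖ = 1 → 0 < esym k (Hs h u) := by
  have E0 : 0 < ((n-1).choose k : ℝ) := by exact_mod_cast Nat.choose_pos hk
  obtain ⟨e1, p1, h1⟩ := unif_close (n := n) (esym k) (continuous_esym k) _ E0
  refine ⟨e1, p1, fun h c u hu => ?_⟩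
  have := h1 u hu _ (c u hu).2.2
  rw [esym_H0 (by omega) _ (dot_self_of_norm u hu)] at this
  linarith [(abs_lt.1 this).1]

lemma int_pos {n : ℕ} (hn : 1 ≤ n) {g : sphere (0 : Euc n) 1 → ℝ} (hg : Continuous g) (h : ∀ u, 0 < g u) :
    0 < ∫ u, g u ∂(sgm n) := by
  rw [integral_pos_iff_support_of_nonneg (fun u => (h u).le) (cint hg)]
  have : Function.support g = Set.univ := by ext u; simp [(h u).ne']
  rw [this]
  by_contra h0
  have := sgm_pos hn
  simp only [not_lt, nonpos_iff_eq_zero] at h0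
  simp [Measure.real, h0] at this

lemma W_pos {n k : ℕ} (hk : k ≤ n - 1) (hn : 1 ≤ n) : ∃ ε > 0, ∀ h : Euc n → ℝ, SF h → Close h ε →
    0 < Wf k h := by
  obtain ⟨e, e0, he⟩ := esym_pos hk hn
  exact ⟨e, e0, fun h H c => int_pos hn ((continuous_esym k).comp (cont_sph H.hs_cont))
    fun u => he h c u (sph_norm u)⟩

set_option maxHeartbeats 1000000 in
lemma key_scaled {n m : ℕ} (hm : m + 2 ≤ n - 1) (p : ℝ) (hp1 : p < 1)
    (hp : (1-p)*((n:ℝ)-1) < (n+1)*(m+1)) :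
    ∃ δ : ℝ, 0 < δ ∧ δ < 1/4 ∧ ∀ h f : Euc n → ℝ, SF h → SF f → Close h δ → Close f δ →
      0 < ∫ u : sphere (0 : Euc n) 1, h u * esym (m+1) (Hs h u) ∂(sgm n) ∧
      ∃ σ : ℝ, 0 < σ ∧ Tp p σ * ∫ u : sphere (0 : Euc n) 1, h u * esym (m+1) (Hs h u) ∂(sgm n) =
        ∫ u : sphere (0 : Euc n) 1, h u * Tp p (f u / h u) * esym (m+1) (Hs h u) ∂(sgm n) ∧
      Wf (m+2) f ≤ σ^(m+2) * Wf (m+2) h ∧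
      (Wf (m+2) f = σ^(m+2) * Wf (m+2) h → ∀ u : Euc n, ‖u‖ = 1 → f u = σ * h u) := by
  obtain ⟨ε, ε0, ε4, K⟩ := key hm p hp1 hp
  obtain ⟨ε1, ε10, K1⟩ := esym_pos (n := n) (k := m+1) (by omega) (by omega)
  refine ⟨min (ε/28) ε1, by positivity, (min_le_left _ _).trans_lt (by linarith), ?_⟩
  intro h f H F ch cf
  set δ := min (ε/28) ε1
  have δ1 : 28 * δ ≤ ε := by linarith [min_le_left (ε/28) ε1]
  have δ2 : δ ≤ ε1 := min_le_right _ _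
  have δ0 : 0 < δ := by positivity
  have hh : ∀ u : Euc n, ‖u‖ = 1 → 0 < h u := fun u hu => by linarith [(abs_lt.1 (ch u hu).1).1]
  have hf : ∀ u : Euc n, ‖u‖ = 1 → 0 < f u := fun u hu => by linarith [(abs_lt.1 (cf u hu).1).1]
  have hE : ∀ u : Euc n, ‖u‖ = 1 → 0 < esym (m+1) (Hs h u) := K1 h (ch.mono δ2)
  have cch := cont_sph H.c2.continuousOn
  have ccf := cont_sph F.c2.continuousOn
  have ccE : Continuous (fun u : sphere (0 : Euc n) 1 => esym (m+1) (Hs h u)) :=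
    (continuous_esym (m+1)).comp (cont_sph H.hs_cont)
  have ccG : Continuous (fun u : sphere (0 : Euc n) 1 => Tp p (f u / h u)) := by
    rw [continuous_iff_continuousAt]; intro u
    have a := hh u (sph_norm u); have b := hf u (sph_norm u)
    exact ContinuousAt.comp (g := Tp p) (f := fun u : sphere (0 : Euc n) 1 => f u / h u)
      (Tp_contAt p (div_pos b a))
      (ccf.continuousAt.div cch.continuousAt a.ne')
  have i1 : Integrable (fun u : sphere (0 : Euc n) 1 => h u * esym (m+1) (Hs h u)) (sgm n) := cint (cch.mul ccE)
  have i2 : Integrable (fun u : sphere (0 : Euc n) 1 => h u * Tp p (f u / h u) * esym (m+1) (Hs h u)) (sgm n) :=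
    cint ((cch.mul ccG).mul ccE)
  have Apos : 0 < ∫ u : sphere (0 : Euc n) 1, h u * esym (m+1) (Hs h u) ∂(sgm n) :=
    int_pos (by omega) (cch.mul ccE) fun u => mul_pos (hh u (sph_norm u)) (hE u (sph_norm u))
  refine ⟨Apos, ?_⟩
  set A := ∫ u : sphere (0 : Euc n) 1, h u * esym (m+1) (Hs h u) ∂(sgm n) with hA
  set I := ∫ u : sphere (0 : Euc n) 1, h u * Tp p (f u / h u) * esym (m+1) (Hs h u) ∂(sgm n) with hI
  have mono := (Tp_strict p).monotoneOn
  have low : Tp p (1 - 3*δ) * A ≤ I := by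
    rw [hA, ← integral_const_mul]
    refine integral_mono (i1.const_mul _) i2 fun u => ?_
    have hu := sph_norm u
    have a := hh u hu; have b := hf u hu; have c := hE u hu
    have t : Tp p (1 - 3*δ) ≤ Tp p (f u / h u) := mono (by simp; linarith) (div_pos b a) (by
      rw [le_div_iff₀ a]
      have c1 := abs_lt.1 (ch u hu).1; have c2 := abs_lt.1 (cf u hu).1
      nlinarith)
    have := mul_le_mul_of_nonneg_right t (mul_pos a c).le
    simp only []
    linarith
  have up : I ≤ Tp p (1 + 3*δ) * A := by
    rw [hA, ← integral_const_mul]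
    refine integral_mono i2 (i1.const_mul _) fun u => ?_
    have hu := sph_norm u
    have a := hh u hu; have b := hf u hu; have c := hE u hu
    have t : Tp p (f u / h u) ≤ Tp p (1 + 3*δ) := mono (div_pos b a) (by simp; linarith) (by
      rw [div_le_iff₀ a]
      have c1 := abs_lt.1 (ch u hu).1; have c2 := abs_lt.1 (cf u hu).1
      nlinarith)
    have := mul_le_mul_of_nonneg_right t (mul_pos a c).le
    simp only []
    linarith
  have ivt := intermediate_value_Icc (f := Tp p) (by linarith : 1 - 3*δ ≤ 1 + 3*δ)
    (fun s hs => (Tp_contAt p (by linarith [hs.1])).continuousWithinAt)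
  obtain ⟨σ, hσ, hσI⟩ := ivt (show I / A ∈ _ from ⟨by rw [le_div_iff₀ Apos]; exact low, by rw [div_le_iff₀ Apos]; exact up⟩)
  have σ0 : 0 < σ := by linarith [hσ.1]
  have hTI : Tp p σ * A = I := by rw [hσI, div_mul_cancel₀ _ Apos.ne']
  refine ⟨σ, σ0, hTI, ?_⟩
  have cf' : Close (fun x => σ⁻¹ * f x) ε := cf.scale F (by linarith)
    (abs_le.2 ⟨by linarith [hσ.1], by linarith [hσ.2]⟩) δ1
  have := K h (fun x => σ⁻¹ * f x) H (F.smul _) (ch.mono (by linarith)) cf' (by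
    have e : ∀ u : sphere (0 : Euc n) 1, h u * Tp p (σ⁻¹ * f u / h u) * esym (m+1) (Hs h u) =
        σ^(-p) * (h u * Tp p (f u / h u) * esym (m+1) (Hs h u)) - σ^(-p) * Tp p σ * (h u * esym (m+1) (Hs h u)) := by
      intro u
      have a := hh u (sph_norm u); have b := hf u (sph_norm u)
      rw [show σ⁻¹ * f u / h u = (f u / h u) / σ by field_simp, Tp_div p (div_pos b a) σ0]
      ring
    simp only [e]
    rw [integral_sub (i2.const_mul _) (i1.const_mul _), integral_const_mul, integral_const_mul, ← hA, ← hI, ← hTI]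
    ring)
  rw [Wf_smul F] at this
  have sp : 0 < σ^(m+2) := by positivity
  refine ⟨?_, fun heq u hu => ?_⟩
  · have := this.1
    rwa [inv_pow, inv_mul_le_iff₀ sp] at this
  · have := this.2 (by rw [heq, inv_pow, inv_mul_cancel_left₀ sp.ne']) u hu
    rw [← this]; field_simp

lemma SF_norm {n : ℕ} : SF (fun x : Euc n => ‖x‖) :=
  ⟨fun x hx => (contDiffAt_norm ℝ hx).contDiffWithinAt, fun c hc x => by
    rw [norm_smul, Real.norm_of_nonneg hc.le], fun x => norm_neg x⟩

lemma grad_norm {n : ℕ} {x : Euc n} (hx : x ≠ 0) : gradient (fun y : Euc n => ‖y‖) x = ‖x‖⁻¹ • x := by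
  have := grad_radial (χ := fun t => t) hx differentiableAt_fun_id
  simpa using this

lemma Hs_norm {n : ℕ} {u : Euc n} (hu : ‖u‖ = 1) : Hs (fun y : Euc n => ‖y‖) u = H0 (u : Fin n → ℝ) := by
  have hu0 : u ≠ 0 := by intro h; simp [h] at hu
  have hd : DifferentiableAt ℝ (fun y : Euc n => ‖y‖⁻¹) u :=
    (SF_norm.diff hu0).fun_inv (by rw [hu]; norm_num)
  have e : gradient (fun y : Euc n => ‖y‖) =ᶠ[nhds u] fun y => ‖y‖⁻¹ • y := by
    filter_upwards [isOpen_compl_singleton.mem_nhds hu0] with y hy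
    exact grad_norm hy
  have : Hs (fun y : Euc n => ‖y‖) u = Jac (fun y : Euc n => ‖y‖⁻¹ • y) u := by
    rw [Hs, Jac, e.fderiv_eq]; rfl
  rw [this, jac_smul (V := fun y => y) hd differentiableAt_fun_id]
  have g := grad_radial (χ := fun t => t⁻¹) hu0 (by
    rw [hu]; exact differentiableAt_inv one_ne_zero)
  rw [g, hu, deriv_inv]
  have j : Jac (fun y : Euc n => y) u = 1 := by
    rw [Jac, fderiv_fun_id, matOf_id]
  rw [j, H0]
  ext i k
  simp [vecMulVec_apply]; ring

lemma hess_eq {n : ℕ} {h : Euc n → ℝ} (H : SF h) {u : Euc n} (hu : u ≠ 0) (i k : Fin n) :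
    hessMat h u i k = Hs h u k i := by
  simp only [hessMat, Hs, Jac, matOf, Matrix.of_apply]
  have e : (fun x => fderiv ℝ h x (EuclideanSpace.single k 1)) =
      (EuclideanSpace.proj k : Euc n →L[ℝ] ℝ) ∘ gradient h := by
    ext x; simp [← grad_apply]
  rw [e, ((EuclideanSpace.proj k : Euc n →L[ℝ] ℝ).hasFDerivAt.comp u (H.gdiff hu).hasFDerivAt).fderiv]
  rfl

lemma Close_of_C2 {n : ℕ} {K : Set (Euc n)} {δ : ℝ} (S : SF (suppFn K)) (c : C2Close n K δ) :
    Close (suppFn K) δ := by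
  intro u hu
  obtain ⟨c1, c2, c3⟩ := c u hu
  have hu0 : u ≠ 0 := by intro h; simp [h] at hu
  refine ⟨c1, ?_, fun i k => ?_⟩
  · have g : gradient (fun x => suppFn K x - ‖x‖) u = gradient (suppFn K) u - u := by
      have := grad_norm hu0
      rw [hu, inv_one, one_smul] at this
      simp only [gradient] at this ⊢
      rw [fderiv_fun_sub (S.diff hu0) (SF_norm.diff hu0), map_sub, this]
    rw [← g]
    simp only [gradient, LinearIsometryEquiv.norm_map]
    exact c2
  · have := c3 k i
    rw [hess_eq S hu0, hess_eq SF_norm hu0, Hs_norm hu] at this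
    exact this

lemma combP_pos {p l a b : ℝ} (hl : l ∈ Set.Ioo (0:ℝ) 1) (ha : 0 < a) (hb : 0 < b) : 0 < combP p l a b := by
  unfold combP
  have := hl.1; have : 0 < 1 - l := by linarith [hl.2]
  split_ifs <;> positivity

lemma combP_Tp {p l a b : ℝ} (hl : l ∈ Set.Ioo (0:ℝ) 1) (ha : 0 < a) (hb : 0 < b) :
    Tp p (combP p l a b) = (1-l) * Tp p a + l * Tp p b := by
  have := hl.1; have : 0 < 1 - l := by linarith [hl.2]
  unfold Tp combP
  by_cases hp : p = 0
  · simp only [hp, if_true]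
    rw [Real.log_mul (by positivity) (by positivity), Real.log_rpow ha, Real.log_rpow hb]
  · simp only [hp, if_false]
    rw [← Real.rpow_mul (by positivity), one_div_mul_cancel hp, Real.rpow_one]
    field_simp; ring

lemma Tp_le_iff {p x y : ℝ} (hx : 0 < x) (hy : 0 < y) : Tp p x ≤ Tp p y ↔ x ≤ y :=
  (Tp_strict p).le_iff_le hx hy

lemma Tp_inj {p x y : ℝ} (hx : 0 < x) (hy : 0 < y) (h : Tp p x = Tp p y) : x = y :=
  (Tp_strict p).injOn hx hy h

lemma combP_le {p l a b r : ℝ} (hl : l ∈ Set.Ioo (0:ℝ) 1) (ha : 0 < a) (hb : 0 < b) (har : a ≤ r) (hbr : b ≤ r) :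
    combP p l a b ≤ r := by
  rw [← Tp_le_iff (p := p) (combP_pos hl ha hb) (ha.trans_le har), combP_Tp hl ha hb]
  have h1 := (Tp_le_iff (p := p) ha (ha.trans_le har)).2 har
  have h2 := (Tp_le_iff (p := p) hb (ha.trans_le har)).2 hbr
  nlinarith [hl.1, hl.2]

lemma le_combP {p l a b r : ℝ} (hl : l ∈ Set.Ioo (0:ℝ) 1) (hr : 0 < r) (har : r ≤ a) (hbr : r ≤ b) :
    r ≤ combP p l a b := by
  have ha : 0 < a := hr.trans_le har
  have hb : 0 < b := hr.trans_le hbr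
  rw [← Tp_le_iff (p := p) hr (combP_pos hl ha hb), combP_Tp hl ha hb]
  have h1 := (Tp_le_iff (p := p) hr ha).2 har
  have h2 := (Tp_le_iff (p := p) hr hb).2 hbr
  nlinarith [hl.1, hl.2]

lemma combP_div {p l a b σ : ℝ} (hl : l ∈ Set.Ioo (0:ℝ) 1) (ha : 0 < a) (hb : 0 < b) (hσ : 0 < σ) :
    combP p l (a/σ) (b/σ) = combP p l a b / σ := by
  have h1 := combP_pos (p := p) hl ha hb
  apply Tp_inj (p := p) (combP_pos hl (div_pos ha hσ) (div_pos hb hσ)) (div_pos h1 hσ)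
  rw [combP_Tp hl (div_pos ha hσ) (div_pos hb hσ), Tp_div p ha hσ, Tp_div p hb hσ, Tp_div p h1 hσ, combP_Tp hl ha hb]
  ring

lemma combP_mul {p l a b c : ℝ} (hl : l ∈ Set.Ioo (0:ℝ) 1) (ha : 0 < a) (hb : 0 < b) (hc : 0 < c) :
    combP p l (c*a) (c*b) = c * combP p l a b := by
  have := combP_div (p := p) hl ha hb (inv_pos.2 hc)
  simpa only [div_inv_eq_mul, mul_comm _ c] using this

lemma combP_zero {p l : ℝ} (hl : l ∈ Set.Ioo (0:ℝ) 1) : combP p l 0 0 = 0 := by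
  unfold combP
  split_ifs with hp
  · rw [Real.zero_rpow hl.1.ne', mul_zero]
  · rw [Real.zero_rpow hp, mul_zero, mul_zero, add_zero, Real.zero_rpow (by simpa using hp)]

lemma SF.zero {n : ℕ} {h : Euc n → ℝ} (H : SF h) : h 0 = 0 := by
  have := H.hom 2 (by norm_num) 0
  rw [smul_zero] at this; linarith

lemma SF_comb {n : ℕ} {a b : Euc n → ℝ} (A : SF a) (B : SF b) (ha : ∀ x, x ≠ 0 → 0 < a x)
    (hb : ∀ x, x ≠ 0 → 0 < b x) (p l : ℝ) (hl : l ∈ Set.Ioo (0:ℝ) 1) : SF (fun x => combP p l (a x) (b x)) := by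
  refine ⟨?_, fun c hc x => ?_, fun x => by rw [A.even, B.even]⟩
  · have l0 := hl.1
    have l1 : 0 < 1 - l := by linarith [hl.2]
    intro x hx
    have ax := ha x hx; have bx := hb x hx
    unfold combP
    split_ifs with hp
    · exact ((A.c2 x hx).rpow_const_of_ne ax.ne').mul ((B.c2 x hx).rpow_const_of_ne bx.ne')
    · exact ((contDiffWithinAt_const.mul ((A.c2 x hx).rpow_const_of_ne ax.ne')).add
        (contDiffWithinAt_const.mul ((B.c2 x hx).rpow_const_of_ne bx.ne'))).rpow_const_of_ne (by positivity)
  · by_cases hx : x = 0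
    · subst hx; simp only [smul_zero, A.zero, B.zero, combP_zero hl, mul_zero]
    · rw [A.hom c hc, B.hom c hc, combP_mul hl (ha x hx) (hb x hx) hc]

/-- the weights -/
def wt (p l : ℝ) (s t : ℝ) : ℝ := l * (s / t)^(p-1)

lemma grad_Tp {n : ℕ} {h : Euc n → ℝ} (p : ℝ) {x : Euc n} (H : DifferentiableAt ℝ h x) (hx : 0 < h x) :
    HasGradientAt (fun y => Tp p (h y)) ((h x)^(p-1) • gradient h x) x := by
  rw [hasGradientAt_iff_hasFDerivAt]
  have := (Tp_deriv p hx).comp_hasFDerivAt x H.hasGradientAt.hasFDerivAt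
  simp only [map_smul]
  exact this

lemma grad_comb {n : ℕ} {a b : Euc n → ℝ} (A : SF a) (B : SF b) (ha : ∀ x, x ≠ 0 → 0 < a x)
    (hb : ∀ x, x ≠ 0 → 0 < b x) (p l : ℝ) (hl : l ∈ Set.Ioo (0:ℝ) 1) {x : Euc n} (hx : x ≠ 0) :
    gradient (fun x => combP p l (a x) (b x)) x =
      wt p (1-l) (a x) (combP p l (a x) (b x)) • gradient a x + wt p l (b x) (combP p l (a x) (b x)) • gradient b x := by
  have H := SF_comb A B ha hb p l hl
  have hp := combP_pos (p := p) hl (ha x hx) (hb x hx)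
  have h1 := grad_Tp p (H.diff hx) hp
  have h2 : HasGradientAt (fun y => (1-l) * Tp p (a y) + l * Tp p (b y))
      ((1-l) • ((a x)^(p-1) • gradient a x) + l • ((b x)^(p-1) • gradient b x)) x := by
    have g1 := (grad_Tp p (A.diff hx) (ha x hx)).hasFDerivAt.const_smul (1-l)
    have g2 := (grad_Tp p (B.diff hx) (hb x hx)).hasFDerivAt.const_smul l
    rw [hasGradientAt_iff_hasFDerivAt]
    have := g1.add g2
    rw [← map_smul, ← map_smul, ← map_add] at this
    exact this
  have e : (fun y => Tp p (combP p l (a y) (b y))) =ᶠ[nhds x] fun y => (1-l) * Tp p (a y) + l * Tp p (b y) := by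
    filter_upwards [isOpen_compl_singleton.mem_nhds hx] with y hy
    exact combP_Tp hl (ha y hy) (hb y hy)
  have h3 := h1.unique (h2.congr_of_eventuallyEq e)
  set c := combP p l (a x) (b x) with hc
  have hcp : 0 < c^(p-1) := by positivity
  have h4 : gradient (fun x => combP p l (a x) (b x)) x = (c^(p-1))⁻¹ • ((1-l) • ((a x)^(p-1) • gradient a x) + l • ((b x)^(p-1) • gradient b x)) := by
    rw [← h3, smul_smul, inv_mul_cancel₀ hcp.ne', one_smul]
  rw [h4, wt, wt, Real.div_rpow (ha x hx).le hp.le, Real.div_rpow (hb x hx).le hp.le, smul_add]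
  simp only [smul_smul]
  congr 2 <;> field_simp

lemma grad_wt {n : ℕ} {a h : Euc n → ℝ} (p l : ℝ) {x : Euc n} (A : DifferentiableAt ℝ a x) (H : DifferentiableAt ℝ h x)
    (ha : 0 < a x) (hh : 0 < h x) :
    DifferentiableAt ℝ (fun y => wt p l (a y) (h y)) x ∧
    gradient (fun y => wt p l (a y) (h y)) x =
      ((1-p) * wt p l (a x) (h x)) • ((h x)⁻¹ • gradient h x - (a x)⁻¹ • gradient a x) := by
  have d1 : HasFDerivAt (fun y => a y / h y) ((h x)⁻¹ • fderiv ℝ a x - (a x / (h x)^2) • fderiv ℝ h x) x := by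
    have := A.hasFDerivAt.fun_mul ((hasDerivAt_inv hh.ne').comp_hasFDerivAt x H.hasFDerivAt)
    refine this.congr_fderiv ?_
    ext v; simp; field_simp; ring
  have d2 := (d1.rpow_const (p := p-1) (Or.inl (by positivity))).const_smul l
  have : HasFDerivAt (fun y => wt p l (a y) (h y)) _ x := d2
  refine ⟨this.differentiableAt, ?_⟩
  rw [gradient, this.fderiv]
  simp only [map_smul, map_sub]
  change l • (((p-1) * (a x / h x)^(p-1-1)) • ((h x)⁻¹ • gradient a x - (a x / h x ^ 2) • gradient h x)) = _
  have e : (a x / h x)^(p-1-1) = (a x / h x)^(p-1) * (h x / a x) := by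
    rw [Real.rpow_sub_one (by positivity)]; field_simp
  rw [e, wt]
  generalize (a x / h x)^(p-1) = q
  ext i
  simp only [PiLp.smul_apply, PiLp.sub_apply, smul_eq_mul]
  field_simp; ring

lemma SF.eq_norm_mul {n : ℕ} {h : Euc n → ℝ} (H : SF h) {x : Euc n} (hx : x ≠ 0) : h x = ‖x‖ * h (‖x‖⁻¹ • x) := by
  have h0 : 0 < ‖x‖ := norm_pos_iff.2 hx
  rw [← H.hom _ h0, smul_smul, mul_inv_cancel₀ h0.ne', one_smul]

lemma norm_unit {n : ℕ} {x : Euc n} (hx : x ≠ 0) : ‖‖x‖⁻¹ • x‖ = 1 := by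
  have h0 : 0 < ‖x‖ := norm_pos_iff.2 hx
  rw [norm_smul, norm_inv, norm_norm, inv_mul_cancel₀ h0.ne']

lemma SF.pos_of_close {n : ℕ} {h : Euc n → ℝ} (H : SF h) {δ : ℝ} (c : Close h δ) (hδ : δ ≤ 1) (x : Euc n) (hx : x ≠ 0) :
    0 < h x := by
  rw [H.eq_norm_mul hx]
  have := abs_lt.1 (c _ (norm_unit hx)).1
  exact mul_pos (norm_pos_iff.2 hx) (by linarith)

lemma Hs_comb {n : ℕ} {a b : Euc n → ℝ} (A : SF a) (B : SF b) (ha : ∀ x, x ≠ 0 → 0 < a x)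
    (hb : ∀ x, x ≠ 0 → 0 < b x) (p l : ℝ) (hl : l ∈ Set.Ioo (0:ℝ) 1) {x : Euc n} (hx : x ≠ 0)
    (h : Euc n → ℝ) (hh : h = fun x => combP p l (a x) (b x)) (i k : Fin n) :
    Hs h x i k = wt p (1-l) (a x) (h x) * Hs a x i k + wt p l (b x) (h x) * Hs b x i k
      + gradient a x i * (((1-p) * wt p (1-l) (a x) (h x)) * ((h x)⁻¹ * gradient h x k - (a x)⁻¹ * gradient a x k))
      + gradient b x i * (((1-p) * wt p l (b x) (h x)) * ((h x)⁻¹ * gradient h x k - (b x)⁻¹ * gradient b x k)) := by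
  have H : SF h := by rw [hh]; exact SF_comb A B ha hb p l hl
  have hp : 0 < h x := by rw [hh]; exact combP_pos hl (ha x hx) (hb x hx)
  have e : gradient h =ᶠ[nhds x] fun y => wt p (1-l) (a y) (h y) • gradient a y + wt p l (b y) (h y) • gradient b y := by
    filter_upwards [isOpen_compl_singleton.mem_nhds hx] with y hy
    rw [hh]; exact grad_comb A B ha hb p l hl hy
  obtain ⟨da, ga⟩ := grad_wt p (1-l) (A.diff hx) (H.diff hx) (ha x hx) hp
  obtain ⟨db, gb⟩ := grad_wt p l (B.diff hx) (H.diff hx) (hb x hx) hp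
  have : Hs h x = Jac (fun y => wt p (1-l) (a y) (h y) • gradient a y) x + Jac (fun y => wt p l (b y) (h y) • gradient b y) x := by
    rw [Hs, Jac, e.fderiv_eq, fderiv_fun_add (da.fun_smul (A.gdiff hx)) (db.fun_smul (B.gdiff hx)), matOf_add]; rfl
  rw [this, jac_smul da (A.gdiff hx), jac_smul db (B.gdiff hx), ga, gb]
  simp only [Matrix.add_apply, Matrix.smul_apply, vecMulVec_apply, PiLp.smul_apply, PiLp.sub_apply, smul_eq_mul, Hs]
  ring

lemma ratio_close {n : ℕ} {g u : Euc n} {t e1 e2 : ℝ} (hu : ‖u‖ = 1) (hg : ‖g - u‖ ≤ e1) (ht : |t - 1| ≤ e2) (ht2 : 1/2 ≤ t) :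
    ‖t⁻¹ • g - u‖ ≤ 2 * (e1 + e2) := by
  have t0 : 0 < t := by linarith
  have : t⁻¹ • g - u = t⁻¹ • ((g - u) + (1 - t) • u) := by
    rw [smul_add, smul_sub, smul_smul, mul_sub, sub_smul, inv_mul_cancel₀ t0.ne']; simp
  rw [this, norm_smul, norm_inv, Real.norm_of_nonneg t0.le]
  have h1 : t⁻¹ ≤ 2 := by rw [inv_le_comm₀ t0 (by norm_num)]; linarith
  have h2 : ‖(g - u) + (1 - t) • u‖ ≤ e1 + e2 := by
    refine (norm_add_le _ _).trans ?_
    rw [norm_smul, hu, Real.norm_eq_abs, abs_sub_comm, mul_one]; linarith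
  exact mul_le_mul h1 h2 (norm_nonneg _) (by norm_num)

set_option maxHeartbeats 1000000 in
lemma Close_comb_aux {n : ℕ} (p : ℝ) (hp1 : p < 1) (ω : ℝ) (hω : 0 < ω) (hω4 : ω < 1/8) :
    ∃ δ : ℝ, 0 < δ ∧ δ ≤ ω ∧ ∀ l ∈ Set.Ioo (0:ℝ) 1, ∀ a b : Euc n → ℝ, SF a → SF b → Close a δ → Close b δ →
      Close (fun x => combP p l (a x) (b x)) ((5 + 80 * (1-p)) * ω) := by
  have cont : ContinuousAt (fun t : ℝ => t^(p-1)) 1 := Real.continuousAt_rpow_const _ _ (Or.inl one_ne_zero)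
  rw [Metric.continuousAt_iff] at cont
  obtain ⟨r, r0, hr⟩ := cont ω hω
  refine ⟨min ω (r/4), by positivity, min_le_left _ _, ?_⟩
  intro l hl a b A B ca cb u hu
  set δ := min ω (r/4)
  have δω : δ ≤ ω := min_le_left _ _
  have δr : δ ≤ r/4 := min_le_right _ _
  have hu0 : u ≠ 0 := by intro h; simp [h] at hu
  have ha := A.pos_of_close ca (by linarith)
  have hb := B.pos_of_close cb (by linarith)
  obtain ⟨a1, a2, a3⟩ := ca u hu
  obtain ⟨b1, b2, b3⟩ := cb u hu
  have a1' := abs_lt.1 a1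
  have b1' := abs_lt.1 b1
  have δ0 : 0 < δ := (abs_nonneg _).trans_lt a1
  set h : Euc n → ℝ := fun x => combP p l (a x) (b x) with hh
  have hup : h u ≤ 1 + δ := combP_le hl (ha u hu0) (hb u hu0) (by linarith) (by linarith)
  have hlo : 1 - δ ≤ h u := le_combP hl (by linarith) (by linarith) (by linarith)
  have h1 : |h u - 1| ≤ δ := abs_le.2 ⟨by linarith, by linarith⟩
  have hpos : 0 < h u := by linarith
  have hrat : ∀ s : ℝ, |s - 1| < δ → |(s / h u)^(p-1) - 1| ≤ ω := fun s hs => by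
    have hs' := abs_lt.1 hs
    have := hr (x := s / h u) (by
      rw [Real.dist_eq, abs_lt]
      constructor
      · rw [lt_sub_iff_add_lt, lt_div_iff₀ hpos]; nlinarith
      · rw [sub_lt_iff_lt_add, div_lt_iff₀ hpos]; nlinarith)
    rw [Real.dist_eq, Real.one_rpow] at this
    exact this.le
  have l0 := hl.1
  have l1 : 0 < 1 - l := by linarith [hl.2]
  have wa := abs_le.1 (hrat _ a1)
  have wb := abs_le.1 (hrat _ b1)
  have eg : gradient h u = wt p (1-l) (a u) (h u) • gradient a u + wt p l (b u) (h u) • gradient b u :=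
    grad_comb A B ha hb p l hl hu0
  have eH := Hs_comb A B ha hb p l hl hu0 h hh
  unfold wt at eg eH
  generalize (a u / h u)^(p-1) = qa at *
  generalize (b u / h u)^(p-1) = qb at *
  set α := (1-l) * qa with hα
  set β := l * qb with hβ
  have α0 : 0 ≤ α := mul_nonneg l1.le (by linarith)
  have β0 : 0 ≤ β := mul_nonneg l0.le (by linarith)
  have αβ : α + β ≤ 1 + ω := by rw [hα, hβ]; nlinarith
  have αβ' : 1 - ω ≤ α + β := by rw [hα, hβ]; nlinarith
  have αβ2 : α + β ≤ 2 := by linarith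
  have hs1 : |α + β - 1| ≤ ω := abs_le.2 ⟨by linarith, by linarith⟩
  have g1 : ‖gradient h u - u‖ ≤ 3 * ω := by
    have : gradient h u - u = α • (gradient a u - u) + β • (gradient b u - u) + (α + β - 1) • u := by
      rw [eg]; module
    rw [this]
    refine (norm_add₃_le).trans ?_
    rw [norm_smul, norm_smul, norm_smul, Real.norm_of_nonneg α0, Real.norm_of_nonneg β0, Real.norm_eq_abs, hu]
    nlinarith
  have gh : ‖(h u)⁻¹ • gradient h u - u‖ ≤ 8 * ω :=
    (ratio_close hu g1 (h1.trans δω) (by linarith)).trans (by linarith)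
  have ga : ‖(a u)⁻¹ • gradient a u - u‖ ≤ 4 * ω :=
    (ratio_close hu (a2.le.trans δω) (a1.le.trans δω) (by linarith)).trans (by linarith)
  have gb : ‖(b u)⁻¹ • gradient b u - u‖ ≤ 4 * ω :=
    (ratio_close hu (b2.le.trans δω) (b1.le.trans δω) (by linarith)).trans (by linarith)
  have pos1 : 0 < 1 - p := by linarith
  have C0 : 5 * ω ≤ (5 + 80 * (1-p)) * ω := by nlinarith
  refine ⟨by linarith, by linarith, fun i k => ?_⟩
  have na : |gradient a u i| ≤ 2 := by
    refine (PiLp.norm_apply_le (gradient a u) i).trans ?_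
    have : ‖gradient a u‖ ≤ ‖gradient a u - u‖ + ‖u‖ := by simpa using norm_add_le (gradient a u - u) u
    linarith
  have nb : |gradient b u i| ≤ 2 := by
    refine (PiLp.norm_apply_le (gradient b u) i).trans ?_
    have : ‖gradient b u‖ ≤ ‖gradient b u - u‖ + ‖u‖ := by simpa using norm_add_le (gradient b u - u) u
    linarith
  have nda : |(h u)⁻¹ * gradient h u k - (a u)⁻¹ * gradient a u k| ≤ 12 * ω := by
    have e : (h u)⁻¹ * gradient h u k - (a u)⁻¹ * gradient a u k =
       (((h u)⁻¹ • gradient h u - u) - ((a u)⁻¹ • gradient a u - u)) k := by simp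
    rw [e]
    refine (PiLp.norm_apply_le (((h u)⁻¹ • gradient h u - u) - ((a u)⁻¹ • gradient a u - u)) k).trans ?_
    refine (norm_sub_le _ _).trans ?_
    linarith
  have ndb : |(h u)⁻¹ * gradient h u k - (b u)⁻¹ * gradient b u k| ≤ 12 * ω := by
    have e : (h u)⁻¹ * gradient h u k - (b u)⁻¹ * gradient b u k =
       (((h u)⁻¹ • gradient h u - u) - ((b u)⁻¹ • gradient b u - u)) k := by simp
    rw [e]
    refine (PiLp.norm_apply_le (((h u)⁻¹ • gradient h u - u) - ((b u)⁻¹ • gradient b u - u)) k).trans ?_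
    refine (norm_sub_le _ _).trans ?_
    linarith
  rw [eH i k]
  generalize (h u)⁻¹ * gradient h u k - (a u)⁻¹ * gradient a u k = Da at *
  generalize (h u)⁻¹ * gradient h u k - (b u)⁻¹ * gradient b u k = Db at *
  generalize gradient a u i = Ga at *
  generalize gradient b u i = Gb at *
  have a3 := a3 i k
  have b3 := b3 i k
  have HH := H0_le u hu i k
  generalize H0 (u : Fin n → ℝ) i k = Z at *
  generalize Hs a u i k = Ya at *
  generalize Hs b u i k = Yb at *
  have e : α * Ya + β * Yb + Ga * ((1-p) * α * Da) + Gb * ((1-p) * β * Db) - Z =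
      α * (Ya - Z) + β * (Yb - Z) + (α + β - 1) * Z + (1-p) * α * (Ga * Da) + (1-p) * β * (Gb * Db) := by ring
  rw [e]
  have t1 : |α * (Ya - Z)| ≤ α * ω := by
    rw [abs_mul, abs_of_nonneg α0]; exact mul_le_mul_of_nonneg_left (by linarith) α0
  have t2 : |β * (Yb - Z)| ≤ β * ω := by
    rw [abs_mul, abs_of_nonneg β0]; exact mul_le_mul_of_nonneg_left (by linarith) β0
  have t3 : |(α + β - 1) * Z| ≤ ω * 2 := by
    rw [abs_mul]; exact mul_le_mul hs1 HH (abs_nonneg _) hω.le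
  have t4 : |(1-p) * α * (Ga * Da)| ≤ (1-p) * α * (2 * (12 * ω)) := by
    rw [abs_mul, abs_of_nonneg (by positivity : 0 ≤ (1-p) * α), abs_mul Ga]
    exact mul_le_mul_of_nonneg_left (mul_le_mul na nda (abs_nonneg _) (by norm_num)) (by positivity)
  have t5 : |(1-p) * β * (Gb * Db)| ≤ (1-p) * β * (2 * (12 * ω)) := by
    rw [abs_mul, abs_of_nonneg (by positivity : 0 ≤ (1-p) * β), abs_mul Gb]
    exact mul_le_mul_of_nonneg_left (mul_le_mul nb ndb (abs_nonneg _) (by norm_num)) (by positivity)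
  have s1 : |α * (Ya - Z) + β * (Yb - Z) + (α + β - 1) * Z + (1-p) * α * (Ga * Da) + (1-p) * β * (Gb * Db)| ≤
      α * ω + β * ω + ω * 2 + (1-p) * α * (2 * (12 * ω)) + (1-p) * β * (2 * (12 * ω)) := by
    refine (abs_add_le _ _).trans (add_le_add ((abs_add_le _ _).trans (add_le_add ((abs_add_le _ _).trans (add_le_add ((abs_add_le _ _).trans (add_le_add t1 t2)) t3)) t4)) t5)
  refine s1.trans_lt ?_
  have q1 : (α + β) * ω ≤ 2 * ω := mul_le_mul_of_nonneg_right αβ2 hω.le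
  have q2 : (1-p) * ((α + β) * ω) ≤ (1-p) * (2 * ω) := mul_le_mul_of_nonneg_left q1 pos1.le
  have q3 : 0 < (1-p) * ω := by positivity
  nlinarith

lemma Close_comb {n : ℕ} (p : ℝ) (hp1 : p < 1) (ε : ℝ) (hε : 0 < ε) :
    ∃ δ : ℝ, 0 < δ ∧ δ < 1 ∧ ∀ l ∈ Set.Ioo (0:ℝ) 1, ∀ a b : Euc n → ℝ, SF a → SF b → Close a δ → Close b δ →
      Close (fun x => combP p l (a x) (b x)) ε := by
  have pos1 : 0 < 1 - p := by linarith
  have C : 0 < 5 + 80 * (1-p) := by positivity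
  obtain ⟨δ, δ0, δ1, h⟩ := Close_comb_aux (n := n) p hp1 (min (1/9) (ε / (5 + 80 * (1-p)))) (by positivity)
    ((min_le_left _ _).trans_lt (by norm_num))
  refine ⟨δ, δ0, (δ1.trans (min_le_left _ _)).trans_lt (by norm_num), fun l hl a b A B ca cb => (h l hl a b A B ca cb).mono ?_⟩
  calc _ ≤ (5 + 80 * (1-p)) * (ε / (5 + 80 * (1-p))) := by gcongr; exact min_le_right _ _
    _ = ε := by field_simp

lemma SF.mulVec_hs {n : ℕ} {h : Euc n → ℝ} (H : SF h) (x : Euc n) (hx : x ≠ 0) :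
    Hs h x *ᵥ (x : Fin n → ℝ) = 0 := by
  have h1 : HasDerivAt (fun t : ℝ => gradient h (t • x)) (fderiv ℝ (gradient h) x x) 1 := by
    have h0 : HasDerivAt (fun t : ℝ => t • x) ((1:ℝ) • x) 1 := (hasDerivAt_id (1:ℝ)).smul_const x
    rw [one_smul] at h0
    have hg : HasFDerivAt (gradient h) (fderiv ℝ (gradient h) x) ((1:ℝ) • x) := by
      rw [one_smul]; exact (H.gdiff hx).hasFDerivAt
    exact hg.comp_hasDerivAt (1:ℝ) h0
  have h2 : HasDerivAt (fun t : ℝ => gradient h (t • x)) 0 1 := by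
    refine (hasDerivAt_const (1:ℝ) (gradient h x)).congr_of_eventuallyEq ?_
    filter_upwards [lt_mem_nhds (show (0:ℝ) < 1 by norm_num)] with t ht
    exact H.g_hom t ht x hx
  have h3 := h1.unique h2
  ext i
  rw [Hs, Jac, ← matOf_mulVec, h3]; simp

lemma SF.quad_nonneg {n : ℕ} {h : Euc n → ℝ} (H : SF h) {ε : ℝ} (c : Close h ε) (hε : n * ε ≤ 1)
    (x : Euc n) (hx : x ≠ 0) (v : Fin n → ℝ) : 0 ≤ v ⬝ᵥ (Hs h x *ᵥ v) := by
  have key : ∀ u : Euc n, ‖u‖ = 1 → 0 ≤ v ⬝ᵥ (Hs h u *ᵥ v) := by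
    intro u hu
    have hu0 : u ≠ 0 := by intro h; simp [h] at hu
    have h1 := H.mulVec_hs u hu0
    have h2 := H.vecMul_hs u hu0
    obtain ⟨c1, -, c3⟩ := c u hu
    have ε0 : 0 ≤ ε := (abs_nonneg _).trans c1.le
    set U : Fin n → ℝ := u.ofLp with hU
    have hUU : U ⬝ᵥ U = 1 := dot_self_of_norm u hu
    set w := v - (U ⬝ᵥ v) • U with hw
    have hv : v = w + (U ⬝ᵥ v) • U := by rw [hw]; abel
    have hUw : U ⬝ᵥ w = 0 := by rw [hw, dotProduct_sub, dotProduct_smul, hUU]; simp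
    have e1 : v ⬝ᵥ (Hs h u *ᵥ v) = w ⬝ᵥ (Hs h u *ᵥ w) := by
      conv_lhs => rw [hv]
      rw [mulVec_add, mulVec_smul, h1, smul_zero, add_zero, add_dotProduct, smul_dotProduct,
        dotProduct_mulVec U, h2]
      simp
    have e2 := quad_bd (Hs h u - H0 U) ε ε0 (fun i k => (c3 i k).le) w
    have e3 : w ⬝ᵥ (H0 U *ᵥ w) = w ⬝ᵥ w := by
      rw [H0, sub_mulVec, one_mulVec, vecMulVec_mulVec, hUw]; simp
    rw [sub_mulVec, dotProduct_sub, e3] at e2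
    have ww : 0 ≤ w ⬝ᵥ w := Finset.sum_nonneg fun i _ => mul_self_nonneg _
    have := (abs_le.1 e2).1
    rw [e1]
    nlinarith
  have hxn : 0 < ‖x‖ := norm_pos_iff.2 hx
  have h1 := H.hs_hom ‖x‖⁻¹ (inv_pos.2 hxn) x hx
  have h2 := key _ (norm_unit hx)
  rw [h1, inv_inv, smul_mulVec, dotProduct_smul, smul_eq_mul] at h2
  exact (mul_nonneg_iff_of_pos_left hxn).1 h2

lemma SF.seg_deriv {n : ℕ} {h : Euc n → ℝ} (H : SF h) (x d : Euc n) (t : ℝ) (ht : x + t • d ≠ 0) :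
    HasDerivAt (fun t : ℝ => h (x + t • d)) ⟪gradient h (x + t • d), d⟫ t ∧
    HasDerivAt (fun t : ℝ => ⟪gradient h (x + t • d), d⟫) ((d : Fin n → ℝ) ⬝ᵥ (Hs h (x + t • d) *ᵥ (d : Fin n → ℝ))) t := by
  have h0 : HasDerivAt (fun t : ℝ => x + t • d) d t := by
    simpa using ((hasDerivAt_id t).smul_const d).const_add x
  constructor
  · have := (H.diff ht).hasFDerivAt.comp_hasDerivAt t h0
    rw [inner_gradient_left]; exact this
  · have := ((H.gdiff ht).hasFDerivAt.comp_hasDerivAt t h0).inner ℝ (hasDerivAt_const t d)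
    refine this.congr_deriv ?_
    rw [inner_zero_right, zero_add, inner_eq_dot, dotProduct_comm]
    congr 1
    ext i
    exact matOf_mulVec _ _ _

lemma SF.grad_le {n : ℕ} {h : Euc n → ℝ} (H : SF h) {ε : ℝ} (c : Close h ε) (hε : n * ε ≤ 1) (hε1 : ε ≤ 1)
    (x : Euc n) (hx : x ≠ 0) (u : Euc n) (hu : u ≠ 0) : ⟪gradient h x, u⟫ ≤ h u := by
  by_cases hs : ∀ t ∈ Set.Icc (0:ℝ) 1, x + t • (u - x) ≠ 0
  · set d := u - x with hd
    obtain ⟨c, hc, e1⟩ := exists_hasDerivAt_eq_slope (fun t : ℝ => h (x + t • d))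
      (fun t => ⟪gradient h (x + t • d), d⟫) (show (0:ℝ) < 1 by norm_num)
      (fun t ht => (H.seg_deriv x d t (hs t ht)).1.continuousAt.continuousWithinAt)
      (fun t ht => (H.seg_deriv x d t (hs t ⟨ht.1.le, ht.2.le⟩)).1)
    obtain ⟨e, he, e2⟩ := exists_hasDerivAt_eq_slope (fun t => ⟪gradient h (x + t • d), d⟫)
      (fun t => ((d : Fin n → ℝ) ⬝ᵥ (Hs h (x + t • d) *ᵥ (d : Fin n → ℝ)))) hc.1
      (fun t ht => (H.seg_deriv x d t (hs t ⟨ht.1, ht.2.trans hc.2.le⟩)).2.continuousAt.continuousWithinAt)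
      (fun t ht => (H.seg_deriv x d t (hs t ⟨ht.1.le, ht.2.le.trans hc.2.le⟩)).2)
    have q := H.quad_nonneg (by assumption) hε (x + e • d) (hs e ⟨he.1.le, he.2.le.trans hc.2.le⟩) d
    rw [e2] at q
    have q2 := q
    rw [le_div_iff₀ (by linarith [hc.1]), zero_mul] at q2
    simp only [zero_smul, one_smul, add_zero, sub_zero, div_one] at q2 e1
    have e3 : x + d = u := by rw [hd]; abel
    rw [e1, e3, hd, inner_sub_right] at q2
    have := H.euler x hx
    rw [real_inner_comm] at this
    linarith
  · push Not at hs
    obtain ⟨t, ht, e⟩ := hs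
    have ht0 : 0 < t := by
      rcases ht.1.lt_or_eq with h | h
      · exact h
      · exfalso; rw [← h] at e; simp at e; exact hx e
    have ht1 : t < 1 := by
      rcases ht.2.lt_or_eq with h | h
      · exact h
      · exfalso; rw [h] at e; simp at e; exact hu e
    have hu' : u = (-((1-t)/t)) • x := by
      have : t • u = -((1-t) • x) := by
        have e4 : t • u + (1-t) • x = 0 := by rw [← e]; module
        exact eq_neg_of_add_eq_zero_left e4
      calc u = t⁻¹ • (t • u) := by rw [smul_smul, inv_mul_cancel₀ ht0.ne', one_smul]
        _ = _ := by rw [this]; module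
    have hq : 0 < (1-t)/t := div_pos (by linarith) ht0
    have e5 := H.euler x hx
    rw [real_inner_comm] at e5
    have p := H.pos_of_close c hε1 u hu
    have p' := H.pos_of_close c hε1 x hx
    have : ⟪gradient h x, u⟫ = -((1-t)/t) * h x := by rw [hu', inner_smul_right, e5]
    rw [this]
    nlinarith [mul_pos hq p']

lemma wulff_compact {n : ℕ} {h : Euc n → ℝ} {ε : ℝ} (c : Close h ε) (hε1 : ε ≤ 1) : IsCompact (wulff h) := by
  refine Metric.isCompact_of_isClosed_isBounded ?_ ?_
  · have : wulff h = ⋂ u : Euc n, ⋂ (_ : ‖u‖ = 1), {x | ⟪x, u⟫ ≤ h u} := by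
      ext x; simp [wulff]
    rw [this]
    exact isClosed_iInter fun u => isClosed_iInter fun _ =>
      isClosed_le (by fun_prop) continuous_const
  · refine (isBounded_iff_forall_norm_le).2 ⟨2, fun x hx => ?_⟩
    by_cases h0 : x = 0
    · simp [h0]
    have hu := norm_unit h0
    have h1 := hx _ hu
    have h2 := (abs_lt.1 (c _ hu).1).2
    rw [inner_smul_right, real_inner_self_eq_norm_sq] at h1
    have : ‖x‖⁻¹ * ‖x‖^2 = ‖x‖ := by
      have := norm_ne_zero_iff.2 h0
      field_simp
    linarith

lemma wulff_convex {n : ℕ} (h : Euc n → ℝ) : Convex ℝ (wulff h) := by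
  intro x hx y hy a b ha hb hab u hu
  rw [inner_add_left, inner_smul_left, inner_smul_left]
  have h1 := mul_le_mul_of_nonneg_left (hx u hu) ha
  have h2 := mul_le_mul_of_nonneg_left (hy u hu) hb
  simp only [conj_trivial]
  have : h u = a * h u + b * h u := by rw [← add_mul, hab, one_mul]
  linarith

lemma wulff_zero_mem {n : ℕ} {h : Euc n → ℝ} {ε : ℝ} (c : Close h ε) (hε1 : ε ≤ 1) : (0 : Euc n) ∈ wulff h := by
  intro u hu
  have := (abs_lt.1 (c u hu).1).1
  simp; linarith

lemma wulff_supp {n : ℕ} {h : Euc n → ℝ} (H : SF h) {ε : ℝ} (c : Close h ε) (hε : n * ε ≤ 1) (hε1 : ε ≤ 1) :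
    suppFn (wulff h) = h := by
  have hne : (wulff h).Nonempty := ⟨0, wulff_zero_mem c hε1⟩
  have hc := wulff_compact c hε1
  ext x
  by_cases hx : x = 0
  · subst hx
    rw [H.zero]
    obtain ⟨y, hy, e⟩ := exists_suppFn hc hne 0
    rw [← e]; simp
  refine le_antisymm (suppFn_le hne fun y hy => ?_) ?_
  · have h1 := hy _ (norm_unit hx)
    rw [H.eq_norm_mul hx]
    rw [inner_smul_right, real_inner_comm] at h1
    have hxn : 0 < ‖x‖ := norm_pos_iff.2 hx
    rwa [inv_mul_le_iff₀ hxn] at h1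
  · rw [← H.euler x hx]
    refine le_suppFn hc x fun u hu => ?_
    exact H.grad_le c hε hε1 x hx u (by intro h; simp [h] at hu)

lemma rhs_eq {p l x y : ℝ} {j : ℕ} (hj : j ≠ 0) (hl : l ∈ Set.Ioo (0:ℝ) 1) (hx : 0 < x) (hy : 0 < y) :
    (if p = 0 then (x^j) ^ (1 - l) * (y^j) ^ l
      else ((1 - l) * (x^j) ^ (p / j) + l * (y^j) ^ (p / j)) ^ ((j : ℝ) / p)) = combP p l x y ^ j := by
  have hj' : (j:ℝ) ≠ 0 := by exact_mod_cast hj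
  have l0 := hl.1
  have l1 : 0 < 1 - l := by linarith [hl.2]
  unfold combP
  split_ifs with hp
  · rw [mul_pow, ← Real.rpow_natCast (x^(1-l)), ← Real.rpow_natCast (y^l), ← Real.rpow_mul hx.le, ← Real.rpow_mul hy.le,
      ← Real.rpow_natCast_mul hx.le, ← Real.rpow_natCast_mul hy.le, mul_comm (1-l), mul_comm l]
  · rw [← Real.rpow_natCast_mul hx.le, ← Real.rpow_natCast_mul hy.le, mul_div_cancel₀ _ hj', ← Real.rpow_natCast (_ ^ (1/p)),
      ← Real.rpow_mul (by positivity), one_div, inv_mul_eq_div]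

lemma combP_mono_eq {p l x y x' y' : ℝ} (hl : l ∈ Set.Ioo (0:ℝ) 1) (hx : 0 < x) (hy : 0 < y) (hxx : x ≤ x') (hyy : y ≤ y') :
    combP p l x y ≤ combP p l x' y' ∧ (combP p l x y = combP p l x' y' → x = x' ∧ y = y') := by
  have hx' := hx.trans_le hxx
  have hy' := hy.trans_le hyy
  have l0 := hl.1
  have l1 : 0 < 1 - l := by linarith [hl.2]
  have h1 := (Tp_le_iff (p := p) hx hx').2 hxx
  have h2 := (Tp_le_iff (p := p) hy hy').2 hyy
  constructor
  · rw [← Tp_le_iff (p := p) (combP_pos hl hx hy) (combP_pos hl hx' hy'), combP_Tp hl hx hy, combP_Tp hl hx' hy']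
    nlinarith
  · intro e
    have e := congrArg (Tp p) e
    rw [combP_Tp hl hx hy, combP_Tp hl hx' hy'] at e
    constructor
    · apply Tp_inj (p := p) hx hx'
      have : (1-l) * Tp p x' ≤ (1-l) * Tp p x := by nlinarith
      exact le_antisymm h1 (le_of_mul_le_mul_left this l1)
    · apply Tp_inj (p := p) hy hy'
      have : l * Tp p y' ≤ l * Tp p y := by nlinarith
      exact le_antisymm h2 (le_of_mul_le_mul_left this l0)

lemma subset_of_supp {n : ℕ} {K L : Set (Euc n)} (hK : IsCompact K) (hL : IsCompact L) (hLc : Convex ℝ L)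
    (hne : L.Nonempty) (h : ∀ x, suppFn K x ≤ suppFn L x) : K ⊆ L := by
  intro y hy
  by_contra hyL
  obtain ⟨f, u, h1, h2⟩ := geometric_hahn_banach_closed_point hLc hL.isClosed hyL
  set v : Euc n := (InnerProductSpace.toDual ℝ (Euc n)).symm f
  have hv : ∀ z, ⟪v, z⟫ = f z := fun z => by simp [v]
  have a1 : suppFn L v ≤ u := suppFn_le hne fun z hz => by rw [hv]; exact (h1 z hz).le
  have a2 := le_suppFn hK v hy
  rw [hv] at a2
  linarith [h v]

lemma suppFn_smul_set {n : ℕ} {K : Set (Euc n)} (hK : IsCompact K) (hne : K.Nonempty) {c : ℝ} (hc : 0 < c) (x : Euc n) :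
    suppFn (c • K) x = c * suppFn K x := by
  apply le_antisymm
  · refine suppFn_le (hne.smul_set) ?_
    rintro _ ⟨y, hy, rfl⟩
    simp only [inner_smul_right]
    exact mul_le_mul_of_nonneg_left (le_suppFn hK x hy) hc.le
  · obtain ⟨y, hy, e⟩ := exists_suppFn hK hne x
    rw [← e, ← inner_smul_right]
    exact le_suppFn (hK.smul c) x (Set.smul_mem_smul_set hy)

lemma core {n m : ℕ} (hm : m + 2 ≤ n - 1) (p : ℝ) (hp1 : p < 1)
    (hp : (1-p)*((n:ℝ)-1) < (n+1)*(m+1)) :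
    ∃ δ : ℝ, 0 < δ ∧ δ < 1/4 ∧ ∀ l ∈ Set.Ioo (0:ℝ) 1, ∀ h a b : Euc n → ℝ, SF h → SF a → SF b →
      Close h δ → Close a δ → Close b δ → (∀ u, h u = combP p l (a u) (b u)) →
      ∀ x y z : ℝ, 0 < x → 0 < y → 0 < z → x^(m+2) = Wf (m+2) a → y^(m+2) = Wf (m+2) b → z^(m+2) = Wf (m+2) h →
      combP p l x y ≤ z ∧ (combP p l x y = z → ∃ s t : ℝ, 0 < s ∧ 0 < t ∧ ∀ u : Euc n, ‖u‖ = 1 →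
        a u = s * h u ∧ b u = t * h u) := by
  obtain ⟨δ, δ0, δ4, KS⟩ := key_scaled hm p hp1 hp
  refine ⟨δ, δ0, δ4, ?_⟩
  intro l hl h a b H A B ch ca cb hcomb x y z hx hy hz ex ey ez
  obtain ⟨I0, s, s0, es, ls, qs⟩ := KS h a H A ch ca
  obtain ⟨-, t, t0, et, lt, qt⟩ := KS h b H B ch cb
  have hpos := H.pos_of_close ch (by linarith)
  have apos := A.pos_of_close ca (by linarith)
  have bpos := B.pos_of_close cb (by linarith)
  have cq : ∀ f : Euc n → ℝ, SF f → (∀ x, x ≠ 0 → 0 < f x) →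
      Integrable (fun u : sphere (0 : Euc n) 1 => h u * Tp p (f u / h u) * esym (m+1) (Hs h u)) (sgm n) := by
    intro f F fpos
    refine cint ?_
    have c1 : Continuous fun u : sphere (0 : Euc n) 1 => h u := cont_sph H.c2.continuousOn
    have c2 : Continuous fun u : sphere (0 : Euc n) 1 => f u := cont_sph F.c2.continuousOn
    have c3 : Continuous fun u : sphere (0 : Euc n) 1 => Tp p (f u / h u) := by
      rw [continuous_iff_continuousAt]
      intro u
      have p1 := hpos u (sph_ne u)
      have p2 := fpos u (sph_ne u)
      exact ContinuousAt.comp (g := Tp p) (f := fun u : sphere (0 : Euc n) 1 => f u / h u)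
        (Tp_deriv p (div_pos p2 p1)).continuousAt (c2.continuousAt.div c1.continuousAt p1.ne')
    exact (c1.mul c3).mul ((continuous_esym (m+1)).comp (cont_sph H.hs_cont))
  have sum0 : (1-l) * Tp p s + l * Tp p t = 0 := by
    have e : ((1-l) * Tp p s + l * Tp p t) * ∫ u : sphere (0 : Euc n) 1, h u * esym (m+1) (Hs h u) ∂(sgm n) = 0 := by
      calc _ = (1-l) * (Tp p s * ∫ u : sphere (0 : Euc n) 1, h u * esym (m+1) (Hs h u) ∂(sgm n)) +
            l * (Tp p t * ∫ u : sphere (0 : Euc n) 1, h u * esym (m+1) (Hs h u) ∂(sgm n)) := by ring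
        _ = 0 := by
          rw [es, et, ← integral_const_mul, ← integral_const_mul,
            ← integral_add ((cq a A apos).const_mul _) ((cq b B bpos).const_mul _)]
          refine integral_eq_zero_of_ae (Filter.Eventually.of_forall fun u => ?_)
          have p1 := hpos u (sph_ne u)
          have p2 := apos u (sph_ne u)
          have p3 := bpos u (sph_ne u)
          have q : (1-l) * Tp p (a u / h u) + l * Tp p (b u / h u) = 0 := by
            rw [← combP_Tp hl (div_pos p2 p1) (div_pos p3 p1), combP_div hl p2 p3 p1, ← hcomb, div_self p1.ne', Tp_one]
          show (1-l) * (h u * Tp p (a u / h u) * esym (m+1) (Hs h u)) + l * (h u * Tp p (b u / h u) * esym (m+1) (Hs h u)) = 0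
          linear_combination (h u * esym (m+1) (Hs h u)) * q
    exact (mul_eq_zero.1 e).resolve_right I0.ne'
  have c1 : combP p l s t = 1 := by
    apply Tp_inj (p := p) (combP_pos hl s0 t0) one_pos
    rw [combP_Tp hl s0 t0, sum0, Tp_one]
  have xs : x ≤ z * s := by
    refine le_of_pow_le_pow_left₀ (n := m+2) (by omega) (by positivity) ?_
    rw [mul_pow, ex, ez, mul_comm]; exact ls
  have yt : y ≤ z * t := by
    refine le_of_pow_le_pow_left₀ (n := m+2) (by omega) (by positivity) ?_
    rw [mul_pow, ey, ez, mul_comm]; exact lt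
  have main := combP_mono_eq (p := p) hl hx hy xs yt
  rw [combP_mul hl s0 t0 hz, c1, mul_one] at main
  refine ⟨main.1, fun e => ⟨s, t, s0, t0, fun u hu => ?_⟩⟩
  obtain ⟨e1, e2⟩ := main.2 e
  refine ⟨qs ?_ u hu, qt ?_ u hu⟩
  · rw [← ex, e1, mul_pow, ez, mul_comm]
  · rw [← ey, e2, mul_pow, ez, mul_comm]

lemma exists_root {j : ℕ} (hj : j ≠ 0) {W : ℝ} (hW : 0 < W) : ∃ x : ℝ, 0 < x ∧ x^j = W :=
  ⟨W ^ ((j:ℝ)⁻¹), by positivity, Real.rpow_inv_natCast_pow hW.le hj⟩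

lemma kappa_pos (d : ℕ) : 0 < kappa d := by
  unfold kappa
  exact ENNReal.toReal_pos (measure_ball_pos volume 0 one_pos).ne' measure_ball_lt_top.ne

lemma V_eq {n : ℕ} (hn : 1 ≤ n) {V : ℕ → Set (Euc n) → ℝ} (hV : steiner n V)
    {K : Set (Euc n)} (hK : IsCompact K) (hcv : Convex ℝ K)
    (hne : K.Nonempty) (S : SF (suppFn K)) (j : ℕ) (hj : j < n) :
    V j K = (kappa (n - j) * ((n:ℝ) - j))⁻¹ * Wf j (suppFn K) := by
  have h := steiner_coeff hn hV hK hcv hne S j hj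
  have k := kappa_pos (n - j)
  have q : (0:ℝ) < (n:ℝ) - j := by
    have : (j:ℝ) < n := by exact_mod_cast hj
    linarith
  field_simp at h ⊢
  linarith

/-- Local `L_p`-Brunn-Minkowski inequality for intrinsic volumes near the ball, for
`(2n - j - nj)/(n-1) < p < 1`, with equality exactly for dilates. -/
theorem local_Lp_BM_intrinsic (n j : ℕ) (hn : 3 ≤ n) (hj2 : 2 ≤ j) (hjn : j ≤ n - 1)
    (p : ℝ) (hp : (2 * n - j - n * j : ℝ) / ((n : ℝ) - 1) < p) (hp1 : p < 1) :
    ∃ δ : ℝ, 0 < δ ∧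
      ∀ (V : ℕ → Set (Euc n) → ℝ), steiner n V →
      ∀ lam : ℝ, lam ∈ Set.Ioo (0 : ℝ) 1 →
      ∀ K L : Set (Euc n),
        IsCompact K → Convex ℝ K → (interior K).Nonempty → (∀ x ∈ K, -x ∈ K) →
        ContDiffOn ℝ 2 (suppFn K) {(0 : Euc n)}ᶜ →
        IsCompact L → Convex ℝ L → (interior L).Nonempty → (∀ x ∈ L, -x ∈ L) →
        ContDiffOn ℝ 2 (suppFn L) {(0 : Euc n)}ᶜ →
        C2Close n K δ → C2Close n L δ →
        (if p = 0 then V j K ^ (1 - lam) * V j L ^ lam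
          else ((1 - lam) * V j K ^ (p / j) + lam * V j L ^ (p / j)) ^ ((j : ℝ) / p))
          ≤ V j (wulff (fun u => combP p lam (suppFn K u) (suppFn L u))) ∧
        ((if p = 0 then V j K ^ (1 - lam) * V j L ^ lam
          else ((1 - lam) * V j K ^ (p / j) + lam * V j L ^ (p / j)) ^ ((j : ℝ) / p))
            = V j (wulff (fun u => combP p lam (suppFn K u) (suppFn L u)))
          ↔ ∃ c : ℝ, 0 < c ∧ L = c • K) := by
  obtain ⟨m, rfl⟩ : ∃ m, j = m + 2 := ⟨j - 2, by omega⟩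
  have hn3 : (3:ℝ) ≤ n := by exact_mod_cast hn
  have hp' : (1-p)*((n:ℝ)-1) < (n+1)*(m+1) := by
    rw [div_lt_iff₀ (by linarith)] at hp
    push_cast at hp
    nlinarith
  obtain ⟨d1, d10, d14, CO⟩ := core hjn p hp1 hp'
  obtain ⟨d2, d20, WP⟩ := W_pos (n := n) (k := m+2) hjn (by omega)
  set ε := min d1 (min d2 (1/n)) with hε
  have ε0 : 0 < ε := by positivity
  have ε1 : ε ≤ d1 := min_le_left _ _
  have ε2 : ε ≤ d2 := (min_le_right _ _).trans (min_le_left _ _)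
  have ε3 : ε ≤ 1/n := (min_le_right _ _).trans (min_le_right _ _)
  have ε4 : n * ε ≤ 1 := by
    rw [le_div_iff₀ (by linarith)] at ε3; linarith
  obtain ⟨d3, d30, d31, CC⟩ := Close_comb (n := n) p hp1 ε ε0
  refine ⟨min ε d3, by positivity, ?_⟩
  intro V hV l hl K L hK hKc hKi hKs hKd hL hLc hLi hLs hLd cK cL
  have hKn : K.Nonempty := hKi.mono interior_subset
  have hLn : L.Nonempty := hLi.mono interior_subset
  have A := suppFn_SF hK hKn hKs hKd
  have B := suppFn_SF hL hLn hLs hLd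
  have ca := Close_of_C2 A cK
  have cb := Close_of_C2 B cL
  have ca3 := ca.mono (min_le_right _ _)
  have cb3 := cb.mono (min_le_right _ _)
  have caε := ca.mono (min_le_left _ _)
  have cbε := cb.mono (min_le_left _ _)
  have apos := A.pos_of_close ca3 d31.le
  have bpos := B.pos_of_close cb3 d31.le
  have chε := CC l hl _ _ A B ca3 cb3
  have H := SF_comb A B apos bpos p l hl
  set h : Euc n → ℝ := fun x => combP p l (suppFn K x) (suppFn L x) with hh
  have ws : suppFn (wulff h) = h := wulff_supp H chε ε4 (by linarith)
  have hWcomp := wulff_compact chε (by linarith)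
  have hWn : (wulff h).Nonempty := ⟨0, wulff_zero_mem chε (by linarith)⟩
  obtain ⟨x, x0, ex⟩ := exists_root (j := m+2) (by omega) (WP _ A (caε.mono ε2))
  obtain ⟨y, y0, ey⟩ := exists_root (j := m+2) (by omega) (WP _ B (cbε.mono ε2))
  obtain ⟨z, z0, ez⟩ := exists_root (j := m+2) (by omega) (WP _ H (chε.mono ε2))
  have hmn : m + 2 < n := by omega
  have kpos : 0 < (kappa (n - (m+2)) * ((n:ℝ) - (m+2 : ℕ)))⁻¹ := by
    have k := kappa_pos (n - (m+2))
    have q : (0:ℝ) < (n:ℝ) - (m+2 : ℕ) := by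
      have : ((m+2 : ℕ):ℝ) < n := by exact_mod_cast hmn
      linarith
    positivity
  obtain ⟨k, k0, ek⟩ := exists_root (j := m+2) (by omega) kpos
  have vK : V (m+2) K = (k*x)^(m+2) := by
    rw [V_eq (by omega) hV hK hKc hKn A _ hmn, ← ek, ← ex, mul_pow]
  have vL : V (m+2) L = (k*y)^(m+2) := by
    rw [V_eq (by omega) hV hL hLc hLn B _ hmn, ← ek, ← ey, mul_pow]
  have vM : V (m+2) (wulff h) = (k*z)^(m+2) := by
    rw [V_eq (by omega) hV hWcomp (wulff_convex h) hWn (by rw [ws]; exact H) _ hmn, ws, ← ek, ← ez, mul_pow]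
  rw [vK, vL, vM, rhs_eq (by omega) hl (by positivity) (by positivity), combP_mul hl x0 y0 k0]
  have cpos := combP_pos (p := p) hl x0 y0
  obtain ⟨main, eqc⟩ := CO l hl h _ _ H A B (chε.mono ε1) (caε.mono ε1) (cbε.mono ε1) (fun _ => rfl) x y z x0 y0 z0 ex ey ez
  refine ⟨pow_le_pow_left₀ (by positivity) (mul_le_mul_of_nonneg_left main k0.le) _, ?_, ?_⟩
  · intro e
    have e1 := (pow_left_inj₀ (by positivity) (by positivity) (by omega)).1 e
    have e2 := mul_left_cancel₀ k0.ne' e1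
    obtain ⟨s, t, s0, t0, hst⟩ := eqc e2
    have c0 : 0 < t / s := by positivity
    have supp : ∀ v, suppFn L v = t / s * suppFn K v := by
      intro v
      by_cases hv : v = 0
      · rw [hv, A.zero, B.zero, mul_zero]
      · rw [A.eq_norm_mul hv, B.eq_norm_mul hv, (hst _ (norm_unit hv)).1, (hst _ (norm_unit hv)).2]
        field_simp
    refine ⟨t/s, c0, Set.Subset.antisymm ?_ ?_⟩
    · refine subset_of_supp hL (hK.smul _) (hKc.smul _) hKn.smul_set fun v => ?_
      rw [suppFn_smul_set hK hKn c0, supp]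
    · refine subset_of_supp (hK.smul _) hL hLc hLn fun v => ?_
      rw [suppFn_smul_set hK hKn c0, supp]
  · rintro ⟨c, c0, hLK⟩
    have supp : suppFn L = fun v => c * suppFn K v := by
      ext v; rw [hLK, suppFn_smul_set hK hKn c0]
    have hs0 := combP_pos (p := p) hl one_pos c0
    have eh : h = fun v => combP p l 1 c * suppFn K v := by
      ext v
      rw [hh]
      simp only [supp]
      by_cases hv : v = 0
      · rw [hv, A.zero, mul_zero, mul_zero, combP_zero hl]
      · have := combP_mul (p := p) hl one_pos c0 (apos v hv)
        rw [mul_one, mul_comm _ c] at this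
        rw [this, mul_comm]
    have e1 : y = c * x := by
      refine (pow_left_inj₀ (n := m+2) y0.le (by positivity) (by omega)).1 ?_
      rw [ey, supp, Wf_smul A, mul_pow, ex]
    have e2 : z = combP p l 1 c * x := by
      refine (pow_left_inj₀ (n := m+2) z0.le (by positivity) (by omega)).1 ?_
      rw [ez, eh, Wf_smul A, mul_pow, ex]
    have := combP_mul (p := p) hl one_pos c0 x0
    rw [mul_one, mul_comm _ c] at this
    rw [e1, e2, this, mul_comm x]

end
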